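/- The only solutions in integers (X, Y) of the equation Y^2 - Y = X^5 - X are (X,Y) = (-1,0), (-1,1), (0,0), (0,1), (1,0), (1,1), (2,-5), (2,6), (3,-15), (3,16), (30,-4929), (30,4930). -/

import Mathlib

namespace Skl

/-- evaluation of an integer coefficient list (low to high) -/
def ev {R : Type*} [CommRing R] (x : R) : List ℤ → R
  | [] => 0
  | a :: l => (a : R) + x * ev x l

def addL : List ℤ → List ℤ → List ℤ
  | [], m => m
  | a :: l, [] => a :: l
  | a :: l, b :: m => (a + b) :: addL l m

def smulL (c : ℤ) (l : List ℤ) : List ℤ := l.map (fun a => c * a)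

def modL (m : ℤ) (l : List ℤ) : List ℤ := l.map (fun a => a % m)

def mulL : List ℤ → List ℤ → List ℤ
  | [], _ => []
  | a :: l, m => addL (smulL a m) (0 :: mulL l m)

/-- multiplication by `x`, reducing with `x ^ (n+1) = ev x red` -/
def shiftL (red : List ℤ) (n : ℕ) (l : List ℤ) : List ℤ :=
  addL (0 :: l.take n) (mulL (l.drop n) red)

def mulM (red : List ℤ) (n : ℕ) (m : ℤ) : List ℤ → List ℤ → List ℤ
  | [], _ => []
  | a :: l, b => modL m (addL (smulL a b) (shiftL red n (mulM red n m l b)))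

section
variable {R : Type*} [CommRing R] (x : R)

@[simp] lemma ev_nil : ev x [] = 0 := rfl
@[simp] lemma ev_cons (a : ℤ) (l : List ℤ) : ev x (a :: l) = (a : R) + x * ev x l := rfl

@[simp] lemma ev_addL (l m : List ℤ) : ev x (addL l m) = ev x l + ev x m := by
  induction l generalizing m with
  | nil => simp [addL]
  | cons a l ih => cases m with
    | nil => simp [addL]
    | cons b m => simp [addL, ih]; ring

@[simp] lemma ev_smulL (c : ℤ) (l : List ℤ) : ev x (smulL c l) = (c : R) * ev x l := by
  induction l with
  | nil => simp [smulL]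
  | cons a l ih => simp only [smulL, List.map_cons, ev_cons] at *; rw [ih]; push_cast; ring

@[simp] lemma ev_mulL (l m : List ℤ) : ev x (mulL l m) = ev x l * ev x m := by
  induction l with
  | nil => simp [mulL]
  | cons a l ih => simp [mulL, ih]; ring

lemma ev_modL (k : ℤ) (l : List ℤ) : (k : R) ∣ ev x (modL k l) - ev x l := by
  induction l with
  | nil => simp [modL]
  | cons a l ih =>
    simp only [modL, List.map_cons, ev_cons] at *
    obtain ⟨c, hc⟩ := ih
    have h : ((a % k : ℤ) : R) = a - k * ((a / k : ℤ) : R) := by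
      have := Int.emod_add_mul_ediv a k
      have h2 : (a % k : ℤ) = a - k * (a / k) := by linarith
      rw [h2]; push_cast; ring
    rw [h]
    refine ⟨x * c - ((a / k : ℤ) : R), ?_⟩
    linear_combination x * hc

lemma ev_take_drop (n : ℕ) (l : List ℤ) :
    ev x l = ev x (l.take n) + x ^ n * ev x (l.drop n) := by
  induction n generalizing l with
  | zero => simp
  | succ n ih => cases l with
    | nil => simp
    | cons a l => simp only [List.take_succ_cons, List.drop_succ_cons, ev_cons]; rw [ih l]; ring

lemma ev_shiftL {red : List ℤ} {n : ℕ} (h : x ^ (n + 1) = ev x red) (l : List ℤ) :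
    ev x (shiftL red n l) = x * ev x l := by
  rw [ev_take_drop x n l]
  simp [shiftL, ← h]; ring

lemma ev_mulM {red : List ℤ} {n : ℕ} (h : x ^ (n + 1) = ev x red) (m : ℤ) (a b : List ℤ) :
    (m : R) ∣ ev x (mulM red n m a b) - ev x a * ev x b := by
  induction a with
  | nil => simp [mulM]
  | cons c l ih =>
    obtain ⟨y, hy⟩ := ih
    obtain ⟨z, hz⟩ := ev_modL x m (addL (smulL c b) (shiftL red n (mulM red n m l b)))
    refine ⟨z + x * y, ?_⟩
    simp only [mulM, ev_cons]
    rw [ev_addL, ev_smulL, ev_shiftL x h] at hz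
    linear_combination hz + x * hy

lemma ev_mulM0 {red : List ℤ} {n : ℕ} (h : x ^ (n + 1) = ev x red) (a b : List ℤ) :
    ev x (mulM red n 0 a b) = ev x a * ev x b := by
  have := ev_mulM x h 0 a b
  rw [Int.cast_zero, zero_dvd_iff] at this
  exact sub_eq_zero.mp this

lemma ev_map {S : Type*} [CommRing S] (f : R →+* S) (l : List ℤ) :
    f (ev x l) = ev (f x) l := by
  induction l with
  | nil => simp
  | cons a l ih => simp [ih]

end

/-- pairs `a + r b` with `r^2 = d` -/
def mulP (red : List ℤ) (n : ℕ) (m : ℤ) (d : List ℤ) (p q : List ℤ × List ℤ) :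
    List ℤ × List ℤ :=
  (addL (mulM red n m p.1 q.1) (mulM red n m d (mulM red n m p.2 q.2)),
   addL (mulM red n m p.1 q.2) (mulM red n m p.2 q.1))

def powP (red : List ℤ) (n : ℕ) (m : ℤ) (d : List ℤ) (p : List ℤ × List ℤ) :
    List Bool → List ℤ × List ℤ
  | [] => ([1], [])
  | b :: l =>
    let s := powP red n m d p l
    let s2 := mulP red n m d s s
    bif b then mulP red n m d s2 p else s2

def bitsVal : List Bool → ℕ
  | [] => 0
  | b :: l => 2 * bitsVal l + (bif b then 1 else 0)

section
variable {R : Type*} [CommRing R] (x r : R)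

def evP (p : List ℤ × List ℤ) : R := ev x p.1 + r * ev x p.2

lemma ev_mulP {red : List ℤ} {n : ℕ} (h : x ^ (n + 1) = ev x red) (m : ℤ) (d : List ℤ)
    (hr : (m : R) ∣ r ^ 2 - ev x d) (p q : List ℤ × List ℤ) :
    (m : R) ∣ evP x r (mulP red n m d p q) - evP x r p * evP x r q := by
  obtain ⟨y, hy⟩ := hr
  obtain ⟨z1, h1⟩ := ev_mulM x h m p.1 q.1
  obtain ⟨z2, h2⟩ := ev_mulM x h m p.2 q.2
  obtain ⟨z3, h3⟩ := ev_mulM x h m d (mulM red n m p.2 q.2)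
  obtain ⟨z4, h4⟩ := ev_mulM x h m p.1 q.2
  obtain ⟨z5, h5⟩ := ev_mulM x h m p.2 q.1
  refine ⟨z1 + z3 + ev x d * z2 + r * z4 + r * z5 - y * ev x p.2 * ev x q.2, ?_⟩
  simp only [mulP, evP, ev_addL]
  linear_combination h1 + h3 + ev x d * h2 + r * h4 + r * h5 - ev x p.2 * ev x q.2 * hy

lemma dvd_sub_mul {m a b c d : R} (h1 : m ∣ a - b) (h2 : m ∣ c - d) : m ∣ a * c - b * d := by
  obtain ⟨y, hy⟩ := h1
  obtain ⟨z, hz⟩ := h2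
  exact ⟨y * c + b * z, by linear_combination c * hy + b * hz⟩

lemma dvd_sub_tr {m a b c : R} (h1 : m ∣ a - b) (h2 : m ∣ b - c) : m ∣ a - c := by
  have := dvd_add h1 h2
  simpa using this

lemma ev_powP {red : List ℤ} {n : ℕ} (h : x ^ (n + 1) = ev x red) (m : ℤ) (d : List ℤ)
    (hr : (m : R) ∣ r ^ 2 - ev x d) (p : List ℤ × List ℤ) (l : List Bool) :
    (m : R) ∣ evP x r (powP red n m d p l) - evP x r p ^ (bitsVal l) := by
  induction l with
  | nil => simp [powP, bitsVal, evP]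
  | cons b l ih =>
    have h2 := dvd_sub_tr (ev_mulP x r h m d hr (powP red n m d p l) (powP red n m d p l))
      (dvd_sub_mul ih ih)
    cases b with
    | false =>
      simp only [powP, bitsVal, cond_false, add_zero, two_mul, pow_add]
      exact h2
    | true =>
      simp only [powP, bitsVal, cond_true, two_mul, pow_add, pow_one]
      exact dvd_sub_tr (ev_mulP x r h m d hr _ _)
        (dvd_sub_mul h2 (by simp : (m : R) ∣ evP x r p - evP x r p))

end

/-- powers of a single list -/
def powM (red : List ℤ) (n : ℕ) (m : ℤ) (p : List ℤ) : List Bool → List ℤ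
  | [] => [1]
  | b :: l =>
    let s := powM red n m p l
    let s2 := mulM red n m s s
    bif b then mulM red n m s2 p else s2

lemma ev_powM {R : Type*} [CommRing R] (x : R) {red : List ℤ} {n : ℕ}
    (h : x ^ (n + 1) = ev x red) (m : ℤ) (p : List ℤ) (l : List Bool) :
    (m : R) ∣ ev x (powM red n m p l) - ev x p ^ (bitsVal l) := by
  induction l with
  | nil => simp [powM, bitsVal]
  | cons b l ih =>
    have h2 := dvd_sub_tr (ev_mulM x h m (powM red n m p l) (powM red n m p l))
      (dvd_sub_mul ih ih)
    cases b with
    | false =>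
      simp only [powM, bitsVal, cond_false, add_zero, two_mul, pow_add]
      exact h2
    | true =>
      simp only [powM, bitsVal, cond_true, two_mul, pow_add, pow_one]
      exact dvd_sub_tr (ev_mulM x h m _ _)
        (dvd_sub_mul h2 (by simp : (m : R) ∣ ev x p - ev x p))

/-- all coefficients divisible by `m` -/
def zeroM (m : ℤ) (l : List ℤ) : Bool := l.all (fun a => a % m == 0)

lemma ev_zeroM {R : Type*} [CommRing R] (x : R) (m : ℤ) (l : List ℤ) (h : zeroM m l = true) :
    (m : R) ∣ ev x l := by
  induction l with
  | nil => simp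
  | cons a l ih =>
    simp only [zeroM, List.all_cons, Bool.and_eq_true, beq_iff_eq] at h
    obtain ⟨h1, h2⟩ := h
    rw [ev_cons]
    refine dvd_add ?_ (Dvd.dvd.mul_left (ih h2) _)
    exact map_dvd (Int.castRingHom R) (Int.dvd_of_emod_eq_zero h1)

def subL (a b : List ℤ) : List ℤ := addL a (smulL (-1) b)

@[simp] lemma ev_subL {R : Type*} [CommRing R] (x : R) (a b : List ℤ) :
    ev x (subL a b) = ev x a - ev x b := by
  simp [subL]; ring

def eqM (m : ℤ) (a b : List ℤ) : Bool := zeroM m (subL a b)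

lemma ev_eqM {R : Type*} [CommRing R] (x : R) {m : ℤ} {a b : List ℤ} (h : eqM m a b = true) :
    (m : R) ∣ ev x a - ev x b := by
  have := ev_zeroM x m _ h
  simpa using this

lemma ev_eq0 {R : Type*} [CommRing R] (x : R) {a b : List ℤ} (h : eqM 0 a b = true) :
    ev x a = ev x b := by
  have := ev_eqM x h
  rw [Int.cast_zero, zero_dvd_iff] at this
  exact sub_eq_zero.mp this

end Skl

open Polynomial NumberField InfinitePlace

namespace Skl

noncomputable section

/-- the defining quintic -/
def hZ : ℤ[X] := X ^ 5 - 8 * X ^ 3 + 16 * X - 2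
def hQ : ℚ[X] := X ^ 5 - 8 * X ^ 3 + 16 * X - 2

lemma hZ_natDegree : hZ.natDegree = 5 := by
  unfold hZ; compute_degree!
lemma hZ_monic : hZ.Monic := by
  unfold hZ; monicity!
lemma hQ_natDegree : hQ.natDegree = 5 := by
  unfold hQ; compute_degree!
lemma hQ_monic : hQ.Monic := by
  unfold hQ; monicity!
lemma hQ_ne : hQ ≠ 0 := hQ_monic.ne_zero

lemma hZ_map : hZ.map (Int.castRingHom ℚ) = hQ := by
  simp [hZ, hQ, Polynomial.map_sub, Polynomial.map_add, Polynomial.map_mul, Polynomial.map_pow]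

lemma hZ_eisenstein : hZ.IsEisensteinAt (Ideal.span {(2 : ℤ)}) where
  leading := by
    rw [hZ_monic.leadingCoeff, Ideal.mem_span_singleton]; decide
  mem := by
    intro n hn
    rw [hZ_natDegree] at hn
    rw [Ideal.mem_span_singleton]
    interval_cases n <;> simp [hZ, coeff_X, coeff_ofNat_mul, coeff_X_pow]
  notMem := by
    rw [Ideal.span_singleton_pow, Ideal.mem_span_singleton]
    simp [hZ]

lemma hZ_irr : Irreducible hZ :=
  hZ_eisenstein.irreducible ((Ideal.span_singleton_prime (by norm_num)).2 (by
    exact Int.prime_two)) hZ_monic.isPrimitive (by rw [hZ_natDegree]; norm_num)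

lemma hQ_irr : Irreducible hQ := by
  rw [← hZ_map]
  exact (Polynomial.Monic.irreducible_iff_irreducible_map_fraction_map hZ_monic).1 hZ_irr

instance : Fact (Irreducible hQ) := ⟨hQ_irr⟩

lemma exists_pb (f : ℚ[X]) [Fact (Irreducible f)] :
    ∃ pb : @PowerBasis ℚ (AdjoinRoot f) _ _ (DivisionRing.toRatAlgebra),
      pb.gen = AdjoinRoot.root f ∧ pb.dim = f.natDegree := by
  have hf : f ≠ 0 := (Fact.out : Irreducible f).ne_zero
  have e : (AdjoinRoot.instAlgebra f : Algebra ℚ (AdjoinRoot f)) = DivisionRing.toRatAlgebra :=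
    Subsingleton.elim _ _
  rw [← e]
  exact ⟨AdjoinRoot.powerBasis hf, AdjoinRoot.powerBasis_gen hf, AdjoinRoot.powerBasis_dim hf⟩

def K : Type := AdjoinRoot hQ
instance : Field K := inferInstanceAs (Field (AdjoinRoot hQ))
def pK : K := AdjoinRoot.root hQ

instance : CharZero K := charZero_of_injective_ringHom (AdjoinRoot.of hQ).injective
lemma exists_pbK : ∃ pb : PowerBasis ℚ K, pb.gen = pK ∧ pb.dim = hQ.natDegree := exists_pb hQ

def pbK : PowerBasis ℚ K := exists_pbK.choose
lemma pbK_gen : pbK.gen = pK := exists_pbK.choose_spec.1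
lemma pbK_dim : pbK.dim = 5 := by rw [← hQ_natDegree]; exact exists_pbK.choose_spec.2

instance : NumberField K where
  to_charZero := inferInstance
  to_finiteDimensional := pbK.finite

lemma pK_rel : pK ^ 5 = 8 * pK ^ 3 - 16 * pK + 2 := by
  have h : AdjoinRoot.mk hQ (X ^ 5 - 8 * X ^ 3 + 16 * X - 2) = 0 := AdjoinRoot.mk_self
  simp only [map_sub, map_add, map_mul, map_pow, AdjoinRoot.mk_X, map_ofNat] at h
  have h2 : (AdjoinRoot.root hQ) ^ 5 = 8 * (AdjoinRoot.root hQ) ^ 3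
    - 16 * (AdjoinRoot.root hQ) + 2 := by linear_combination h
  exact h2

lemma finrank_K : Module.finrank ℚ K = 5 := by
  rw [pbK.finrank, pbK_dim]

lemma pK_int : IsIntegral ℤ pK :=
  ⟨hZ, hZ_monic, by simp [hZ]; linear_combination pK_rel⟩

def piO : 𝓞 K := ⟨pK, pK_int⟩

lemma minpoly_pK : minpoly ℚ pK = hQ := by
  refine (minpoly.eq_of_irreducible_of_monic hQ_irr ?_ hQ_monic).symm
  simp only [hQ, map_sub, map_add, map_mul, map_pow, aeval_X, map_ofNat]
  linear_combination pK_rel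

lemma minpolyZ_pK : minpoly ℤ pK = hZ := by
  have h := minpoly.isIntegrallyClosed_eq_field_fractions' ℚ pK_int
  rw [minpoly_pK, ← hZ_map] at h
  exact (Polynomial.map_injective _ (Int.cast_injective)) h.symm

def bK : Module.Basis (Fin 5) ℚ K := pbK.basis.reindex (finCongr pbK_dim)
lemma bK_apply (i : Fin 5) : bK i = pK ^ (i : ℕ) := by
  simp [bK, pbK_gen]

lemma bK_repr (c : Fin 5 → ℚ) (j : Fin 5) :
    bK.repr (∑ i, c i • pK ^ (i : ℕ)) j = c j := by
  have : ∑ i, c i • pK ^ (i : ℕ) = ∑ i, c i • bK i := by simp [bK_apply]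
  rw [this, bK.repr_sum_self]

def dmat : Matrix (Fin 5) (Fin 5) ℚ :=
  !![16, 10, 0, 32, 0; 0, -64, 10, -256, 32; -24, 0, -64, 10, -256; 0, 16, 0, 64, 10;
    5, 0, 16, 0, 64]

lemma dmat_det : dmat.det = -998576 := by
  simp [dmat, Matrix.det_succ_row_zero, Fin.sum_univ_succ, Fin.succAbove]
  norm_num

lemma leftMul_d : Algebra.leftMulMatrix bK (16 - 24 * pK ^ 2 + 5 * pK ^ 4) = dmat := by
  ext i j
  rw [Algebra.leftMulMatrix_eq_repr_mul, bK_apply]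
  have key : (16 - 24 * pK ^ 2 + 5 * pK ^ 4) * pK ^ (j : ℕ) =
      ∑ k, (dmat k j) • pK ^ (k : ℕ) := by
    have h := pK_rel
    fin_cases j <;> simp [dmat, Fin.sum_univ_succ, Algebra.smul_def]
    · ring
    · linear_combination 5 * h
    · linear_combination 5 * pK * h
    · linear_combination (5 * pK ^ 2 + 16) * h
    · linear_combination (5 * pK ^ 3 + 16 * pK) * h
  rw [key, bK_repr]

lemma discr_bK : Algebra.discr ℚ bK = -998576 := by
  have h := Algebra.discr_powerBasis_eq_norm ℚ pbK
  rw [finrank_K, pbK_gen, minpoly_pK] at h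
  have h2 : aeval pK (derivative hQ) = 16 - 24 * pK ^ 2 + 5 * pK ^ 4 := by
    simp [hQ, -derivative_ofNat]; simp only [map_ofNat, derivative_ofNat]; simp; ring
  rw [h2, Algebra.norm_eq_matrix_det bK, leftMul_d, dmat_det] at h
  rw [bK, Module.Basis.coe_reindex, Algebra.discr_reindex, h]
  norm_num

end
end Skl


namespace Skl
noncomputable section

@[simp] lemma piO_coe : ((piO : 𝓞 K) : K) = pK := rfl

def bO : Module.Basis (Fin 5) ℤ (𝓞 K) :=
  (RingOfIntegers.basis K).reindex (Fintype.equivFinOfCardEq (by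
    rw [← Module.finrank_eq_card_chooseBasisIndex, RingOfIntegers.rank, finrank_K]))

lemma discr_bO : Algebra.discr ℤ bO = discr K := (discr_eq_discr K bO)

def PO : Matrix (Fin 5) (Fin 5) ℤ := bO.toMatrix (fun i : Fin 5 => piO ^ (i : ℕ))

lemma PO_spec : Matrix.vecMul (bO : Fin 5 → 𝓞 K) (PO.map (algebraMap ℤ (𝓞 K)))
    = fun i : Fin 5 => piO ^ (i : ℕ) := by
  ext1 j
  simp only [Matrix.vecMul, dotProduct, Matrix.map_apply]
  have := bO.sum_toMatrix_smul_self (fun i : Fin 5 => piO ^ (i : ℕ)) j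
  rw [← this]
  refine Finset.sum_congr rfl fun i _ => ?_
  rw [PO, Algebra.smul_def, mul_comm]

lemma discr_pow : Algebra.discr ℤ (fun i : Fin 5 => piO ^ (i : ℕ)) = -998576 := by
  have h := discr_bK
  have h2 : (bK : Fin 5 → K) = fun i : Fin 5 => algebraMap (𝓞 K) K (piO ^ (i : ℕ)) := by
    ext1 i; rw [bK_apply]; simp
  have h3 : Algebra.discr ℚ (fun i : Fin 5 => algebraMap (𝓞 K) K (piO ^ (i : ℕ))) =
      ((Algebra.discr ℤ (fun i : Fin 5 => piO ^ (i : ℕ)) : ℤ) : ℚ) := by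
    rw [Algebra.discr_def, Algebra.discr_def, ← eq_intCast (Int.castRingHom ℚ), RingHom.map_det]
    congr 1
    ext i j
    simp only [Algebra.traceMatrix_apply, Algebra.traceForm_apply, RingHom.mapMatrix_apply,
      Matrix.map_apply]
    rw [← map_mul, Algebra.trace_localization ℤ (nonZeroDivisors ℤ) (Rₘ := ℚ) (Sₘ := K)]
    rfl
  rw [h2, h3] at h
  exact_mod_cast h

lemma det_sq : PO.det ^ 2 * discr K = -998576 := by
  rw [← discr_bO, ← Algebra.discr_of_matrix_vecMul, PO_spec, discr_pow]

lemma det_dvd : PO.det ∣ 4 := by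
  have h : PO.det ^ 2 ∣ 998576 := ⟨-discr K, by linarith [det_sq]⟩
  have h2 : PO.det.natAbs ^ 2 ∣ 998576 := by
    have := Int.natAbs_dvd_natAbs.2 h
    rwa [Int.natAbs_pow] at this
  have h3 : PO.det.natAbs ≤ 1000 := by
    by_contra hc
    have := Nat.le_of_dvd (by norm_num) h2
    nlinarith
  have key : ∀ d : ℕ, d ≤ 1000 → d ^ 2 ∣ 998576 → d ∣ 4 := by
    intro d hd hdv
    have : ∀ d < 1001, d ^ 2 ∣ 998576 → d ∣ 4 := by decide +kernel
    exact this d (by omega) hdv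
  have := key _ h3 h2
  exact Int.natAbs_dvd_natAbs.1 this

lemma abs_discr_le : |discr K| ≤ 998576 := by
  have h := det_sq
  have h1 : PO.det ^ 2 ≥ 1 := by
    have : PO.det ≠ 0 := by intro h0; rw [h0] at h; norm_num at h
    have := sq_pos_of_ne_zero this
    linarith
  rw [abs_le]; constructor <;> nlinarith

lemma four_mem (x : 𝓞 K) : ∃ c : Fin 5 → ℤ, 4 * x = ∑ i, (c i : 𝓞 K) * piO ^ (i : ℕ) := by
  obtain ⟨e, he⟩ := det_dvd
  have h1 : ∀ j, ((PO.det : ℤ) : 𝓞 K) * bO j =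
      ∑ i, ((PO.adjugate i j : ℤ) : 𝓞 K) * piO ^ (i : ℕ) := by
    intro j
    have h := congrArg (fun v => Matrix.vecMul v (PO.adjugate.map (algebraMap ℤ (𝓞 K)))) PO_spec
    simp only [Matrix.vecMul_vecMul] at h
    rw [← Matrix.map_mul, Matrix.mul_adjugate] at h
    have h := congrFun h j
    simp only [Matrix.vecMul, dotProduct, Matrix.map_apply, Matrix.smul_apply, Matrix.one_apply] at h
    simp at h
    rw [mul_comm, h]
    exact Finset.sum_congr rfl fun i _ => mul_comm _ _
  refine ⟨fun i => ∑ j, e * bO.repr x j * PO.adjugate i j, ?_⟩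
  conv_lhs => rw [← bO.sum_repr x]
  have h4 : (4 : 𝓞 K) = (e : 𝓞 K) * ((PO.det : ℤ) : 𝓞 K) := by
    rw [← Int.cast_mul, mul_comm e, ← he]; norm_num
  rw [Finset.mul_sum]
  push_cast
  simp only [Finset.sum_mul]
  rw [Finset.sum_comm]
  refine Finset.sum_congr rfl fun j _ => ?_
  rw [h4, zsmul_eq_mul]
  have := h1 j
  calc _ = (e : 𝓞 K) * (bO.repr x j : 𝓞 K) * (((PO.det : ℤ) : 𝓞 K) * bO j) := by ring
    _ = _ := by rw [this, Finset.mul_sum]; exact Finset.sum_congr rfl fun i _ => by ring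

lemma mem_adjoin_pK (x : 𝓞 K) : (x : K) ∈ Algebra.adjoin ℤ {pK} := by
  have h := mem_adjoin_of_smul_prime_pow_smul_of_minpoly_isEisensteinAt (R := ℤ) (K := ℚ) (L := K)
    (p := 2) (B := pbK) Int.prime_two (by rw [pbK_gen]; exact pK_int) (n := 2) (z := (x : K))
    x.2
  rw [pbK_gen, minpolyZ_pK] at h
  refine h ?_ hZ_eisenstein
  obtain ⟨c, hc⟩ := four_mem x
  have h2 := congrArg (algebraMap (𝓞 K) K) hc
  have h3 : ((2 : ℤ) ^ 2 • (x : K)) = ∑ i, (c i : K) * pK ^ (i : ℕ) := by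
    simp only [map_mul, map_sum, map_pow, map_intCast, map_ofNat] at h2
    rw [zsmul_eq_mul]
    push_cast
    exact h2
  rw [h3]
  refine Subalgebra.sum_mem _ fun i _ => ?_
  refine Subalgebra.mul_mem _ (Subalgebra.intCast_mem _ _) (Subalgebra.pow_mem _ ?_ _)
  exact Algebra.self_mem_adjoin_singleton ℤ pK

def evK (c : Fin 5 → ℤ) : 𝓞 K := ev piO [c 0, c 1, c 2, c 3, c 4]

lemma piO_rel : piO ^ (4 + 1) = ev piO [2, -16, 0, 8, 0] := by
  apply RingOfIntegers.ext
  have := pK_rel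
  simp
  simp only [map_ofNat]
  linear_combination this

lemma exists_list (x : 𝓞 K) : ∃ l : List ℤ, x = ev piO l := by
  have h := mem_adjoin_pK x
  rw [Algebra.adjoin_singleton_eq_range_aeval] at h
  obtain ⟨q, hq⟩ := h
  have : ∀ q : ℤ[X], ∃ l : List ℤ, aeval pK q = ((ev piO l : 𝓞 K) : K) := by
    intro q
    induction q using Polynomial.induction_on with
    | C a => exact ⟨[a], by simp⟩
    | add p q hp hq =>
      obtain ⟨l, hl⟩ := hp
      obtain ⟨m, hm⟩ := hq
      exact ⟨addL l m, by simp [hl, hm]⟩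
    | monomial n a h =>
      obtain ⟨l, hl⟩ := h
      refine ⟨0 :: l, ?_⟩
      have h5 : aeval pK (C a * X ^ (n + 1)) = pK * aeval pK (C a * X ^ n) := by
        simp; ring
      rw [h5, hl]; simp
  obtain ⟨l, hl⟩ := this q
  exact ⟨l, RingOfIntegers.ext (hq.symm.trans hl)⟩

lemma exists_evK (x : 𝓞 K) : ∃ c : Fin 5 → ℤ, x = evK c := by
  obtain ⟨l, rfl⟩ := exists_list x
  induction l with
  | nil => exact ⟨0, by simp [evK]⟩
  | cons a l ih =>
    obtain ⟨c, hc⟩ := ih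
    refine ⟨![a + 2 * c 4, c 0 - 16 * c 4, c 1, c 2 + 8 * c 4, c 3], ?_⟩
    rw [ev_cons, hc]
    have h := piO_rel
    simp [evK] at *
    linear_combination (c 4 : 𝓞 K) * h

lemma evK_coe (c : Fin 5 → ℤ) : ((evK c : 𝓞 K) : K) = ∑ i, ((c i : ℤ) : ℚ) • pK ^ (i : ℕ) := by
  simp [evK, Fin.sum_univ_succ, Algebra.smul_def]; ring

lemma evK_inj {c d : Fin 5 → ℤ} (h : evK c = evK d) : c = d := by
  have h2 := congrArg (algebraMap (𝓞 K) K) h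
  change ((evK c : 𝓞 K) : K) = ((evK d : 𝓞 K) : K) at h2
  rw [evK_coe, evK_coe] at h2
  ext i
  have := congrArg (fun y => bK.repr y i) h2
  simp only [bK_repr] at this
  exact_mod_cast this

lemma evK_dvd {n : ℤ} {c : Fin 5 → ℤ} (h : (n : 𝓞 K) ∣ evK c) (i : Fin 5) : n ∣ c i := by
  obtain ⟨y, hy⟩ := h
  obtain ⟨d, rfl⟩ := exists_evK y
  have : evK c = evK (fun i => n * d i) := by
    rw [hy]; simp [evK]; ring
  exact ⟨d i, congrFun (evK_inj this) i⟩

end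
end Skl


namespace Skl
noncomputable section

lemma nrComplex_K : nrComplexPlaces K = 1 := by
  have h1 := card_add_two_mul_card_eq_rank K
  rw [finrank_K] at h1
  have h2 := NumberField.sign_discr (K := K)
  have h3 : discr K < 0 := by
    have := det_sq
    by_contra hc
    have := mul_nonneg (sq_nonneg PO.det) (not_lt.1 hc)
    linarith
  rw [Int.sign_eq_neg_one_of_neg h3] at h2
  have h4 : nrComplexPlaces K ≤ 2 := by omega
  interval_cases nrComplexPlaces K
  · norm_num at h2
  · rfl
  · norm_num at h2

lemma nrReal_K : nrRealPlaces K = 3 := by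
  have h1 := card_add_two_mul_card_eq_rank K
  rw [finrank_K, nrComplex_K] at h1
  omega

lemma rank_K : Units.rank K = 3 := by
  rw [Units.rank, card_eq_nrRealPlaces_add_nrComplexPlaces, nrReal_K, nrComplex_K]

lemma minkowski_lt : (4 / Real.pi) ^ nrComplexPlaces K *
    ((Module.finrank ℚ K).factorial / (Module.finrank ℚ K) ^ (Module.finrank ℚ K) *
      √|(discr K : ℝ)|) < 49 := by
  rw [nrComplex_K, finrank_K]
  have h1 : √|(discr K : ℝ)| ≤ 999.29 := by
    rw [Real.sqrt_le_left (by norm_num)]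
    have : |(discr K : ℝ)| ≤ 998576 := by exact_mod_cast abs_discr_le
    norm_num at *
    linarith
  have h2 : 4 / Real.pi < 1.2735 := by
    rw [div_lt_iff₀ Real.pi_pos]
    have := Real.pi_gt_d4
    linarith
  have h3 : (0 : ℝ) < 4 / Real.pi := by positivity
  have h4 : (((5 : ℕ).factorial : ℝ) / ((5 : ℕ) : ℝ) ^ 5 * √|(discr K : ℝ)|) ≤ 0.0384 * 999.29 := by
    norm_num [Nat.factorial]
    linarith
  calc _ ≤ (4 / Real.pi) ^ 1 * (0.0384 * 999.29) := by gcongr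
    _ < _ := by norm_num at *; linarith

def redK : List ℤ := [2, -16, 0, 8, 0]

lemma piO_relK : piO ^ (4 + 1) = ev piO redK := piO_rel

def tab : List (ℕ × ℕ × List ℤ × List ℤ × List ℤ) :=
  [(2, 0, [0, 1], [16, 0, -8, 0, 1], [1]),
   (7, 1, [-1, 1], [-9, 7, 7, -1, -1], [1]),
   (7, 4, [-3, 4, 1, -1, 0], [-5, 16, 11, -5, -3], [2, -3, -4, 1, 1]),
   (11, 8, [-1, -1, 1], [-15, 37, 28, -7, -5], [10, -21, -17, 4, 3]),
   (11, 10, [-1, -1], [-9, -7, 7, 1, -1], [8, 7, -7, -1, 1]),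
   (17, 8, [-1, 3, 1, -1], [-31, 21, 26, -6, -5], [14, -7, -11, 2, 2]),
   (17, 13, [-3, -1, 1], [-7, 11, 10, -5, -3], [5, -6, -7, 3, 2]),
   (23, 12, [-1, -4, 0, 1], [-15, -2, -4, 1, 2], [8, -1, 2, 0, -1]),
   (29, 19, [-1, 1, 2, -1], [-25, -73, -13, 26, 9], [17, 42, 6, -15, -5]),
   (31, 18, [-1, 1, 1], [-35, -13, 32, 3, -5], [20, 9, -19, -2, 3]),
   (37, 6, [-5, 1, 1], [3, -79, -44, 17, 9], [0, 9, 5, -2, -1]),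
   (41, 4, [-1, 2, 1, -1], [-69, 94, 85, -19, -15], [6, -5, -6, 1, 1]),
   (41, 16, [-1, 2, 1], [-57, 4, 31, 2, -5], [22, -1, -12, -1, 2]),
   (43, 34, [-1, -1, -2, 0, 1], [111, -1101, -623, 217, 124], [-82, 827, 467, -163, -93])]

lemma tab_full : ∀ p : ℕ, p < 49 → (2 ≤ p ∧ ∀ d : ℕ, d < p → 2 ≤ d → ¬ d ∣ p) → ∀ a : ℕ, a < p →
    (p : ℤ) ∣ (a : ℤ) ^ 5 - 8 * (a : ℤ) ^ 3 + 16 * a - 2 →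
    tab.any (fun e => e.1 == p && e.2.1 == a) = true := by
  decide +kernel

lemma tab_ok : tab.all (fun e => eqM 0 (mulM redK 4 0 e.2.2.1 e.2.2.2.1) [(e.1 : ℤ)] &&
    eqM 0 (mulM redK 4 0 e.2.2.1 e.2.2.2.2) [-(e.2.1 : ℤ), 1] &&
    eqM e.1 [ev (e.2.1 : ℤ) e.2.2.1] []) = true := by
  decide +kernel

lemma ev_sub_mem {R : Type*} [CommRing R] (P : Ideal R) (x : R) (a : ℤ) (h : x - a ∈ P)
    (l : List ℤ) : ev x l - ((ev a l : ℤ) : R) ∈ P := by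
  induction l with
  | nil => simp
  | cons c l ih =>
    simp only [ev_cons]
    have : ((c : ℤ) : R) + x * ev x l - ((c + a * ev a l : ℤ) : R)
      = x * (ev x l - ((ev a l : ℤ) : R)) + ((ev a l : ℤ) : R) * (x - a) := by
      push_cast; ring
    simp only [Int.cast_id]
    rw [this]
    exact P.add_mem (P.mul_mem_left _ ih) (P.mul_mem_left _ h)

lemma int_mem_dvd (P : Ideal (𝓞 K)) (hP : P ≠ ⊤) (p : ℕ) (hp : p.Prime) (hpP : (p : 𝓞 K) ∈ P)
    (n : ℤ) (hn : (n : 𝓞 K) ∈ P) : (p : ℤ) ∣ n := by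
  by_contra hc
  have hcop : IsCoprime (p : ℤ) n :=
    (Prime.coprime_iff_not_dvd (Nat.prime_iff_prime_int.1 hp)).2 hc
  obtain ⟨u, v, huv⟩ := hcop
  apply hP
  rw [Ideal.eq_top_iff_one]
  have : (1 : 𝓞 K) = (u : 𝓞 K) * (p : 𝓞 K) + (v : 𝓞 K) * (n : 𝓞 K) := by
    have := congrArg (fun z : ℤ => (z : 𝓞 K)) huv
    push_cast at this
    exact this.symm
  rw [this]
  exact P.add_mem (P.mul_mem_left _ hpP) (P.mul_mem_left _ hn)

lemma principal_of_root (P : Ideal (𝓞 K)) (hP : P ≠ ⊤) (p : ℕ) (hp : p.Prime) (hp49 : p < 49)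
    (hpP : (p : 𝓞 K) ∈ P) (a : ℤ) (ha : piO - a ∈ P) : Submodule.IsPrincipal P := by
  obtain ⟨a', ha', hap⟩ : ∃ a' : ℕ, piO - (a' : 𝓞 K) ∈ P ∧ a' < p := by
    refine ⟨(a % p).toNat, ?_, ?_⟩
    · have h0 : (0 : ℤ) ≤ a % p := Int.emod_nonneg _ (by exact_mod_cast hp.ne_zero)
      have h1 : (((a % p).toNat : ℤ)) = a - p * (a / p) := by
        rw [Int.toNat_of_nonneg h0]
        have := Int.emod_add_mul_ediv a p
        linarith
      have h2 : (((a % p).toNat : 𝓞 K)) = a - p * ((a / p : ℤ) : 𝓞 K) := by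
        have := congrArg (fun z : ℤ => (z : 𝓞 K)) h1
        push_cast at this
        exact this
      rw [h2, show piO - ((a : 𝓞 K) - p * ((a / p : ℤ) : 𝓞 K)) =
        (piO - a) + ((a / p : ℤ) : 𝓞 K) * p by ring]
      exact P.add_mem ha (P.mul_mem_left _ hpP)
    · have := Int.emod_lt_of_pos a (show (0 : ℤ) < p by exact_mod_cast hp.pos)
      have h0 : (0 : ℤ) ≤ a % p := Int.emod_nonneg _ (by exact_mod_cast hp.ne_zero)
      omega
  have hroot : (p : ℤ) ∣ (a' : ℤ) ^ 5 - 8 * (a' : ℤ) ^ 3 + 16 * a' - 2 := by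
    apply int_mem_dvd P hP p hp hpP
    have h := ev_sub_mem P piO (a' : ℤ) (by simpa using ha') [-2, 16, 0, -8, 0, 1]
    have h0 : ev piO [-2, 16, 0, -8, 0, 1] = 0 := by
      have := piO_rel
      simp at *
      linear_combination this
    rw [h0] at h
    have := P.neg_mem h
    convert this using 1
    simp
    ring
  have htab := tab_full p hp49 ⟨hp.two_le, fun d hd hd2 hdv => by
    rcases (Nat.dvd_prime hp).1 hdv with h | h <;> omega⟩ a' hap hroot
  rw [List.any_eq_true] at htab
  obtain ⟨⟨p1, a1, g, g1, g2⟩, hmem, he⟩ := htab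
  simp only [Bool.and_eq_true, beq_iff_eq] at he
  obtain ⟨rfl, rfl⟩ := he
  have hok := (List.all_eq_true.1 tab_ok) _ hmem
  simp only [Bool.and_eq_true] at hok
  obtain ⟨⟨h1, h2⟩, h3⟩ := hok
  have e1 := ev_eq0 piO h1
  have e2 := ev_eq0 piO h2
  rw [ev_mulM0 piO piO_relK] at e1 e2
  have e3 := ev_eqM (1 : ℤ) h3
  simp at e1 e2 e3
  refine ⟨⟨ev piO g, ?_⟩⟩
  apply le_antisymm
  · intro x hx
    obtain ⟨l, rfl⟩ := exists_list x
    have h4 := ev_sub_mem P piO (a1 : ℤ) (by simpa using ha') l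
    have h5 := (P.sub_mem_iff_right hx).1 h4
    obtain ⟨c, hc⟩ := int_mem_dvd P hP p1 hp hpP _ h5
    have h6 := ev_sub_mem (Ideal.span {ev piO g}) piO (a1 : ℤ) (by
      rw [Ideal.mem_span_singleton]
      exact ⟨ev piO g2, by rw [e2]; simp; ring⟩) l
    rw [hc] at h6
    have h7 : (((p1 : ℤ) * c : ℤ) : 𝓞 K) ∈ Ideal.span {ev piO g} := by
      rw [Ideal.mem_span_singleton]
      exact ⟨ev piO g1 * c, by push_cast; rw [← mul_assoc, e1]⟩
    have := (Ideal.span {ev piO g}).add_mem h6 h7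
    simpa using this
  · rw [Ideal.submodule_span_eq, Ideal.span_singleton_le_iff_mem]
    have h4 := ev_sub_mem P piO (a1 : ℤ) (by simpa using ha') g
    obtain ⟨c, hc⟩ := e3
    rw [hc] at h4
    have h7 : (((p1 : ℤ) * c : ℤ) : 𝓞 K) ∈ P := by
      push_cast; exact P.mul_mem_right _ hpP
    have := P.add_mem h4 h7
    simpa using this

lemma top_of_cert (P : Ideal (𝓞 K)) (p : ℕ) (hpP : (p : 𝓞 K) ∈ P) (bits : List Bool)
    (c : List ℤ) (hx : piO ^ (bitsVal bits) - piO ∈ P)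
    (hc : eqM p (mulM redK 4 p c (subL (powM redK 4 p [0, 1] bits) [0, 1])) [1] = true) :
    P = ⊤ := by
  rw [Ideal.eq_top_iff_one]
  obtain ⟨y1, h1⟩ := ev_eqM piO hc
  obtain ⟨y2, h2⟩ := ev_mulM piO piO_rel p c (subL (powM redK 4 p [0, 1] bits) [0, 1])
  obtain ⟨y3, h3⟩ := ev_powM piO piO_rel p [0, 1] bits
  have e1 : (1 : 𝓞 K) = ev piO c * (piO ^ (bitsVal bits) - piO) +
      (y2 - y1 + ev piO c * y3) * (p : 𝓞 K) := by
    rw [ev_subL] at h2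
    simp at h1 h2 h3
    change ev piO (mulM redK 4 _ _ _) - _ = _ at h2
    change ev piO (powM redK 4 _ _ _) - _ = _ at h3
    linear_combination (-1 : 𝓞 K) * h1 + h2 + ev piO c * h3
  rw [e1]
  exact P.add_mem (P.mul_mem_left _ hx) (P.mul_mem_left _ hpP)

instance pid_K : IsPrincipalIdealRing (𝓞 K) := by
  refine RingOfIntegers.isPrincipalIdealRing_of_isPrincipal_of_norm_le_of_isPrime ?_
  rintro ⟨P, hP0⟩ hPp hPN
  have hP0' : P ≠ ⊥ := by simpa using hP0
  simp only at hPp hPN ⊢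
  have hN : Ideal.absNorm P < 49 := by
    have := lt_of_le_of_lt hPN minkowski_lt
    exact_mod_cast this
  have hmax : P.IsMaximal := hPp.isMaximal hP0'
  letI : Field (𝓞 K ⧸ P) := Ideal.Quotient.field P
  have : Finite (𝓞 K ⧸ P) := Ideal.finiteQuotientOfFreeOfNeBot P hP0'
  letI : Fintype (𝓞 K ⧸ P) := Fintype.ofFinite _
  have hcard : Fintype.card (𝓞 K ⧸ P) = Ideal.absNorm P := by
    rw [Ideal.absNorm_apply, Submodule.cardQuot_apply, Nat.card_eq_fintype_card]
  obtain ⟨p, hchar⟩ := CharP.exists (𝓞 K ⧸ P)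
  obtain ⟨n, hp, hn⟩ := FiniteField.card (𝓞 K ⧸ P) p
  have hpP : (p : 𝓞 K) ∈ P := by
    rw [← Ideal.Quotient.eq_zero_iff_mem]
    simpa using CharP.cast_eq_zero (𝓞 K ⧸ P) p
  have hfrob : piO ^ (p ^ (n : ℕ)) - piO ∈ P := by
    rw [← Ideal.Quotient.eq_zero_iff_mem, map_sub, map_pow, ← hn, FiniteField.pow_card, sub_self]
  have hpn : p ^ (n : ℕ) < 49 := by rw [← hn, hcard]; exact hN
  have hp49 : p < 49 := lt_of_le_of_lt (Nat.le_self_pow n.ne_zero p) hpn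
  have hPt : P ≠ ⊤ := hPp.ne_top
  by_cases h2 : p = 2
  · subst h2
    refine principal_of_root P hPt 2 hp hp49 hpP 0 ?_
    have h := piO_rel
    simp at h
    have h5 : piO ^ 5 ∈ P := by
      rw [h, show (2 + piO * (-16 + piO * (piO * 8)) : 𝓞 K) =
        (1 - 8 * piO + 4 * piO ^ 3) * ((2 : ℕ) : 𝓞 K) by push_cast; ring]
      exact P.mul_mem_left _ hpP
    simpa using hPp.mem_of_pow_mem _ h5
  by_cases hn1 : (n : ℕ) = 1
  · have hcp : Fintype.card (𝓞 K ⧸ P) = p := by rw [hn, hn1, pow_one]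
    haveI : Fact p.Prime := ⟨hp⟩
    let e := ZMod.ringEquivOfPrime (𝓞 K ⧸ P) hp hcp
    obtain ⟨b, hb⟩ := e.surjective (Ideal.Quotient.mk P piO)
    refine principal_of_root P hPt p hp hp49 hpP (b.val : ℤ) ?_
    rw [← Ideal.Quotient.eq_zero_iff_mem, map_sub, ← hb]
    have : Ideal.Quotient.mk P ((b.val : ℤ) : 𝓞 K) = e ((b.val : ℕ) : ZMod p) := by
      simp only [Int.cast_natCast, map_natCast]
    rw [this, ZMod.natCast_zmod_val, sub_self]
  · have hn2 : 2 ≤ (n : ℕ) := by have := n.pos; omega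
    have hpp : p ^ 2 < 49 := lt_of_le_of_lt (Nat.pow_le_pow_right hp.pos hn2) hpn
    have hp7 : p < 7 := by nlinarith
    have h35 : p = 3 ∨ p = 5 := by
      interval_cases p <;> simp_all +decide
    exfalso
    apply hPt
    rcases h35 with rfl | rfl
    · have hn4 : (n : ℕ) < 4 := by
        by_contra hc
        have := Nat.pow_le_pow_right (show 0 < 3 by norm_num) (not_lt.1 hc)
        omega
      have : (n : ℕ) = 2 ∨ (n : ℕ) = 3 := by omega
      rcases this with h | h
      · rw [h] at hfrob
        exact top_of_cert P 3 hpP [true, false, false, true] [1, 1] hfrob (by decide +kernel)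
      · rw [h] at hfrob
        exact top_of_cert P 3 hpP [true, true, false, true, true] [0, 1, 0, 1, 1] hfrob
          (by decide +kernel)
    · have hn4 : (n : ℕ) < 3 := by
        by_contra hc
        have := Nat.pow_le_pow_right (show 0 < 5 by norm_num) (not_lt.1 hc)
        omega
      have h : (n : ℕ) = 2 := by omega
      rw [h] at hfrob
      exact top_of_cert P 5 hpP [true, false, false, true, true] [0, 2, 1, 1, 3] hfrob
        (by decide +kernel)

end
end Skl


namespace Skl
noncomputable section

/-- among `n+1` units of a number field of unit rank at most `n` there is a relation -/
lemma unit_relation (L : Type*) [Field L] [NumberField L] (n : ℕ) (hr : Units.rank L ≤ n)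
    (e : Fin (n + 1) → (𝓞 L)ˣ) (q : ℤ) (hq : ¬ IsUnit q) :
    ∃ a : Fin (n + 1) → ℤ, (∃ i, ¬ q ∣ a i) ∧ ∏ i, e i ^ a i ∈ Units.torsion L := by
  choose ze hze using fun i => (Units.exist_unique_eq_mul_prod L (e i)).exists
  let v : Fin (n + 1) → (Fin (Units.rank L) → ℤ) := fun i => (ze i).2
  have hdep : ¬ LinearIndependent ℤ v := by
    intro h
    have := h.fintype_card_le_finrank
    rw [Module.finrank_fintype_fun_eq_card, Fintype.card_fin, Fintype.card_fin] at this
    omega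
  rw [Fintype.not_linearIndependent_iff] at hdep
  obtain ⟨g, hg, i0, hi0⟩ := hdep
  obtain ⟨b, hb, hgcd⟩ := Finset.extract_gcd g (Finset.univ_nonempty (α := Fin (n + 1)))
  refine ⟨b, ?_, ?_⟩
  · by_contra hc
    push Not at hc
    apply hq
    have : q ∣ (Finset.univ : Finset (Fin (n + 1))).gcd b := Finset.dvd_gcd fun i _ => hc i
    rw [hgcd] at this
    exact isUnit_of_dvd_one this
  · have h0 : (Finset.univ : Finset (Fin (n + 1))).gcd g ≠ 0 := by
      intro h
      apply hi0
      rw [hb i0 (Finset.mem_univ _), h, zero_mul]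
    have h1 : (Finset.univ.gcd g) • ∑ i, b i • v i = 0 := by
      rw [Finset.smul_sum, ← hg]
      refine Finset.sum_congr rfl fun i hi => ?_
      rw [smul_smul, ← hb i hi]
    have h2 : ∑ i, b i • v i = 0 := (smul_eq_zero.1 h1).resolve_left h0
    have h3 : ∏ i, e i ^ b i = ∏ i, (((ze i).1 : (𝓞 L)ˣ)) ^ b i := by
      have h4 : ∀ i, e i ^ b i = (((ze i).1 : (𝓞 L)ˣ)) ^ b i *
          ∏ j, Units.fundSystem L j ^ (b i * v i j) := by
        intro i
        conv_lhs => rw [hze i]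
        rw [mul_zpow, ← Finset.prod_zpow]
        congr 1
        refine Finset.prod_congr rfl fun j _ => ?_
        rw [← zpow_mul, mul_comm]
      rw [Finset.prod_congr rfl fun i _ => h4 i, Finset.prod_mul_distrib, Finset.prod_comm]
      have h5 : ∀ j, ∏ i, Units.fundSystem L j ^ (b i * v i j) = 1 := by
        intro j
        have hs : ∀ s : Finset (Fin (n + 1)), ∏ i ∈ s, Units.fundSystem L j ^ (b i * v i j) =
            Units.fundSystem L j ^ (∑ i ∈ s, b i * v i j) := by
          intro s
          induction s using Finset.induction_on with
          | empty => simp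
          | insert i s hi ih => rw [Finset.prod_insert hi, Finset.sum_insert hi, ih, zpow_add]
        rw [hs]
        have := congrFun h2 j
        simp only [Finset.sum_apply, Pi.smul_apply, smul_eq_mul, Pi.zero_apply] at this
        rw [this, zpow_zero]
      rw [Finset.prod_congr rfl fun j _ => h5 j]
      simp
    rw [h3]
    exact Subgroup.prod_mem _ fun i _ => Subgroup.zpow_mem _ (ze i).1.2 _

section
variable {R : Type*} [CommRing R]

lemma unit_zpow_mod (u : Rˣ) (w : R) (h : (9 : R) ∣ (u : R) - (1 + 3 * w)) (a : ℤ) :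
    (9 : R) ∣ ((u ^ a : Rˣ) : R) - (1 + 3 * (a * w)) := by
  have hnat : ∀ (u : Rˣ) (w : R), (9 : R) ∣ (u : R) - (1 + 3 * w) → ∀ n : ℕ,
      (9 : R) ∣ ((u ^ n : Rˣ) : R) - (1 + 3 * (n * w)) := by
    intro u w h n
    induction n with
    | zero => simp
    | succ n ih =>
      obtain ⟨y, hy⟩ := h
      obtain ⟨z, hz⟩ := ih
      refine ⟨z * u + (1 + 3 * n * w) * y + n * w * w, ?_⟩
      rw [pow_succ]
      push_cast at *
      linear_combination (u : R) * hz + (1 + 3 * n * w) * hy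
  obtain ⟨n, rfl | rfl⟩ := a.eq_nat_or_neg
  · simpa using hnat u w h n
  · have h1 : (9 : R) ∣ ((u⁻¹ : Rˣ) : R) - (1 + 3 * (-w)) := by
      obtain ⟨y, hy⟩ := h
      refine ⟨-y * ((u⁻¹ : Rˣ) : R) + w * w * ((u⁻¹ : Rˣ) : R) + w * y * 3 * ((u⁻¹ : Rˣ) : R), ?_⟩
      have hu : (u : R) * ((u⁻¹ : Rˣ) : R) = 1 := by simp
      linear_combination (-1 + 3 * w) * ((u⁻¹ : Rˣ) : R) * hy + (1 - 3 * w) * hu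
    have := hnat u⁻¹ (-w) h1 n
    simpa using this

lemma unit_prod_mod {ι : Type*} (s : Finset ι) (u : ι → Rˣ) (w : ι → R)
    (h : ∀ i ∈ s, (9 : R) ∣ (u i : R) - (1 + 3 * w i)) :
    (9 : R) ∣ ((∏ i ∈ s, u i : Rˣ) : R) - (1 + 3 * ∑ i ∈ s, w i) := by
  classical
  induction s using Finset.induction_on with
  | empty => simp
  | insert i s hi ih =>
    rw [Finset.prod_insert hi, Finset.sum_insert hi]
    obtain ⟨y, hy⟩ := h i (Finset.mem_insert_self _ _)
    obtain ⟨z, hz⟩ := ih fun j hj => h j (Finset.mem_insert_of_mem hj)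
    refine ⟨y * ((∏ i ∈ s, u i : Rˣ) : R) + (1 + 3 * w i) * z + w i * ∑ i ∈ s, w i, ?_⟩
    push_cast at *
    linear_combination (∏ i ∈ s, (u i : R)) * hy + (1 + 3 * w i) * hz

lemma nine_to_three [IsDomain R] [CharZero R] {x : R} (h : (9 : R) ∣ 3 * x) : (3 : R) ∣ x := by
  obtain ⟨y, hy⟩ := h
  refine ⟨y, ?_⟩
  have h3 : (3 : R) ≠ 0 := by norm_num
  apply mul_left_cancel₀ h3
  linear_combination hy

end

/-- data for the Skolem argument in a number field -/
structure SkData (L : Type*) [Field L] [NumberField L] (n : ℕ) where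
  e : Fin n → (𝓞 L)ˣ
  w : Fin n → 𝓞 L
  M : ℕ
  hM : ¬ (3 : ℤ) ∣ M
  hrank : Units.rank L ≤ n
  hw : ∀ i, (9 : 𝓞 L) ∣ ((e i ^ M : (𝓞 L)ˣ) : 𝓞 L) - (1 + 3 * w i)
  htors : ∀ z ∈ Units.torsion L, z ^ M = 1
  hind : ∀ a : Fin n → ℤ, (3 : 𝓞 L) ∣ ∑ i, (a i : 𝓞 L) * w i → ∀ i, (3 : ℤ) ∣ a i

variable {L : Type*} [Field L] [NumberField L] {n : ℕ}

/-- the basic relation -/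
lemma SkData.rel (S : SkData L n) (u : (𝓞 L)ˣ) (v : 𝓞 L)
    (hu : (9 : 𝓞 L) ∣ (u : 𝓞 L) - (1 + 3 * v)) :
    ∃ (a : Fin n → ℤ) (c : ℤ) (z : (𝓞 L)ˣ), ¬ (3 : ℤ) ∣ c ∧ z ^ S.M = 1 ∧
      u ^ c = z * ∏ i, S.e i ^ a i ∧
      (3 : 𝓞 L) ∣ ((c * S.M : ℤ) : 𝓞 L) * v - ∑ i, (a i : 𝓞 L) * S.w i := by
  obtain ⟨a, ha, hz⟩ := unit_relation L n S.hrank (Fin.cons u S.e) 3 (by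
    rw [Int.isUnit_iff]; norm_num)
  have hzM := S.htors _ hz
  rw [Fin.prod_univ_succ] at hzM hz
  simp only [Fin.cons_zero, Fin.cons_succ] at hzM hz
  have h1 : (9 : 𝓞 L) ∣ ((∏ i, (S.e i ^ S.M) ^ (a (Fin.succ i)) : (𝓞 L)ˣ) : 𝓞 L) -
      (1 + 3 * ∑ i, ((a (Fin.succ i) : ℤ) : 𝓞 L) * S.w i) :=
    unit_prod_mod _ _ _ fun i _ => unit_zpow_mod _ _ (S.hw i) _
  have h2 := unit_zpow_mod u v hu (a 0 * S.M)
  have h3 : (u ^ (a 0 * S.M : ℤ)) * ∏ i, (S.e i ^ S.M) ^ (a (Fin.succ i)) = 1 := by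
    rw [← hzM, mul_pow, zpow_mul, zpow_natCast, ← Finset.prod_pow]
    congr 1
    refine Finset.prod_congr rfl fun i _ => ?_
    rw [← zpow_natCast, ← zpow_natCast, ← zpow_mul, ← zpow_mul, mul_comm]
  have h3' := congrArg (fun x : (𝓞 L)ˣ => (x : 𝓞 L)) h3
  simp only [Units.val_mul, Units.val_one] at h3'
  have h4 : (3 : 𝓞 L) ∣ ((a 0 * S.M : ℤ) : 𝓞 L) * v +
      ∑ i, ((a (Fin.succ i) : ℤ) : 𝓞 L) * S.w i := by
    apply nine_to_three
    obtain ⟨y, hy⟩ := h1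
    obtain ⟨x, hx⟩ := h2
    set P := ((∏ i, (S.e i ^ S.M) ^ (a (Fin.succ i)) : (𝓞 L)ˣ) : 𝓞 L)
    set Q := ((u ^ (a 0 * S.M : ℤ) : (𝓞 L)ˣ) : 𝓞 L)
    set s := ∑ i, ((a (Fin.succ i) : ℤ) : 𝓞 L) * S.w i
    set t := ((a 0 * S.M : ℤ) : 𝓞 L) * v
    refine ⟨-x * P - (1 + 3 * t) * y - t * s, ?_⟩
    linear_combination - P * hx - (1 + 3 * t) * hy + h3'
  have hc : ¬ (3 : ℤ) ∣ a 0 := by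
    intro hc
    obtain ⟨i, hi⟩ := ha
    have h5 : (3 : 𝓞 L) ∣ ∑ i, ((a (Fin.succ i) : ℤ) : 𝓞 L) * S.w i := by
      have : (3 : 𝓞 L) ∣ ((a 0 * S.M : ℤ) : 𝓞 L) * v := by
        obtain ⟨k, hk⟩ := hc
        exact ⟨k * S.M * v, by rw [hk]; push_cast; ring⟩
      exact (dvd_add_right this).1 h4
    have h6 := S.hind _ h5
    induction i using Fin.cases with
    | zero => exact hi hc
    | succ i => exact hi (h6 i)
  refine ⟨fun i => - a (Fin.succ i), a 0, u ^ a 0 * ∏ i, S.e i ^ a (Fin.succ i), hc, hzM, ?_, ?_⟩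
  · simp
  · simpa using h4

/-- refined Skolem lemma -/
lemma SkData.main (S : SkData L n) (k : ℕ) (u : (𝓞 L)ˣ) (v : 𝓞 L)
    (hu : (3 ^ (k + 2) : 𝓞 L) ∣ (u : 𝓞 L) - (1 + 3 ^ (k + 1) * v)) :
    ∃ (a : Fin n → ℤ) (c : ℤ), ¬ (3 : ℤ) ∣ c ∧
      (3 : 𝓞 L) ∣ (c : 𝓞 L) * v - ∑ i, (a i : 𝓞 L) * S.w i := by
  induction k generalizing u v with
  | zero =>
    obtain ⟨a, c, z, hc, hz, h1, h2⟩ := S.rel u v (by convert hu using 1 <;> norm_num)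
    refine ⟨a, c * S.M, ?_, h2⟩
    intro h
    rcases Int.prime_three.dvd_or_dvd h with h | h
    · exact hc h
    · exact S.hM h
  | succ k ih =>
    obtain ⟨a, c, z, hc, hz, h1, h2⟩ := S.rel u 0 (by
      obtain ⟨y, hy⟩ := hu
      refine ⟨3 ^ k * v + 3 ^ (k + 1) * y, ?_⟩
      rw [pow_succ, pow_succ, pow_succ] at hy
      rw [pow_succ]
      linear_combination hy)
    have h3 : ∀ i, (3 : ℤ) ∣ - a i := by
      apply S.hind
      simpa using h2
    choose b hb using h3
    -- cube root of the torsion part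
    obtain ⟨s, hs⟩ : ∃ s : ℤ, (z ^ s) ^ (3 : ℤ) = z := by
      have hcop : IsCoprime (3 : ℤ) S.M := (Prime.coprime_iff_not_dvd Int.prime_three).2 S.hM
      obtain ⟨p, q, hpq⟩ := hcop
      refine ⟨p, ?_⟩
      rw [← zpow_mul]
      have : p * 3 = 1 - S.M * q := by linarith
      rw [this, zpow_sub, zpow_mul, zpow_natCast, hz]
      simp
    set g : (𝓞 L)ˣ := z ^ s * ∏ i, S.e i ^ (-b i) with hg
    have hg3 : u ^ c = g ^ (3 : ℤ) := by
      rw [h1, hg, mul_zpow, hs, ← Finset.prod_zpow]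
      congr 1
      refine Finset.prod_congr rfl fun i _ => ?_
      rw [← zpow_mul]
      congr 1
      have := hb i
      linarith
    -- g ^ M is 1 mod 3
    obtain ⟨w, hw⟩ : ∃ w : 𝓞 L, ((g ^ S.M : (𝓞 L)ˣ) : 𝓞 L) = 1 + 3 * w := by
      have hgM : g ^ S.M = ∏ i, (S.e i ^ S.M) ^ (-b i) := by
        rw [hg, mul_pow, ← zpow_natCast (z ^ s), ← zpow_mul, mul_comm s, zpow_mul, zpow_natCast,
          hz, one_zpow, one_mul, ← Finset.prod_pow]
        refine Finset.prod_congr rfl fun i _ => ?_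
        rw [← zpow_natCast, ← zpow_natCast, ← zpow_mul, ← zpow_mul, mul_comm]
      obtain ⟨y, hy⟩ := unit_prod_mod Finset.univ (fun i => (S.e i ^ S.M) ^ (-b i))
        (fun i => ((-b i : ℤ) : 𝓞 L) * S.w i) fun i _ => unit_zpow_mod _ _ (S.hw i) _
      rw [← hgM] at hy
      exact ⟨3 * y + ∑ i, ((-b i : ℤ) : 𝓞 L) * S.w i, by linear_combination hy⟩
    -- power of u
    have hpow : ∀ (u : (𝓞 L)ˣ) (v : 𝓞 L) (m : ℕ),
        (3 ^ (k + 3) : 𝓞 L) ∣ (u : 𝓞 L) - (1 + 3 ^ (k + 2) * v) →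
        (3 ^ (k + 3) : 𝓞 L) ∣ ((u ^ m : (𝓞 L)ˣ) : 𝓞 L) - (1 + 3 ^ (k + 2) * (m * v)) := by
      intro u v m h
      induction m with
      | zero => simp
      | succ m ihm =>
        obtain ⟨y, hy⟩ := h
        obtain ⟨x, hx⟩ := ihm
        refine ⟨x * u + (1 + 3 ^ (k + 2) * (m * v)) * y + 3 ^ (k + 1) * m * v * v, ?_⟩
        rw [pow_succ]
        push_cast at *
        linear_combination (u : 𝓞 L) * hx + (1 + 3 ^ (k + 2) * (m * v)) * hy
    have hinv : (3 ^ (k + 3) : 𝓞 L) ∣ ((u⁻¹ : (𝓞 L)ˣ) : 𝓞 L) - (1 + 3 ^ (k + 2) * (-v)) := by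
      obtain ⟨y, hy⟩ := hu
      have hu1 : (u : 𝓞 L) * ((u⁻¹ : (𝓞 L)ˣ) : 𝓞 L) = 1 := by simp
      refine ⟨((u⁻¹ : (𝓞 L)ˣ) : 𝓞 L) * (3 ^ (k + 1) * v * v - (1 - 3 ^ (k + 2) * v) * y), ?_⟩
      linear_combination (-1 + 3 ^ (k + 2) * v) * ((u⁻¹ : (𝓞 L)ˣ) : 𝓞 L) * hy +
        (1 - 3 ^ (k + 2) * v) * hu1
    have hzpow : (3 ^ (k + 3) : 𝓞 L) ∣ ((u ^ c : (𝓞 L)ˣ) : 𝓞 L) - (1 + 3 ^ (k + 2) * (c * v)) := by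
      obtain ⟨m, rfl | rfl⟩ := c.eq_nat_or_neg
      · simpa using hpow u v m hu
      · simpa using hpow u⁻¹ (-v) m hinv
    have hgM3 := hpow _ _ S.M hzpow
    have e1 : (((u ^ c) ^ S.M : (𝓞 L)ˣ) : 𝓞 L) = (1 + 3 * w) ^ 3 := by
      rw [hg3, ← hw, ← Units.val_pow_eq_pow_val]
      congr 1
      rw [← zpow_natCast, ← zpow_natCast, ← zpow_natCast, ← zpow_mul, ← zpow_mul, mul_comm]
      rfl
    rw [e1] at hgM3
    obtain ⟨y, hy⟩ := hgM3
    have h3ne : (3 : 𝓞 L) ≠ 0 := by norm_num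
    have hd1 : (3 : 𝓞 L) ^ (k + 1) ∣ 3 * w := by
      have hcop : IsCoprime ((3 : 𝓞 L) ^ (k + 1)) (1 + 3 * (w + w ^ 2)) := by
        apply IsCoprime.pow_left
        exact ⟨-(w + w ^ 2), 1, by ring⟩
      apply hcop.dvd_of_dvd_mul_right
      refine ⟨S.M * (c * v) + 3 * y, ?_⟩
      apply mul_left_cancel₀ h3ne
      linear_combination hy
    obtain ⟨y', hy'⟩ := hd1
    have hcong : (3 : 𝓞 L) ∣ y' - S.M * (c * v) := by
      have hne : (3 : 𝓞 L) ^ (k + 2) ≠ 0 := pow_ne_zero _ h3ne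
      refine ⟨y - y' * (w + w ^ 2), ?_⟩
      apply mul_left_cancel₀ hne
      linear_combination hy - 3 * (1 + 3 * (w + w ^ 2)) * hy'
    obtain ⟨x, hx⟩ := hcong
    obtain ⟨a', c', hc', h4⟩ := ih (g ^ S.M) (S.M * (c * v)) (by
      refine ⟨x, ?_⟩
      rw [hw, hy']
      linear_combination (3 : 𝓞 L) ^ (k + 1) * hx)
    refine ⟨a', c' * (S.M * c), ?_, ?_⟩
    · intro h
      rcases Int.prime_three.dvd_or_dvd h with h | h
      · exact hc' h
      · rcases Int.prime_three.dvd_or_dvd h with h | h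
        · exact S.hM h
        · exact hc h
    · convert h4 using 1
      push_cast; ring

end
end Skl


namespace Skl
noncomputable section

lemma transfer {R : Type*} [CommRing R] [IsDomain R] [CharZero R] (x : R) (hx : IsIntegral ℤ x)
    (gl : List ℤ) (hm : minpoly ℤ x = ev X gl) {S : Type*} [CommRing S] (a : S)
    (ha : ev a gl = 0) (l : List ℤ) (h : ev x l = 0) : ev a l = 0 := by
  have e1 : aeval x (ev X l : ℤ[X]) = ev x l := by
    have := ev_map X (aeval (R := ℤ) x : ℤ[X] →ₐ[ℤ] R).toRingHom l
    simpa using this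
  have h2 : ∀ l, eval₂ (Int.castRingHom S) a (ev X l : ℤ[X]) = ev a l := by
    intro l
    have := ev_map X (eval₂RingHom (Int.castRingHom S) a) l
    simpa using this
  have hd : minpoly ℤ x ∣ ev X l := minpoly.isIntegrallyClosed_dvd hx (by rw [e1, h])
  obtain ⟨q, hq⟩ := hd
  rw [← h2 l, hq, eval₂_mul, hm, h2, ha, zero_mul]

def hL : List ℤ := [-2, 16, 0, -8, 0, 1]

lemma minpolyZ_piO : minpoly ℤ piO = ev X hL := by
  have h1 : minpoly ℤ piO = minpoly ℤ pK := by
    have := minpoly.algebraMap_eq (A := ℤ) (B := 𝓞 K) (B' := K)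
      (FaithfulSMul.algebraMap_injective (𝓞 K) K) piO
    exact this.symm
  rw [h1, minpolyZ_pK, hZ, hL]
  simp
  ring

lemma transferK {S : Type*} [CommRing S] (a : S) (ha : ev a hL = 0) (l m : List ℤ)
    (h : ev piO l = ev piO m) : ev a l = ev a m := by
  have := transfer piO (RingOfIntegers.isIntegral piO) hL minpolyZ_piO a ha (subL l m) (by
    rw [ev_subL, h, sub_self])
  rw [ev_subL] at this
  exact sub_eq_zero.1 this

lemma exists_homK {S : Type*} [CommRing S] (a : S) (ha : ev a hL = 0) :
    ∃ φ : 𝓞 K →+* S, φ piO = a := by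
  choose ch hch using exists_list
  have key : ∀ x l, x = ev piO l → ev a (ch x) = ev a l := by
    intro x l h
    exact transferK a ha _ _ (by rw [← hch, h])
  let φ : 𝓞 K →+* S :=
    { toFun := fun x => ev a (ch x)
      map_one' := by rw [key 1 [1] (by simp)]; simp
      map_mul' := by
        intro x y
        rw [key (x * y) (mulL (ch x) (ch y)) (by rw [ev_mulL, ← hch, ← hch]), ev_mulL]
      map_zero' := by rw [key 0 [] (by simp)]; simp
      map_add' := by
        intro x y
        rw [key (x + y) (addL (ch x) (ch y)) (by rw [ev_addL, ← hch, ← hch]), ev_addL] }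
  refine ⟨φ, ?_⟩
  change ev a (ch piO) = a
  rw [key piO [0, 1] (by simp)]; simp

def mkU (l m : List ℤ) (h : eqM 0 (mulM redK 4 0 l m) [1] = true) : (𝓞 K)ˣ where
  val := ev piO l
  inv := ev piO m
  val_inv := by
    have := ev_eq0 piO h
    rw [ev_mulM0 piO piO_relK] at this
    simpa using this
  inv_val := by
    have := ev_eq0 piO h
    rw [ev_mulM0 piO piO_relK] at this
    rw [mul_comm]
    simpa using this

def uK1 : (𝓞 K)ˣ := mkU [3, 0, -1] [-1, 10, 5, -2, -1] (by decide +kernel)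
def uK2 : (𝓞 K)ˣ := mkU [5, 0, -1] [1, -6, -3, 2, 1] (by decide +kernel)
def uK3 : (𝓞 K)ˣ := mkU [17, 0, -8, 0, 1] [1, -8, 4, 2, -1] (by decide +kernel)

lemma uK1_val : (uK1 : 𝓞 K) = ev piO [3, 0, -1] := rfl
lemma uK2_val : (uK2 : 𝓞 K) = ev piO [5, 0, -1] := rfl
lemma uK3_val : (uK3 : 𝓞 K) = ev piO [17, 0, -8, 0, 1] := rfl

def uval {S : Type*} [CommRing S] (a : S) (s i j k : ℕ) : S :=
  (-1) ^ s * (ev a [3, 0, -1]) ^ i * (ev a [5, 0, -1]) ^ j * (ev a [17, 0, -8, 0, 1]) ^ k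

set_option synthInstance.maxHeartbeats 400000 in
set_option synthInstance.maxSize 4000 in
lemma uval_not_sq : ∀ s < 2, ∀ i < 2, ∀ j < 2, ∀ k < 2, s + i + j + k ≠ 0 →
    ¬ IsSquare (uval piO s i j k) := by
  have key : ∀ (p : ℕ) (a : ZMod p) (_ : ev a hL = 0) (s i j k : ℕ), ¬ IsSquare (uval a s i j k) →
      ¬ IsSquare (uval piO s i j k) := by
    intro p a ha s i j k h hs
    obtain ⟨φ, hφ⟩ := exists_homK a ha
    apply h
    have : uval a s i j k = φ (uval piO s i j k) := by
      simp only [uval, map_mul, map_pow, map_neg, map_one, ev_map, hφ]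
    rw [this]
    exact hs.map φ
  have tabl : ∀ s < 2, ∀ i < 2, ∀ j < 2, ∀ k < 2, s + i + j + k ≠ 0 →
    (∀ r : ZMod 7, uval (1 : ZMod 7) s i j k ≠ r * r) ∨ (∀ r : ZMod 7, uval (4 : ZMod 7) s i j k ≠ r * r) ∨
    (∀ r : ZMod 11, uval (8 : ZMod 11) s i j k ≠ r * r) ∨ (∀ r : ZMod 11, uval (10 : ZMod 11) s i j k ≠ r * r) ∨
    (∀ r : ZMod 17, uval (8 : ZMod 17) s i j k ≠ r * r) ∨ (∀ r : ZMod 17, uval (13 : ZMod 17) s i j k ≠ r * r) := by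
    decide +kernel
  intro s hs i hi j hj k hk h
  rcases tabl s hs i hi j hj k hk h with h | h | h | h | h | h
  · exact key 7 1 (by decide +kernel) _ _ _ _ fun ⟨r, hr⟩ => h r hr
  · exact key 7 4 (by decide +kernel) _ _ _ _ fun ⟨r, hr⟩ => h r hr
  · exact key 11 8 (by decide +kernel) _ _ _ _ fun ⟨r, hr⟩ => h r hr
  · exact key 11 10 (by decide +kernel) _ _ _ _ fun ⟨r, hr⟩ => h r hr
  · exact key 17 8 (by decide +kernel) _ _ _ _ fun ⟨r, hr⟩ => h r hr
  · exact key 17 13 (by decide +kernel) _ _ _ _ fun ⟨r, hr⟩ => h r hr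

lemma zpow_mod_two {G : Type*} [CommGroup G] (u : G) (a : ℤ) :
    ∃ (i : ℕ) (w : G), i < 2 ∧ u ^ a = u ^ i * w ^ 2 ∧ ((2 : ℤ) ∣ a ↔ i = 0) := by
  rcases Int.even_or_odd' a with ⟨b, rfl | rfl⟩
  · exact ⟨0, u ^ b, by norm_num, by
      rw [mul_comm, zpow_mul, pow_zero, one_mul]; exact zpow_ofNat _ 2, by simp⟩
  · refine ⟨1, u ^ b, by norm_num, ?_, by simp⟩
    rw [zpow_add, mul_comm 2 b, zpow_mul, mul_comm]; simp

lemma units_mod_sq (ε : (𝓞 K)ˣ) : ∃ s < 2, ∃ i < 2, ∃ j < 2, ∃ k < 2, ∃ w : 𝓞 K,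
    (ε : 𝓞 K) = uval piO s i j k * w ^ 2 := by
  obtain ⟨a, ha, ht⟩ := unit_relation K 3 rank_K.le ![ε, uK1, uK2, uK3] 2 (by
    rw [Int.isUnit_iff]; norm_num)
  have ht2 := Units.torsion_eq_one_or_neg_one_of_odd_finrank (K := K) (by
    rw [finrank_K]; decide) ⟨_, ht⟩
  obtain ⟨c, w0, hc, h0, e0⟩ := zpow_mod_two ε (a 0)
  obtain ⟨i, w1, hi, h1, e1⟩ := zpow_mod_two uK1 (a 1)
  obtain ⟨j, w2, hj, h2, e2⟩ := zpow_mod_two uK2 (a 2)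
  obtain ⟨k, w3, hk, h3, e3⟩ := zpow_mod_two uK3 (a 3)
  obtain ⟨s, hs, hrel⟩ : ∃ s < 2, ε ^ c * (uK1 ^ i * uK2 ^ j * uK3 ^ k) *
      (w0 * w1 * w2 * w3) ^ 2 = (-1) ^ s := by
    have h4 : ε ^ c * (uK1 ^ i * uK2 ^ j * uK3 ^ k) * (w0 * w1 * w2 * w3) ^ 2 =
        ∏ l, ![ε, uK1, uK2, uK3] l ^ a l := by
      simp only [Fin.prod_univ_four]
      simp [h0, h1, h2, h3]
      simp only [mul_pow, mul_assoc, mul_comm, mul_left_comm]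
    rw [h4]
    rcases ht2 with h | h
    · exact ⟨0, by norm_num, by simpa using h⟩
    · exact ⟨1, by norm_num, by simpa using h⟩
  have hval : uval piO s i j k = (((-1) ^ s * (uK1 ^ i * uK2 ^ j * uK3 ^ k) : (𝓞 K)ˣ) : 𝓞 K) := by
    simp only [uval, Units.val_mul, Units.val_pow_eq_pow_val, Units.val_neg, Units.val_one,
      uK1_val, uK2_val, uK3_val]
    ring
  set w := w0 * w1 * w2 * w3
  set U := uK1 ^ i * uK2 ^ j * uK3 ^ k
  have hs1 : ((-1 : (𝓞 K)ˣ) ^ s) * (-1) ^ s = 1 := by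
    rw [← mul_pow]; simp
  interval_cases c
  · exfalso
    have hU : (-1) ^ s * U = w⁻¹ ^ 2 := by
      rw [pow_zero, one_mul] at hrel
      rw [← hrel, inv_pow, eq_inv_iff_mul_eq_one]
      calc U * w ^ 2 * U * w ^ 2 = (U * w ^ 2) * (U * w ^ 2) := by ac_rfl
        _ = 1 := by rw [hrel, hs1]
    refine uval_not_sq s hs i hi j hj k hk ?_ ?_
    · intro h
      obtain ⟨l, hl⟩ := ha
      apply hl
      fin_cases l
      · exact e0.2 rfl
      · exact e1.2 (by omega)
      · exact e2.2 (by omega)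
      · exact e3.2 (by omega)
    · rw [hval, hU]
      exact ⟨((w⁻¹ : (𝓞 K)ˣ) : 𝓞 K), by push_cast; ring⟩
  · refine ⟨s, hs, i, hi, j, hj, k, hk, ((w⁻¹ * U⁻¹ : (𝓞 K)ˣ) : 𝓞 K), ?_⟩
    rw [hval, ← Units.val_pow_eq_pow_val, ← Units.val_mul]
    congr 1
    rw [← hrel]
    simp only [pow_one, pow_two]
    calc ε = ε * (U * U⁻¹) * (U * U⁻¹) * (w * w⁻¹) * (w * w⁻¹) := by simp
      _ = _ := by ac_rfl

lemma real_root1 : ∃ a : ℝ, ev a hL = 0 ∧ 0 < a ∧ a < 1 / 2 := by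
  have hc : ContinuousOn (fun a : ℝ => ev a hL) (Set.Icc 0 (1 / 2)) := by
    simp only [hL, ev]; fun_prop
  obtain ⟨a, ha, h⟩ := intermediate_value_Icc (by norm_num) hc
    (show (0 : ℝ) ∈ _ by constructor <;> norm_num [hL, ev])
  refine ⟨a, h, lt_of_le_of_ne ha.1 ?_, lt_of_le_of_ne ha.2 ?_⟩
  · rintro rfl; norm_num [hL, ev] at h
  · rintro rfl; norm_num [hL, ev] at h

lemma real_root2 : ∃ a : ℝ, ev a hL = 0 ∧ 2.2 ≤ a ∧ a ≤ 2.23 := by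
  have hc : ContinuousOn (fun a : ℝ => ev a hL) (Set.Icc 2.2 2.23) := by
    simp only [hL, ev]; fun_prop
  obtain ⟨a, ha, h⟩ := intermediate_value_Icc (by norm_num) hc
    (show (0 : ℝ) ∈ _ by constructor <;> norm_num [hL, ev])
  exact ⟨a, h, ha.1, ha.2⟩

lemma coprime_ff (X Y : ℤ) (h : 4 * X ^ 5 - 4 * X + 1 = (2 * Y - 1) ^ 2) :
    IsCoprime (4 * X ^ 5 - 4 * X + 1) (20 * X ^ 4 - 4) := by
  apply isCoprime_of_prime_dvd
  · intro h; omega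
  intro p hp h1 h2
  have h3 : p ∣ 16 * X - 5 := by
    have : 16 * X - 5 = X * (20 * X ^ 4 - 4) - 5 * (4 * X ^ 5 - 4 * X + 1) := by ring
    rw [this]
    exact dvd_sub (Dvd.dvd.mul_left h2 _) (Dvd.dvd.mul_left h1 _)
  have h4 : p ∣ 4 * (139 * 449) := by
    obtain ⟨c, hc⟩ := h3
    obtain ⟨d, hd⟩ := h2
    refine ⟨20 * c * ((16 * X) ^ 3 + 5 * (16 * X) ^ 2 + 25 * (16 * X) + 125) - 16 ^ 4 * d, ?_⟩
    have : 4 * (139 * 449) = 20 * ((16 * X - 5) * ((16 * X) ^ 3 + 5 * (16 * X) ^ 2 + 25 * (16 * X) + 125))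
      - 16 ^ 4 * (20 * X ^ 4 - 4) := by ring
    rw [this, hc, hd]; ring
  have hsq : p ^ 2 ∣ 4 * X ^ 5 - 4 * X + 1 := by
    rw [h] at h1 ⊢
    exact pow_dvd_pow_of_dvd (hp.dvd_of_dvd_pow h1) 2
  have hsolve : ∀ q x0 : ℤ, p ∣ q → Prime q → q ∣ 16 * x0 - 5 → IsCoprime q 16 →
      ¬ q ^ 2 ∣ 4 * x0 ^ 5 - 4 * x0 + 1 → False := by
    intro q x0 hpq hq hx0 hcop hn
    have has : Associated p q := hp.associated_of_dvd hq hpq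
    have e1 : q ∣ 16 * X - 5 := has.symm.dvd.trans h3
    have e2 : q ∣ X - x0 := by
      have : q ∣ 16 * (X - x0) := by
        have := dvd_sub e1 hx0
        rwa [show 16 * X - 5 - (16 * x0 - 5) = 16 * (X - x0) by ring] at this
      exact hcop.dvd_of_dvd_mul_left this
    have e3 : q ^ 2 ∣ 4 * X ^ 5 - 4 * X + 1 := ((has.symm.pow_pow (n := 2)).dvd).trans hsq
    have e4 : q ∣ 20 * X ^ 4 - 4 := has.symm.dvd.trans h2
    apply hn
    obtain ⟨c, hc⟩ := e2
    obtain ⟨d, hd⟩ := e3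
    obtain ⟨g, hg⟩ := e4
    have hx : x0 = X - q * c := by linarith
    refine ⟨d - c * g + 40 * X ^ 3 * c ^ 2 - 40 * X ^ 2 * c ^ 3 * q + 20 * X * c ^ 4 * q ^ 2
      - 4 * c ^ 5 * q ^ 3, ?_⟩
    rw [hx]
    linear_combination hd - q * c * hg
  rcases hp.dvd_or_dvd h4 with h5 | h5
  · have h6 : p ∣ 2 := by
      have : p ∣ 2 ^ 2 := by simpa using h5
      exact hp.dvd_of_dvd_pow this
    have h7 : (2 : ℤ) ∣ 4 * X ^ 5 - 4 * X + 1 :=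
      ((hp.associated_of_dvd Int.prime_two h6).symm.dvd).trans h1
    omega
  · rcases hp.dvd_or_dvd h5 with h6 | h6
    · exact hsolve 139 9 h6 (by norm_num) (by norm_num) ⟨-13, 113, by norm_num⟩ (by norm_num)
    · exact hsolve 449 309 h6 (by norm_num) (by norm_num) ⟨-15, 421, by norm_num⟩ (by norm_num)

def BL (X : ℤ) : List ℤ := [1, -8, X, 2]

lemma K_descent (X Y : ℤ) (hX : 1 ≤ X) (h : 4 * X ^ 5 - 4 * X + 1 = (2 * Y - 1) ^ 2) :
    ∃ j < 2, ∃ k < 2, ∃ η : 𝓞 K, ev piO (BL X) = uval piO 0 0 j k * η ^ 2 := by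
  have hrel := piO_rel
  simp at hrel
  set β := ev piO (BL X) with hβ
  have hβ1 : β = X * piO ^ 2 + 2 * piO ^ 3 - 8 * piO + 1 := by
    rw [hβ, BL]; simp; ring
  set θ := 4 - piO ^ 2 with hθ
  set β' := X ^ 4 * θ ^ 4 + X ^ 3 * θ ^ 3 + X ^ 2 * θ ^ 2 + X * θ + 1 - θ ^ 4 with hβ'
  have t1 : piO * θ ^ 2 = 2 := by rw [hθ]; linear_combination hrel
  have t2 : β * θ = piO ^ 2 * (X * θ - 1) := by
    rw [hβ1, hθ]; linear_combination - 2 * hrel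
  have t3 : θ ^ 5 = 4 * θ ^ 4 - 4 := by
    rw [hθ]
    linear_combination (-(piO ^ 5 - 8 * piO ^ 3 + 16 * piO) - 2) * hrel
  have hθ0 : θ ≠ 0 := by
    intro h0; rw [h0] at t1; norm_num at t1
  have hmul : β * β' = ((4 * X ^ 5 - 4 * X + 1 : ℤ) : 𝓞 K) := by
    apply mul_left_cancel₀ (pow_ne_zero 5 hθ0)
    have t4 : piO ^ 2 * θ ^ 4 = 4 := by linear_combination (piO * θ ^ 2 + 2) * t1
    push_cast
    have : θ ^ 5 * (β * β') = (piO ^ 2 * θ ^ 4) * ((X * θ - 1) * β') := by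
      linear_combination θ ^ 4 * β' * t2
    rw [this, t4, hβ']
    linear_combination (-4 * (X : 𝓞 K) ^ 5 + 4 * X - 1 + 4 * X ^ 5 - 4 * X) * t3
  have hcop : IsCoprime β β' := by
    obtain ⟨a, b, hab⟩ := coprime_ff X Y h
    have hab' := congrArg (fun z : ℤ => (z : 𝓞 K)) hab
    rw [Int.cast_add, Int.cast_mul a, Int.cast_mul b, Int.cast_one] at hab'
    rw [← hmul] at hab'
    have hder : ((20 * X ^ 4 - 4 : ℤ) : 𝓞 K) = piO ^ 2 * β' +
        β * (4 * X ^ 3 * θ ^ 4 + 3 * X ^ 2 * θ ^ 3 + 2 * X * θ ^ 2 + θ) := by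
      apply mul_left_cancel₀ (pow_ne_zero 5 hθ0)
      have t4 : piO ^ 2 * θ ^ 4 = 4 := by linear_combination (piO * θ ^ 2 + 2) * t1
      have : θ ^ 5 * (piO ^ 2 * β' +
        β * (4 * X ^ 3 * θ ^ 4 + 3 * X ^ 2 * θ ^ 3 + 2 * X * θ ^ 2 + θ)) =
        (piO ^ 2 * θ ^ 4) * (θ * β' + (X * θ - 1) *
          (4 * X ^ 3 * θ ^ 4 + 3 * X ^ 2 * θ ^ 3 + 2 * X * θ ^ 2 + θ)) := by
        linear_combination θ ^ 4 * (4 * X ^ 3 * θ ^ 4 + 3 * X ^ 2 * θ ^ 3 + 2 * X * θ ^ 2 + θ) * t2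
      rw [this, t4, hβ']
      push_cast
      ring
    rw [hder] at hab'
    refine ⟨b * (4 * X ^ 3 * θ ^ 4 + 3 * X ^ 2 * θ ^ 3 + 2 * X * θ ^ 2 + θ),
      a * β + b * piO ^ 2, ?_⟩
    linear_combination hab'
  have hsq : β * β' = ((2 * Y - 1 : ℤ) : 𝓞 K) ^ 2 := by rw [hmul, h]; push_cast; ring
  obtain ⟨d, ε, hd⟩ := exists_associated_pow_of_mul_eq_pow' hcop hsq
  obtain ⟨s, hs, i, hi, j, hj, k, hk, w, hw⟩ := units_mod_sq ε
  have hfin : β = uval piO s i j k * (d * w) ^ 2 := by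
    rw [← hd, hw]; ring
  have hX' : (1 : ℝ) ≤ X := by exact_mod_cast hX
  -- positivity in real embeddings
  have hpos : ∀ a : ℝ, ev a hL = 0 → (4 - a ^ 2 < 0 ∨ 1 < 4 - a ^ 2) → 0 < uval a s i j k := by
    intro a ha hcase
    obtain ⟨φ, hφ⟩ := exists_homK a ha
    have e1 := congrArg φ hfin
    have e2 := congrArg φ t2
    rw [map_mul, map_pow] at e1
    have e3 : φ (uval piO s i j k) = uval a s i j k := by
      simp only [uval, map_mul, map_pow, map_neg, map_one, ev_map, hφ]
    rw [e3] at e1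
    simp only [hθ, map_mul, map_sub, map_pow, map_intCast, map_one, hφ, map_ofNat] at e2
    have ha0 : a ≠ 0 := by
      rintro rfl; norm_num [hL, ev] at ha
    have ha2 : 0 < a ^ 2 := by positivity
    have hβpos : 0 < φ β := by
      rcases hcase with hc | hc
      · by_contra hneg
        have h5 : 0 ≤ φ β * (4 - a ^ 2) := mul_nonneg_of_nonpos_of_nonpos (not_lt.1 hneg) hc.le
        have h6 : X * (4 - a ^ 2) - 1 < 0 := by nlinarith
        nlinarith
      · by_contra hneg
        have h5 : φ β * (4 - a ^ 2) ≤ 0 := mul_nonpos_of_nonpos_of_nonneg (not_lt.1 hneg) (by linarith)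
        have h6 : 0 < X * (4 - a ^ 2) - 1 := by nlinarith
        nlinarith
    rw [e1] at hβpos
    by_contra hneg
    have := mul_nonpos_of_nonpos_of_nonneg (not_lt.1 hneg) (sq_nonneg (φ (d * w)))
    linarith
  obtain ⟨a1, r1, l1, u1⟩ := real_root1
  obtain ⟨a2, r2, l2, u2⟩ := real_root2
  have p1 := hpos a1 r1 (Or.inr (by nlinarith))
  have p2 := hpos a2 r2 (Or.inl (by nlinarith))
  have hs0 : s = 0 := by
    interval_cases s
    · rfl
    · exfalso
      have h1 : 0 < ev a1 [3, 0, -1] := by simp; nlinarith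
      have h2 : 0 < ev a1 [5, 0, -1] := by simp; nlinarith
      have h3 : 0 < ev a1 [17, 0, -8, 0, 1] := by simp; nlinarith [sq_nonneg (a1 ^ 2)]
      have := mul_pos (mul_pos (pow_pos h1 i) (pow_pos h2 j)) (pow_pos h3 k)
      rw [uval] at p1
      linarith
  subst hs0
  have hi0 : i = 0 := by
    interval_cases i
    · rfl
    · exfalso
      have h1 : ev a2 [3, 0, -1] < 0 := by simp; nlinarith
      have h2 : 0 < ev a2 [5, 0, -1] := by simp; nlinarith
      have h3 : 0 < ev a2 [17, 0, -8, 0, 1] := by simp; nlinarith [sq_nonneg (a2 ^ 2 - 4)]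
      have := mul_pos (pow_pos h2 j) (pow_pos h3 k)
      rw [uval] at p2
      nlinarith
  subst hi0
  exact ⟨j, hj, k, hk, d * w, hfin⟩

end
end Skl


namespace Skl

def allLists (p : ℕ) : ℕ → List (List ℤ)
  | 0 => [[]]
  | d + 1 => (allLists p d).flatMap fun l => (List.range p).map fun (a : ℕ) => (a : ℤ) :: l

/-- remainder of `g` (low to high) modulo the monic polynomial `x^(n+1) = ev x red`, mod p -/
def remL (red : List ℤ) (n : ℕ) (p : ℤ) : List ℤ → List ℤ
  | [] => []
  | a :: g => modL p (addL [a] (shiftL red n (remL red n p g)))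

lemma mem_allLists (p : ℕ) (l : List ℤ) (h : ∀ a ∈ l, 0 ≤ a ∧ a < p) :
    l ∈ allLists p l.length := by
  induction l with
  | nil => simp [allLists]
  | cons a l ih =>
    simp only [allLists, List.length_cons, List.mem_flatMap, List.mem_map]
    have ha := h a (by simp)
    refine ⟨l, ih fun b hb => h b (by simp [hb]), a.toNat, ?_, ?_⟩
    · simp only [List.mem_range]; omega
    · rw [Int.toNat_of_nonneg ha.1]

lemma ev_remL {R : Type*} [CommRing R] (x : R) {red : List ℤ} {n : ℕ}
    (h : x ^ (n + 1) = ev x red) (p : ℤ) (hp : (p : R) = 0) (g : List ℤ) :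
    ev x (remL red n p g) = ev x g := by
  induction g with
  | nil => simp [remL]
  | cons a g ih =>
    have h1 := ev_modL x p (addL [a] (shiftL red n (remL red n p g)))
    rw [hp, zero_dvd_iff, sub_eq_zero] at h1
    simp only [remL]
    rw [h1, ev_addL, ev_shiftL x h, ih]
    simp

def g10L : List ℤ := [4, 0, 0, 8, -64, 4, -16, 0, 4, 0, 1]
def red10 : List ℤ := [-4, 0, 0, -8, 64, -4, 16, 0, -4, 0]

lemma coeff_ev {R : Type*} [CommRing R] (l : List ℤ) (i : ℕ) :
    (ev (X : R[X]) l).coeff i = ((l.getD i 0 : ℤ) : R) := by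
  induction l generalizing i with
  | nil => simp
  | cons a l ih =>
    rw [ev_cons, coeff_add]
    cases i with
    | zero => simp
    | succ i =>
      have h1 : ((a : ℤ) : R[X]).coeff (i + 1) = 0 := by
        rw [← C_eq_intCast, coeff_C, if_neg (by omega)]
      rw [coeff_X_mul, ih, h1]; simp

lemma natDegree_ev_lt {R : Type*} [CommRing R] (l : List ℤ) (n : ℕ) (h : l.length ≤ n + 1) :
    (ev (X : R[X]) l).natDegree ≤ n := by
  rw [natDegree_le_iff_coeff_eq_zero]
  intro N hN
  rw [coeff_ev, List.getD_eq_default _ _ (by omega)]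
  simp

lemma ev_X_ofFn {R : Type*} [CommRing R] (l : List ℤ) (x : R) :
    ev x l = ∑ i ∈ Finset.range l.length, ((l.getD i 0 : ℤ) : R) * x ^ i := by
  induction l with
  | nil => simp
  | cons a l ih =>
    rw [List.length_cons, Finset.sum_range_succ', ev_cons, ih, Finset.mul_sum, add_comm]
    congr 1
    · refine Finset.sum_congr rfl fun i _ => ?_
      simp; ring
    · simp

lemma no_factor (p : ℕ) [Fact p.Prime] (n : ℕ) (g : List ℤ)
    (hc : ((allLists p (n + 1)).all fun l =>
      decide ((remL l n p g).length ≤ n + 1) && !(zeroM p (remL l n p g))) = true)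
    (a : ℤ[X]) (ha : a.Monic) (hd : a.natDegree = n + 1) (hdv : a ∣ ev X g) : False := by
  let f := Int.castRingHom (ZMod p)
  let b : (ZMod p)[X] := a.map f
  have hb : b.Monic := ha.map f
  have hbd : b.natDegree = n + 1 := by rw [ha.natDegree_map, hd]
  let red : List ℤ := (List.range (n + 1)).map fun i => (-(a.coeff i)) % p
  have hp0 : (0 : ℤ) < p := by exact_mod_cast (Fact.out : p.Prime).pos
  have hlen : red.length = n + 1 := by simp [red]
  have hmem : red ∈ allLists p (n + 1) := by
    rw [← hlen]
    apply mem_allLists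
    intro x hx
    simp only [red, List.mem_map] at hx
    obtain ⟨i, _, rfl⟩ := hx
    exact ⟨Int.emod_nonneg _ hp0.ne', Int.emod_lt_of_pos _ hp0⟩
  have hcc := List.all_eq_true.1 hc red hmem
  rw [Bool.and_eq_true, decide_eq_true_iff] at hcc
  obtain ⟨hl, hz⟩ := hcc
  let S := AdjoinRoot b
  let x : S := AdjoinRoot.root b
  have hx : x ^ (n + 1) = ev x red := by
    have h1 : AdjoinRoot.mk b b = 0 := AdjoinRoot.mk_self
    have h2 : b = X ^ (n + 1) + ∑ i ∈ Finset.range (n + 1), C (b.coeff i) * X ^ i := by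
      conv_lhs => rw [hb.as_sum, hbd]
    have h3 := congrArg (AdjoinRoot.mk b) h2
    rw [h1] at h3
    simp only [map_add, map_sum, map_mul, map_pow, AdjoinRoot.mk_X, AdjoinRoot.mk_C] at h3
    have h4 : ev x red = - ∑ i ∈ Finset.range (n + 1), (AdjoinRoot.of b (b.coeff i)) * x ^ i := by
      rw [ev_X_ofFn, hlen, ← Finset.sum_neg_distrib]
      refine Finset.sum_congr rfl fun i hi => ?_
      rw [Finset.mem_range] at hi
      have h5 : red.getD i 0 = (-(a.coeff i)) % p := by
        simp [red, List.getD_eq_getElem?_getD, hi]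
      rw [h5]
      have h6 : ((((-(a.coeff i)) % p : ℤ) : ZMod p)) = - b.coeff i := by
        simp [b, f, coeff_map]
      have h7 : ((((-(a.coeff i)) % p : ℤ) : S)) = - AdjoinRoot.of b (b.coeff i) := by
        rw [← map_neg, ← h6, map_intCast]
      rw [h7]; ring
    rw [h4]
    linear_combination -h3
  have hpS : ((p : ℤ) : S) = 0 := by
    have : ((p : ℕ) : ZMod p) = 0 := by simp
    have h2 := congrArg (AdjoinRoot.of b) this
    rw [map_natCast, map_zero] at h2
    rw [Int.cast_natCast]; exact h2
  have h8 := ev_remL x hx (p : ℤ) hpS g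
  have h9 : ev x g = 0 := by
    obtain ⟨q, hq⟩ := hdv
    have h10 := congrArg (fun y => AdjoinRoot.mk b (y.map f)) hq
    simp only [Polynomial.map_mul, map_mul] at h10
    have h11 : AdjoinRoot.mk b (Polynomial.map f a) = 0 := AdjoinRoot.mk_self
    rw [h11, zero_mul] at h10
    have h12 := ev_map (X : ℤ[X]) ((AdjoinRoot.mk b).comp (mapRingHom f)) g
    have h13 : ((AdjoinRoot.mk b).comp (mapRingHom f)) X = x := by simp [x]
    rw [h13] at h12
    rw [← h12]
    exact h10
  rw [h9] at h8
  have h14 := ev_map (X : (ZMod p)[X]) (AdjoinRoot.mk b) (remL red n p g)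
  rw [AdjoinRoot.mk_X] at h14
  have h15 : b ∣ ev X (remL red n p g) := by
    rw [← AdjoinRoot.mk_eq_zero, h14]; exact h8
  have h16 : ev (X : (ZMod p)[X]) (remL red n p g) = 0 := by
    refine eq_zero_of_dvd_of_natDegree_lt h15 ?_
    rw [hbd]
    exact Nat.lt_succ_of_le (natDegree_ev_lt _ n hl)
  have h17 : zeroM p (remL red n p g) = true := by
    rw [zeroM, List.all_eq_true]
    intro c hcm
    obtain ⟨i, hi, rfl⟩ := List.getElem_of_mem hcm
    have := coeff_ev (R := ZMod p) (remL red n p g) i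
    rw [h16, coeff_zero, List.getD_eq_getElem _ _ hi] at this
    have h18 := (ZMod.intCast_zmod_eq_zero_iff_dvd _ p).1 this.symm
    simp only [beq_iff_eq]
    exact Int.emod_eq_zero_of_dvd h18
  rw [h17] at hz
  simp at hz

def bad7 (a4 a3 a2 a1 : ℕ) : Bool :=
  let b4 := (6 * a4) % 7
  let b3 := (4 + 6 * (a3 + a4 * b4)) % 7
  let b2 := (6 * (a2 + a3 * b4 + a4 * b3)) % 7
  let b1 := (5 + 6 * (a1 + a2 * b4 + a3 * b3 + a4 * b2)) % 7
  let s := (a1 * b4 + a2 * b3 + a3 * b2 + a4 * b1) % 7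
  (List.range 7).all fun a0 =>
    let b0 := (4 + 6 * (a0 + s)) % 7
    !(((a0 * b0) % 7).beq 4 && (((a0 * b1 + a1 * b0) % 7).beq 0 &&
    (((a0 * b2 + a1 * b1 + a2 * b0) % 7).beq 0 &&
    (((a0 * b3 + a1 * b2 + a2 * b1 + a3 * b0) % 7).beq 1 &&
    ((a0 * b4 + a1 * b3 + a2 * b2 + a3 * b1 + a4 * b0) % 7).beq 6))))

lemma chk7 : ((List.range 7).all fun a => (List.range 7).all fun b => (List.range 7).all fun c =>
    (List.range 7).all fun d => bad7 a b c d) = true := by decide +kernel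

lemma no55 (a0 a1 a2 a3 a4 b0 b1 b2 b3 b4 : ZMod 7)
    (e9 : a4 + b4 = 0) (e8 : a3 + a4 * b4 + b3 = 4) (e7 : a2 + a3 * b4 + a4 * b3 + b2 = 0)
    (e6 : a1 + a2 * b4 + a3 * b3 + a4 * b2 + b1 = -16)
    (e5 : a0 + a1 * b4 + a2 * b3 + a3 * b2 + a4 * b1 + b0 = 4)
    (e4 : a0 * b4 + a1 * b3 + a2 * b2 + a3 * b1 + a4 * b0 = -64)
    (e3 : a0 * b3 + a1 * b2 + a2 * b1 + a3 * b0 = 8)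
    (e2 : a0 * b2 + a1 * b1 + a2 * b0 = 0) (e1 : a0 * b1 + a1 * b0 = 0) (e0 : a0 * b0 = 4) :
    False := by
  have h7 : (7 : ZMod 7) = 0 := by decide
  have hv : ∀ a : ZMod 7, ∃ n : ℕ, n < 7 ∧ (n : ZMod 7) = a := fun a =>
    ⟨a.val, ZMod.val_lt a, ZMod.natCast_zmod_val a⟩
  obtain ⟨m0, l0, rfl⟩ := hv a0
  obtain ⟨m1, l1, rfl⟩ := hv a1
  obtain ⟨m2, l2, rfl⟩ := hv a2
  obtain ⟨m3, l3, rfl⟩ := hv a3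
  obtain ⟨m4, l4, rfl⟩ := hv a4
  have hc := chk7
  simp only [List.all_eq_true, List.mem_range] at hc
  have hc := hc m4 l4 m3 l3 m2 l2 m1 l1
  simp only [bad7, List.all_eq_true, List.mem_range] at hc
  have hc := hc m0 l0
  have beq : ∀ x c : ℕ, c < 7 → (x : ZMod 7) = c → (x % 7).beq c = true := by
    intro x c hcl h
    have := (ZMod.natCast_eq_natCast_iff' x c 7).1 h
    rw [Nat.beq_eq, this, Nat.mod_eq_of_lt hcl]
  have f4 : (((6 * m4) % 7 : ℕ) : ZMod 7) = b4 := by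
    rw [ZMod.natCast_mod]; push_cast; linear_combination (m4 : ZMod 7) * h7 - e9
  generalize (6 * m4) % 7 = n4 at *
  have f3 : (((4 + 6 * (m3 + m4 * n4)) % 7 : ℕ) : ZMod 7) = b3 := by
    rw [ZMod.natCast_mod]; push_cast; rw [f4]
    linear_combination (m3 + m4 * b4 : ZMod 7) * h7 - e8
  generalize (4 + 6 * (m3 + m4 * n4)) % 7 = n3 at *
  have f2 : (((6 * (m2 + m3 * n4 + m4 * n3)) % 7 : ℕ) : ZMod 7) = b2 := by
    rw [ZMod.natCast_mod]; push_cast; rw [f4, f3]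
    linear_combination (m2 + m3 * b4 + m4 * b3 : ZMod 7) * h7 - e7
  generalize (6 * (m2 + m3 * n4 + m4 * n3)) % 7 = n2 at *
  have f1 : (((5 + 6 * (m1 + m2 * n4 + m3 * n3 + m4 * n2)) % 7 : ℕ) : ZMod 7) = b1 := by
    rw [ZMod.natCast_mod]; push_cast; rw [f4, f3, f2]
    linear_combination (m1 + m2 * b4 + m3 * b3 + m4 * b2 + 3 : ZMod 7) * h7 - e6
  generalize (5 + 6 * (m1 + m2 * n4 + m3 * n3 + m4 * n2)) % 7 = n1 at *
  have f0 : (((4 + 6 * (m0 + (m1 * n4 + m2 * n3 + m3 * n2 + m4 * n1) % 7)) % 7 : ℕ) : ZMod 7)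
      = b0 := by
    rw [ZMod.natCast_mod]; push_cast; rw [ZMod.natCast_mod]; push_cast; rw [f4, f3, f2, f1]
    linear_combination (m0 + m1 * b4 + m2 * b3 + m3 * b2 + m4 * b1 : ZMod 7) * h7 - e5
  generalize (4 + 6 * (m0 + (m1 * n4 + m2 * n3 + m3 * n2 + m4 * n1) % 7)) % 7 = n0 at *
  subst f0 f1 f2 f3 f4
  rw [beq _ 4 (by norm_num) (by push_cast; linear_combination e0),
    beq _ 0 (by norm_num) (by push_cast; linear_combination e1),
    beq _ 0 (by norm_num) (by push_cast; linear_combination e2),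
    beq _ 1 (by norm_num) (by push_cast; linear_combination e3 + h7),
    beq _ 6 (by norm_num) (by push_cast; linear_combination e4 - 10 * h7)] at hc
  simp at hc


lemma ch3 : ∀ n < 4, ((allLists 3 (n + 1)).all fun l =>
      decide ((remL l n (3 : ℕ) g10L).length ≤ n + 1) && !(zeroM (3 : ℕ) (remL l n (3 : ℕ) g10L))) = true := by
  decide +kernel

noncomputable section

def gZ : ℤ[X] := ev X g10L
lemma gZ_eq : gZ = X ^ 10 + 4 * X ^ 8 - 16 * X ^ 6 + 4 * X ^ 5 - 64 * X ^ 4 + 8 * X ^ 3 + 4 := by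
  simp [gZ, g10L]; ring
lemma gZ_natDegree : gZ.natDegree = 10 := by rw [gZ_eq]; compute_degree!
lemma gZ_monic : gZ.Monic := by rw [gZ_eq]; monicity!

lemma monic5 (f : ℤ[X]) (hf : f.Monic) (hd : f.natDegree = 5) :
    f = ev X [f.coeff 0, f.coeff 1, f.coeff 2, f.coeff 3, f.coeff 4, 1] := by
  conv_lhs => rw [hf.as_sum, hd]
  simp [Finset.sum_range_succ]; ring

lemma gZ_irr : Irreducible gZ := by
  rw [gZ_monic.irreducible_iff_natDegree']
  refine ⟨fun h => by have := gZ_natDegree; rw [h] at this; simp at this, ?_⟩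
  intro f g hf hg hfg hmem
  rw [gZ_natDegree, Finset.mem_Ioc] at hmem
  obtain ⟨h0, h5⟩ := hmem
  have : Fact (Nat.Prime 3) := ⟨by norm_num⟩
  by_cases hd : g.natDegree = 5
  · have hfd : f.natDegree = 5 := by
      have := hf.natDegree_mul hg
      rw [hfg, gZ_natDegree] at this; omega
    have h1 := hfg
    rw [monic5 f hf hfd, monic5 g hg hd, ← ev_mulL, gZ] at h1
    have hc : ∀ i, (mulL [f.coeff 0, f.coeff 1, f.coeff 2, f.coeff 3, f.coeff 4, 1]
        [g.coeff 0, g.coeff 1, g.coeff 2, g.coeff 3, g.coeff 4, 1]).getD i 0 = g10L.getD i 0 := by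
      intro i
      have := congrArg (fun q => coeff q i) h1
      simpa only [coeff_ev, Int.cast_id] using this
    generalize f.coeff 0 = a0 at *
    generalize f.coeff 1 = a1 at *
    generalize f.coeff 2 = a2 at *
    generalize f.coeff 3 = a3 at *
    generalize f.coeff 4 = a4 at *
    generalize g.coeff 0 = b0 at *
    generalize g.coeff 1 = b1 at *
    generalize g.coeff 2 = b2 at *
    generalize g.coeff 3 = b3 at *
    generalize g.coeff 4 = b4 at *
    have hz : ∀ i, (((mulL [a0, a1, a2, a3, a4, 1] [b0, b1, b2, b3, b4, 1]).getD i 0 : ℤ) : ZMod 7)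
      = ((g10L.getD i 0 : ℤ) : ZMod 7) := fun i => by rw [hc]
    have e0 := hz 0
    have e1 := hz 1
    have e2 := hz 2
    have e3 := hz 3
    have e4 := hz 4
    have e5 := hz 5
    have e6 := hz 6
    have e7 := hz 7
    have e8 := hz 8
    have e9 := hz 9
    simp [mulL, addL, smulL, g10L] at e0 e1 e2 e3 e4 e5 e6 e7 e8 e9
    refine no55 a0 a1 a2 a3 a4 b0 b1 b2 b3 b4 ?_ ?_ ?_ ?_ ?_ ?_ ?_ ?_ ?_ ?_
    · linear_combination e9
    · linear_combination e8
    · linear_combination e7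
    · linear_combination e6
    · linear_combination e5
    · linear_combination e4
    · linear_combination e3
    · linear_combination e2
    · linear_combination e1
    · linear_combination e0
  · obtain ⟨n, hn⟩ : ∃ n, g.natDegree = n + 1 := ⟨g.natDegree - 1, by omega⟩
    exact no_factor 3 n g10L (ch3 n (by omega)) g hg hn ⟨f, by rw [mul_comm, hfg]; rfl⟩

end
end Skl


namespace Skl
noncomputable section

def gQ : ℚ[X] := gZ.map (Int.castRingHom ℚ)
lemma gQ_monic : gQ.Monic := gZ_monic.map _
lemma gQ_natDegree : gQ.natDegree = 10 := by rw [gQ, gZ_monic.natDegree_map, gZ_natDegree]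
lemma gQ_irr : Irreducible gQ :=
  (Polynomial.Monic.irreducible_iff_irreducible_map_fraction_map gZ_monic).1 gZ_irr
instance : Fact (Irreducible gQ) := ⟨gQ_irr⟩

def L10 : Type := AdjoinRoot gQ
instance : Field L10 := inferInstanceAs (Field (AdjoinRoot gQ))
def tL : L10 := AdjoinRoot.root gQ
instance : CharZero L10 := charZero_of_injective_ringHom (AdjoinRoot.of gQ).injective
lemma exists_pbL : ∃ pb : PowerBasis ℚ L10, pb.gen = tL ∧ pb.dim = gQ.natDegree := exists_pb gQ
def pbL : PowerBasis ℚ L10 := exists_pbL.choose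
lemma pbL_gen : pbL.gen = tL := exists_pbL.choose_spec.1
lemma pbL_dim : pbL.dim = 10 := by rw [← gQ_natDegree]; exact exists_pbL.choose_spec.2
instance : NumberField L10 where
  to_charZero := inferInstance
  to_finiteDimensional := pbL.finite
lemma finrank_L10 : Module.finrank ℚ L10 = 10 := by rw [pbL.finrank, pbL_dim]

lemma aeval_ev {R S : Type*} [CommRing R] [CommRing S] [Algebra R S] (x : S) (l : List ℤ) :
    aeval x (ev (X : R[X]) l) = ev x l := by
  have := ev_map (X : R[X]) (aeval (R := R) x : R[X] →ₐ[R] S).toRingHom l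
  simpa using this

lemma gQ_ev : gQ = ev X g10L := by
  have := ev_map (X : ℤ[X]) (mapRingHom (Int.castRingHom ℚ)) g10L
  simpa [gQ, gZ] using this

lemma tL_root : ev tL g10L = 0 := by
  have h1 : AdjoinRoot.mk gQ gQ = 0 := AdjoinRoot.mk_self
  have h2 := ev_map (X : ℚ[X]) (AdjoinRoot.mk gQ) g10L
  rw [← gQ_ev, h1, AdjoinRoot.mk_X] at h2
  exact h2.symm

lemma rel_of_root {R : Type*} [CommRing R] (x : R) (h : ev x g10L = 0) :
    x ^ (9 + 1) = ev x red10 := by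
  simp [g10L, red10] at *
  linear_combination h

lemma tL_int : IsIntegral ℤ tL := ⟨gZ, gZ_monic, by
  have := aeval_ev (R := ℤ) tL g10L
  rw [tL_root] at this
  exact this⟩

def tO : 𝓞 L10 := ⟨tL, tL_int⟩
@[simp] lemma tO_coe : ((tO : 𝓞 L10) : L10) = tL := rfl

lemma minpoly_tL : minpoly ℚ tL = gQ := by
  refine (minpoly.eq_of_irreducible_of_monic gQ_irr ?_ gQ_monic).symm
  rw [gQ_ev, aeval_ev, tL_root]

lemma minpolyZ_tL : minpoly ℤ tL = gZ := by
  have h := minpoly.isIntegrallyClosed_eq_field_fractions' ℚ tL_int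
  rw [minpoly_tL, gQ] at h
  exact (Polynomial.map_injective _ (Int.cast_injective)) h.symm

lemma transferL {S : Type*} [CommRing S] (a : S) (ha : ev a g10L = 0) (l m : List ℤ)
    (h : ev tL l = ev tL m) : ev a l = ev a m := by
  have := transfer tL tL_int g10L minpolyZ_tL a ha (subL l m) (by
    rw [ev_subL, h, sub_self])
  rw [ev_subL] at this
  exact sub_eq_zero.1 this

def dL10 : List ℤ := [0, 0, 24, -256, 20, -96, 0, 32, 0, 10]
def wL10 : List ℤ := [3846, -127032, -2240, 22228, -2288, 21891, 220, -1408, -25, -864]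

lemma wd_check : eqM 0 (mulM red10 9 0 wL10 dL10) [1997152] = true := by decide +kernel

lemma adjoin_tL : Algebra.adjoin ℚ {tL} = ⊤ := by
  rw [← pbL_gen]; exact pbL.adjoin_gen_eq_top

lemma deriv_tL : aeval tL (derivative (minpoly ℚ tL)) = ev tL dL10 := by
  have : gQ = X ^ 10 + 4 * X ^ 8 - 16 * X ^ 6 + 4 * X ^ 5 - 64 * X ^ 4 + 8 * X ^ 3 + 4 := by
    rw [gQ, gZ_eq]; simp
  rw [minpoly_tL, this]
  simp only [derivative_add, derivative_sub, derivative_mul, derivative_X_pow, derivative_ofNat]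
  simp [dL10]
  simp only [map_ofNat]
  ring

lemma N_mem (x : 𝓞 L10) : (1997152 : L10) * x ∈ Algebra.adjoin ℤ {tL} := by
  have h1 : (x : L10) ∈ (Algebra.traceForm ℚ L10).dualSubmodule
      (Subalgebra.toSubmodule (Algebra.adjoin ℤ {tL})) := by
    rw [LinearMap.BilinForm.mem_dualSubmodule]
    intro y hy
    have hy2 : IsIntegral ℤ y := by
      have : Algebra.adjoin ℤ {tL} ≤ integralClosure ℤ L10 := by
        rw [Algebra.adjoin_le_iff]
        intro z hz
        rw [Set.mem_singleton_iff] at hz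
        rw [hz]; exact tL_int
      exact this hy
    have h2 : IsIntegral ℤ (Algebra.trace ℚ L10 ((x : L10) * y)) :=
      Algebra.isIntegral_trace ((RingOfIntegers.isIntegral_coe x).mul hy2)
    obtain ⟨n, hn⟩ := (IsIntegrallyClosed.isIntegral_iff).1 h2
    rw [Algebra.traceForm_apply, ← hn]
    exact Submodule.mem_one.2 ⟨n, rfl⟩
  rw [traceForm_dualSubmodule_adjoin ℤ ℚ adjoin_tL tL_int, deriv_tL] at h1
  have hw : ev tL wL10 * ev tL dL10 = 1997152 := by
    rw [← ev_mulM0 tL (rel_of_root tL tL_root), ev_eq0 tL wd_check]; simp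
  have hd : ev tL dL10 ≠ 0 := by
    intro h0; rw [h0] at hw; norm_num at hw
  obtain ⟨y, hy, hyx⟩ := h1
  have hyx : (ev tL dL10)⁻¹ * y = (x : L10) := hyx
  have h3 : y = ev tL dL10 * x := by
    rw [← hyx]; field_simp
  have hev : ∀ l, ev tL l ∈ Algebra.adjoin ℤ {tL} := by
    intro l
    induction l with
    | nil => simp
    | cons a l ih =>
      rw [ev_cons]
      exact add_mem (Subalgebra.intCast_mem _ _)
        (mul_mem (Algebra.self_mem_adjoin_singleton ℤ tL) ih)
  have h4 : (1997152 : L10) * x = ev tL wL10 * y := by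
    rw [h3, ← hw]; ring
  rw [h4]
  exact mul_mem (hev _) hy

/-- any integer of `L10`, times `N`, is a polynomial in `t` of degree `< 10` -/
lemma N_poly (x : 𝓞 L10) : ∃ q : ℤ[X], q.natDegree < 10 ∧ (1997152 : L10) * x = aeval tL q := by
  have h := N_mem x
  rw [Algebra.adjoin_singleton_eq_range_aeval] at h
  obtain ⟨q, hq⟩ := h
  refine ⟨q %ₘ gZ, ?_, ?_⟩
  · have := natDegree_modByMonic_lt q gZ_monic (by
      intro h; have := gZ_natDegree; rw [h] at this; simp at this)
    rwa [gZ_natDegree] at this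
  · rw [← hq]
    conv_lhs => rw [← modByMonic_add_div q gZ]
    have : aeval tL gZ = 0 := by rw [gZ, aeval_ev, tL_root]
    simp [this]

lemma eq_zero_of_aeval (q : ℤ[X]) (hq : q.natDegree < 10) (h : aeval tL q = 0) : q = 0 := by
  have hd := minpoly.isIntegrallyClosed_dvd tL_int h
  rw [minpolyZ_tL] at hd
  exact eq_zero_of_dvd_of_natDegree_lt hd (by rw [gZ_natDegree]; exact hq)

lemma exists_N (p : ℤ) (hp : ¬ p ∣ 1997152) : ∃ N : ℤ, ¬ p ∣ N ∧ ∀ x : 𝓞 L10, ∃ q : ℤ[X],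
    q.natDegree < 10 ∧ (N : L10) * x = aeval tL q := by
  refine ⟨1997152, hp, fun x => ?_⟩
  obtain ⟨q, hq, h⟩ := N_poly x
  exact ⟨q, hq, by rw [← h]; norm_num⟩

lemma sat10 (l : List ℤ) (hl : l.length ≤ 10) (h : (3 : 𝓞 L10) ∣ ev tO l) (i : ℕ) :
    (3 : ℤ) ∣ l.getD i 0 := by
  obtain ⟨y, hy⟩ := h
  obtain ⟨N, hN3, hN⟩ := exists_N 3 (by norm_num)
  obtain ⟨q, hq, hqy⟩ := hN y
  have h1 : aeval tL (C N * ev (X : ℤ[X]) l - C 3 * q) = 0 := by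
    have h2 : ev tL l = 3 * (y : L10) := by
      have := congrArg (algebraMap (𝓞 L10) L10) hy
      rw [ev_map, map_mul, map_ofNat] at this
      exact this
    rw [map_sub, map_mul, map_mul, aeval_ev, ← hqy, h2, aeval_C, aeval_C]
    simp only [algebraMap_int_eq, eq_intCast]
    push_cast
    ring
  have h3 := eq_zero_of_aeval _ (by
    have e1 := natDegree_ev_lt (R := ℤ) l 9 hl
    have h5 : (C N * ev (X : ℤ[X]) l).natDegree ≤ 9 := (natDegree_C_mul_le _ _).trans e1
    have h6 : (C 3 * q).natDegree ≤ 9 := (natDegree_C_mul_le _ _).trans (by omega)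
    have := natDegree_sub_le_of_le h5 h6
    rw [max_self] at this
    omega) h1
  have h4 := congrArg (fun p => coeff p i) h3
  simp only [coeff_sub, coeff_zero, coeff_C_mul, coeff_ev, Int.cast_id] at h4
  have h5 : (3 : ℤ) ∣ N * l.getD i 0 := ⟨q.coeff i, by linarith⟩
  exact (Int.prime_three.dvd_or_dvd h5).resolve_left hN3

end
end Skl


namespace Skl
noncomputable section

lemma relL : tL ^ (9 + 1) = ev tL red10 := rel_of_root tL tL_root
lemma tO_root : ev tO g10L = 0 := by
  apply RingOfIntegers.coe_injective
  have := ev_map tO (algebraMap (𝓞 L10) L10) g10L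
  rw [map_zero]
  exact this.trans tL_root
lemma relO : tO ^ (9 + 1) = ev tO red10 := rel_of_root tO tO_root

lemma tL10 : tL ^ 10 = -4*tL^8+16*tL^6-4*tL^5+64*tL^4-8*tL^3-4 := by
  have := relL
  simp [red10] at this
  rw [this]; ring

def b5 : L10 := tL ^ 5 / 4 + 1 / 2
def b7 : L10 := tL ^ 7 / 8 + tL ^ 2 / 4

lemma b5_b5 : b5 * b5 = -2 * tL * b7 + (tL ^ 6 + 4 * tL ^ 4) := by
  unfold b5 b7; linear_combination (1/16) * tL10
lemma b5_b7 : b5 * b7 = (4 * tL - tL ^ 3) * b7 + (2 * tL * b5 * tL ^ 0 * 0 + 2 * tL ^ 6 - tL^3)  := by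
  unfold b5 b7; linear_combination (tL^2/32) * tL10
lemma b7_b7 : b7 * b7 = (1 - 2 * b5) * b7 + (4 * tL^6 - tL^5 + 16 * tL^4 - 2 * tL^3 - 1) := by
  unfold b5 b7; linear_combination (tL^4/64 + 1/4) * tL10

def NN : Submodule (𝓞 L10) L10 := Submodule.span (𝓞 L10) {1, b5, b7}

lemma one_NN : (1 : L10) ∈ NN := Submodule.subset_span (by simp)
lemma b5_NN : b5 ∈ NN := Submodule.subset_span (by simp)
lemma b7_NN : b7 ∈ NN := Submodule.subset_span (by simp)
lemma smul_NN (a : 𝓞 L10) {x : L10} (h : x ∈ NN) : (a : L10) * x ∈ NN := by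
  have := NN.smul_mem a h
  rwa [Algebra.smul_def] at this

lemma int_of (x : L10) (h1 : x ∈ NN) (h2 : x * b5 ∈ NN) (h3 : x * b7 ∈ NN) : IsIntegral ℤ x := by
  have : IsIntegral (𝓞 L10) x := by
    refine isIntegral_of_smul_mem_submodule NN ?_ ?_ x ?_
    · intro h
      have := one_NN
      rw [h] at this
      simp at this
    · exact Submodule.fg_span (by simp)
    · intro n hn
      refine Submodule.span_induction (p := fun n _ => x • n ∈ NN) ?_ ?_ ?_ ?_ hn
      · rintro y (rfl | rfl | rfl)
        · simpa using h1
        · exact h2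
        · exact h3
      · simp
      · intro a b _ _ ha hb
        rw [smul_add]; exact NN.add_mem ha hb
      · intro a b _ hb
        rw [smul_comm]; exact NN.smul_mem a hb
  exact isIntegral_trans x this

lemma b5b7_NN : b5 * b7 ∈ NN := by
  rw [b5_b7]
  refine NN.add_mem ?_ ?_
  · have := smul_NN (4 * tO - tO ^ 3) b7_NN
    simpa [map_ofNat] using this
  · have := smul_NN (2 * tO ^ 6 - tO ^ 3) one_NN
    simpa [map_ofNat] using this

lemma b5_int : IsIntegral ℤ b5 := by
  refine int_of _ b5_NN ?_ b5b7_NN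
  rw [b5_b5]
  refine NN.add_mem ?_ ?_
  · have := smul_NN (-2 * tO) b7_NN
    simpa [map_ofNat] using this
  · have := smul_NN (tO ^ 6 + 4 * tO ^ 4) one_NN
    simpa [map_ofNat] using this

def b5O : 𝓞 L10 := ⟨b5, b5_int⟩
@[simp] lemma b5O_coe : ((b5O : 𝓞 L10) : L10) = b5 := rfl

lemma b7_int : IsIntegral ℤ b7 := by
  refine int_of _ b7_NN (by rw [mul_comm]; exact b5b7_NN) ?_
  rw [b7_b7]
  refine NN.add_mem ?_ ?_
  · have := smul_NN (1 - 2 * (b5O : 𝓞 L10)) b7_NN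
    simpa [map_ofNat] using this
  · have := smul_NN (4 * tO^6 - tO^5 + 16 * tO^4 - 2 * tO^3 - 1) one_NN
    simpa [map_ofNat] using this

def b7O : 𝓞 L10 := ⟨b7, b7_int⟩

lemma b5O_eq : 8 * b5O = ev tO [4, 0, 0, 0, 0, 2] := by
  apply RingOfIntegers.coe_injective
  simp only [map_mul, ev_map, map_ofNat]
  change 8 * b5 = ev tL _
  simp [b5]; ring
lemma b7O_eq : 8 * b7O = ev tO [0, 0, 2, 0, 0, 0, 0, 1] := by
  apply RingOfIntegers.coe_injective
  simp only [map_mul, ev_map, map_ofNat]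
  change 8 * b7 = ev tL _
  simp [b7]; ring

/-- `l / 8` is integral -/
def checkInt (l : List ℤ) : Bool :=
  let c7 := [l.getD 7 0, l.getD 8 0, l.getD 9 0]
  let c5 := [l.getD 5 0 / 2, l.getD 6 0 / 2]
  let m := addL (mulL [0, 0, 2, 0, 0, 0, 0, 1] c7) (mulL [4, 0, 0, 0, 0, 2] c5)
  let c0 := (subL l m).map (fun a => a / 8)
  eqM 0 l (addL m (smulL 8 c0))

lemma exists_int {l : List ℤ} (h : checkInt l = true) : ∃ y : 𝓞 L10, 8 * y = ev tO l := by
  unfold checkInt at h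
  simp only at h
  have := ev_eq0 tO h
  rw [this]
  simp only [ev_addL, ev_mulL, ev_smulL, ← b7O_eq, ← b5O_eq]
  generalize ev tO [l.getD 7 0, l.getD 8 0, l.getD 9 0] = a
  generalize ev tO [l.getD 5 0 / 2, l.getD 6 0 / 2] = b
  generalize ev tO (List.map _ _) = c
  exact ⟨b7O * a + b5O * b + c, by push_cast; ring⟩

end
end Skl


namespace Skl
noncomputable section

def pF (s x : ℝ) : ℝ := x^6+4*x^4-16*x^2+4*s*x-64+8*s*x⁻¹+4*(x^4)⁻¹
def pF1 (s x : ℝ) : ℝ := 6*x^5+16*x^3-32*x+4*s-8*s*(x^2)⁻¹-16*(x^5)⁻¹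

lemma pF_deriv (s x : ℝ) (hx : 0 < x) : HasDerivAt (pF s) (pF1 s x) x := by
  have hx0 : x ≠ 0 := hx.ne'
  have h := ((((((hasDerivAt_pow 6 x).add ((hasDerivAt_pow 4 x).const_mul 4)).sub
    ((hasDerivAt_pow 2 x).const_mul 16)).add ((hasDerivAt_id x).const_mul (4*s))).sub_const 64).add
    ((hasDerivAt_inv hx0).const_mul (8*s))).add (((hasDerivAt_pow 4 x).inv (by positivity)).const_mul 4)
  refine h.congr_deriv ?_
  unfold pF1
  field_simp
  norm_num
  ring

lemma pF1_deriv (s x : ℝ) (hx : 0 < x) : HasDerivAt (pF1 s)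
    (30*x^4+48*x^2-32+16*s*(x^3)⁻¹+80*(x^6)⁻¹) x := by
  have hx0 : x ≠ 0 := hx.ne'
  have h := ((((((hasDerivAt_pow 5 x).const_mul 6).add ((hasDerivAt_pow 3 x).const_mul 16)).sub
    ((hasDerivAt_id x).const_mul 32)).add_const (4*s)).sub
    (((hasDerivAt_pow 2 x).inv (by positivity)).const_mul (8*s))).sub
     (((hasDerivAt_pow 5 x).inv (by positivity)).const_mul 16)
  refine h.congr_deriv ?_
  field_simp
  norm_num
  ring

lemma pF2_pos (s x : ℝ) (hs : s = 1 ∨ s = -1) (hx : 0 < x) :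
    0 < 30*x^4+48*x^2-32+16*s*(x^3)⁻¹+80*(x^6)⁻¹ := by
  have h1 : 0 < (x^3)⁻¹ := by positivity
  have e : (x^6)⁻¹ = (x^3)⁻¹ ^ 2 := by rw [← inv_pow, ← inv_pow]; ring
  have e2 : x^3 * (x^3)⁻¹ = 1 := by field_simp
  rw [e]
  set y := (x^3)⁻¹ with hy
  have hs2 : -16 * y ≤ 16 * s * y := by rcases hs with rfl | rfl <;> linarith
  by_cases hc : x < 1
  · have h3 : x ^ 3 ≤ 1 := pow_le_one₀ hx.le hc.le
    have hy1 : 1 ≤ y := by nlinarith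
    have : 0 < x ^ 4 := by positivity
    have : 0 < x ^ 2 := by positivity
    nlinarith
  · have h2 : 1 ≤ x ^ 2 := by nlinarith
    have h4 : 0 < x ^ 4 := by positivity
    nlinarith [sq_nonneg (y - 1/10)]

lemma pF_convex (s : ℝ) (hs : s = 1 ∨ s = -1) : StrictConvexOn ℝ (Set.Ioi 0) (pF s) := by
  have hd : ∀ x ∈ Set.Ioi (0:ℝ), deriv (pF s) x = pF1 s x := fun x hx => (pF_deriv s x hx).deriv
  refine strictConvexOn_of_deriv2_pos' (convex_Ioi 0) ?_ ?_
  · intro x hx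
    exact (pF_deriv s x hx).continuousAt.continuousWithinAt
  · intro x hx
    have : deriv^[2] (pF s) x = deriv (pF1 s) x := by
      simp only [Function.iterate_succ, Function.iterate_zero, Function.comp, id]
      apply Filter.EventuallyEq.deriv_eq
      filter_upwards [Ioi_mem_nhds hx] with y hy
      exact hd y hy
    rw [this, (pF1_deriv s x hx).deriv]
    exact pF2_pos s x hs hx

/-- a strictly convex function has at most two zeros -/
lemma two_zeros {f : ℝ → ℝ} {D : Set ℝ} (hf : StrictConvexOn ℝ D f) {a b c : ℝ} (ha : a ∈ D)
    (hc : c ∈ D) (hab : a < b) (hbc : b < c) (fa : f a = 0) (fb : f b = 0) (fc : f c = 0) : False := by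
  have := hf.slope_strict_mono_adjacent ha hc hab hbc
  simp [fa, fb, fc] at this

lemma pF_root (s x : ℝ) (hs : s = 1 ∨ s = -1) (hx : 0 < x) (h : ev (s * x) g10L = 0) :
    pF s x = 0 := by
  have hs2 : s ^ 2 = 1 := by rcases hs with rfl | rfl <;> norm_num
  have : ev (s * x) g10L = x ^ 4 * pF s x := by
    unfold pF
    simp [g10L]
    field_simp
    rcases hs with rfl | rfl <;> ring
  rw [this] at h
  exact (mul_eq_zero.1 h).resolve_left (by positivity)

lemma card_le_two {f : ℝ → ℝ} {D : Set ℝ} (hf : StrictConvexOn ℝ D f) (A : Finset ℝ)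
    (hA : ∀ x ∈ A, x ∈ D ∧ f x = 0) : A.card ≤ 2 := by
  by_contra hc
  push Not at hc
  let e := A.orderEmbOfFin rfl
  have hm : ∀ i, e i ∈ A := fun i => A.orderEmbOfFin_mem rfl i
  have h01 : e ⟨0, by omega⟩ < e ⟨1, by omega⟩ := e.lt_iff_lt.2 (by simp)
  have h12 : e ⟨1, by omega⟩ < e ⟨2, by omega⟩ := e.lt_iff_lt.2 (by simp)
  exact two_zeros hf (hA _ (hm _)).1 (hA _ (hm _)).1 h01 h12 (hA _ (hm _)).2 (hA _ (hm _)).2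
    (hA _ (hm _)).2

lemma real_roots (A : Finset ℝ) (hA : ∀ x ∈ A, ev x g10L = 0) : A.card ≤ 4 := by
  classical
  have h0 : ∀ x ∈ A, x ≠ 0 := by
    rintro x hx rfl
    have := hA _ hx
    simp [g10L] at this
  have e : A = A.filter (fun x => 0 < x) ∪ A.filter (fun x => x < 0) := by
    ext x
    simp only [Finset.mem_union, Finset.mem_filter]
    constructor
    · intro h
      rcases lt_or_gt_of_ne (h0 x h) with h1 | h1
      · exact Or.inr ⟨h, h1⟩
      · exact Or.inl ⟨h, h1⟩
    · rintro (h | h) <;> exact h.1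
  have h1 : (A.filter (fun x => 0 < x)).card ≤ 2 := by
    refine card_le_two (pF_convex 1 (Or.inl rfl)) _ ?_
    intro x hx
    rw [Finset.mem_filter] at hx
    exact ⟨hx.2, pF_root 1 x (Or.inl rfl) hx.2 (by rw [one_mul]; exact hA x hx.1)⟩
  have h2 : (A.filter (fun x => x < 0)).card ≤ 2 := by
    rw [← Finset.card_image_of_injective _ (neg_injective (G := ℝ))]
    refine card_le_two (pF_convex (-1) (Or.inr rfl)) _ ?_
    intro x hx
    rw [Finset.mem_image] at hx
    obtain ⟨y, hy, rfl⟩ := hx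
    rw [Finset.mem_filter] at hy
    refine ⟨by simpa using hy.2, pF_root (-1) (-y) (Or.inr rfl) (by linarith [hy.2]) ?_⟩
    rw [show (-1:ℝ) * -y = y by ring]; exact hA y hy.1
  rw [e]
  exact (Finset.card_union_le _ _).trans (by omega)

end
end Skl


namespace Skl
noncomputable section

lemma tors_real {L : Type*} [Field L] [NumberField L] (φ : L →+* ℝ) (z : (𝓞 L)ˣ)
    (hz : z ∈ Units.torsion L) : z ^ 2 = 1 := by
  have h1 : IsOfFinOrder z := hz
  rw [isOfFinOrder_iff_pow_eq_one] at h1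
  obtain ⟨n, hn, h⟩ := h1
  let ψ : 𝓞 L →+* ℝ := φ.comp (algebraMap (𝓞 L) L)
  have hinj : Function.Injective ψ := φ.injective.comp RingOfIntegers.coe_injective
  have h2 : ψ z ^ n = 1 := by
    rw [← map_pow, ← Units.val_pow_eq_pow_val, h]; simp
  have h3 : |ψ z| = 1 := by
    have : |ψ z| ^ n = 1 := by rw [← abs_pow, h2, abs_one]
    exact (pow_eq_one_iff_of_nonneg (abs_nonneg _) hn.ne').1 this
  have h4 : ψ z ^ 2 = 1 := by rw [← sq_abs, h3, one_pow]
  ext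
  congr 1
  apply hinj
  rw [Units.val_pow_eq_pow_val, map_pow, h4]; simp

lemma rank_le {L : Type*} [Field L] [NumberField L] (m r : ℕ)
    (h1 : Module.finrank ℚ L = 2 * m) (h2 : nrRealPlaces L ≤ 2 * r) : Units.rank L ≤ m + r - 1 := by
  have h3 := card_add_two_mul_card_eq_rank L
  rw [Units.rank, card_eq_nrRealPlaces_add_nrComplexPlaces]
  omega

lemma real_ofReal {L : Type*} [Field L] (φ : L →+* ℂ) (h : ComplexEmbedding.IsReal φ) (x : L) :
    φ x = ((φ x).re : ℂ) := by
  have := RingHom.congr_fun (ComplexEmbedding.isReal_iff.1 h) x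
  rw [ComplexEmbedding.conjugate_coe_eq] at this
  exact (Complex.conj_eq_iff_re.1 this).symm

lemma hom_ext10 {S : Type*} [Field S] [Algebra ℚ S] (φ ψ : L10 →+* S) (h : φ tL = ψ tL) : φ = ψ := by
  have : φ.toRatAlgHom = ψ.toRatAlgHom := by
    refine pbL.algHom_ext ?_
    rw [pbL_gen]
    exact h
  ext x
  exact congrArg (fun f => f x) this

lemma nrReal_L10 : nrRealPlaces L10 ≤ 4 := by
  classical
  rw [← card_real_embeddings]
  let f : { φ : L10 →+* ℂ // ComplexEmbedding.IsReal φ } → ℝ := fun φ => (φ.1 tL).re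
  have hf : Function.Injective f := by
    intro φ ψ h
    apply Subtype.ext
    apply hom_ext10
    rw [real_ofReal φ.1 φ.2, real_ofReal ψ.1 ψ.2]
    exact congrArg _ h
  rw [← Finset.card_univ, ← Finset.card_image_of_injective _ hf]
  apply real_roots
  intro x hx
  rw [Finset.mem_image] at hx
  obtain ⟨φ, -, rfl⟩ := hx
  have h1 := congrArg φ.1 tL_root
  rw [ev_map, map_zero, real_ofReal φ.1 φ.2] at h1
  have h2 := ev_map (f φ) Complex.ofRealHom g10L
  rw [show Complex.ofRealHom (f φ) = (((φ.1 tL).re : ℝ) : ℂ) from rfl, h1] at h2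
  exact (map_eq_zero _).1 h2

lemma rank_L10 : Units.rank L10 ≤ 6 := rank_le 5 2 finrank_L10 nrReal_L10

def evI (lo hi : ℚ) : List ℤ → ℚ × ℚ
  | [] => (0, 0)
  | a :: l =>
    let p := evI lo hi l
    (a + min (lo * p.1) (hi * p.1), a + max (lo * p.2) (hi * p.2))

lemma ev_evI (lo hi : ℚ) (x : ℝ) (h0 : 0 < lo) (h1 : lo ≤ x) (h2 : x ≤ hi) (l : List ℤ) :
    ((evI lo hi l).1 : ℝ) ≤ ev x l ∧ ev x l ≤ (evI lo hi l).2 := by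
  have h0' : (0:ℝ) < lo := by exact_mod_cast h0
  induction l with
  | nil => simp [evI]
  | cons a l ih =>
    obtain ⟨i1, i2⟩ := ih
    simp only [evI, ev_cons]
    push_cast
    refine ⟨add_le_add le_rfl ?_, add_le_add le_rfl ?_⟩
    · refine le_trans ?_ (mul_le_mul_of_nonneg_left i1 (by linarith))
      rcases le_total 0 ((evI lo hi l).1 : ℝ) with h | h
      · exact (min_le_left _ _).trans (by nlinarith)
      · exact (min_le_right _ _).trans (by nlinarith)
    · refine le_trans (mul_le_mul_of_nonneg_left i2 (by linarith)) ?_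
      rcases le_total 0 ((evI lo hi l).2 : ℝ) with h | h
      · exact le_trans (by nlinarith) (le_max_right _ _)
      · exact le_trans (by nlinarith) (le_max_left _ _)

lemma ev_cont (l : List ℤ) : Continuous (fun x : ℝ => ev x l) := by
  induction l with
  | nil => simp only [ev_nil]; fun_prop
  | cons a l ih => simp only [ev_cons]; fun_prop

lemma exists_real_hom : ∃ φ : L10 →+* ℝ, ((5294/10000 : ℚ) : ℝ) ≤ φ tL ∧ φ tL ≤ ((5295/10000 : ℚ) : ℝ) := by
  have h := intermediate_value_Icc' (a := ((5294/10000 : ℚ) : ℝ)) (b := ((5295/10000 : ℚ) : ℝ))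
    (by norm_num) (ev_cont g10L).continuousOn
  have h2 := h (a := 0) ⟨by norm_num [g10L], by norm_num [g10L]⟩
  obtain ⟨x, hx, hx0⟩ := h2
  have hr : gQ.eval₂ (algebraMap ℚ ℝ) x = 0 := by
    have := aeval_ev (R := ℚ) x g10L
    rw [← gQ_ev] at this
    exact this.trans hx0
  let φ : L10 →+* ℝ := AdjoinRoot.lift (algebraMap ℚ ℝ) x hr
  have hφ : φ tL = x := AdjoinRoot.lift_root hr
  exact ⟨φ, by rw [hφ]; exact hx⟩

lemma mkUnit10 (A B : List ℤ) (hA : checkInt A = true) (hB : checkInt B = true)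
    (h : eqM 0 (mulM red10 9 0 A B) [64] = true) : ∃ u : (𝓞 L10)ˣ, 8 * (u : 𝓞 L10) = ev tO A := by
  obtain ⟨a, ha⟩ := exists_int hA
  obtain ⟨b, hb⟩ := exists_int hB
  have h1 := ev_eq0 tO h
  rw [ev_mulM0 tO relO, ← ha, ← hb] at h1
  have h2 : a * b = 1 := by
    have : (64 : 𝓞 L10) ≠ 0 := by norm_num
    apply mul_left_cancel₀ this
    simp at h1
    linear_combination h1
  exact ⟨Units.mkOfMulEqOne a b h2, ha⟩

lemma tors_L10 (z : (𝓞 L10)ˣ) (hz : z ∈ Units.torsion L10) : z ^ 2 = 1 := by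
  obtain ⟨φ, -⟩ := exists_real_hom
  exact tors_real φ z hz

end
end Skl


namespace Skl
noncomputable section

def L20 (d : L10) : Type := QuadraticAlgebra L10 d 0

section
variable (d : L10) [hd : Fact (∀ x : L10, x ^ 2 ≠ d + 0 * x)]

instance : Field (L20 d) := inferInstanceAs (Field (QuadraticAlgebra L10 d 0))
instance : Algebra L10 (L20 d) := inferInstanceAs (Algebra L10 (QuadraticAlgebra L10 d 0))
instance : CharZero (L20 d) := charZero_of_injective_ringHom (algebraMap L10 (L20 d)).injective

def reL (x : L20 d) : L10 := QuadraticAlgebra.re x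
def imL (x : L20 d) : L10 := QuadraticAlgebra.im x
def rL : L20 d := (⟨0, 1⟩ : QuadraticAlgebra L10 d 0)

lemma L20_eq (x : L20 d) : x = algebraMap L10 (L20 d) (reL d x) + rL d * algebraMap L10 (L20 d) (imL d x) := by
  have h : ∀ c : L10, algebraMap L10 (L20 d) c = (⟨c, 0⟩ : QuadraticAlgebra L10 d 0) := fun c => rfl
  rw [h, h]
  refine QuadraticAlgebra.ext ?_ ?_
  · change x.re = x.re + (0 * x.im + d * 1 * 0)
    ring
  · change x.im = 0 + (0 * 0 + 1 * x.im + 0 * 1 * 0)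
    ring

lemma rL_sq : rL d ^ 2 = algebraMap L10 (L20 d) d := by
  have h : algebraMap L10 (L20 d) d = (⟨d, 0⟩ : QuadraticAlgebra L10 d 0) := rfl
  rw [h, sq]
  refine QuadraticAlgebra.ext ?_ ?_
  · change 0 * 0 + d * 1 * 1 = d
    ring
  · change (0:L10) * 1 + 1 * 0 + 0 * 1 * 1 = 0
    ring

lemma finrank_L20' : Module.finrank L10 (L20 d) = 2 := QuadraticAlgebra.finrank_eq_two d 0
instance : Module.Finite L10 (L20 d) := inferInstanceAs (Module.Finite L10 (QuadraticAlgebra L10 d 0))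

instance : NumberField (L20 d) where
  to_charZero := inferInstance
  to_finiteDimensional := Module.Finite.trans L10 (L20 d)

lemma finrank_L20 : Module.finrank ℚ (L20 d) = 20 := by
  rw [← Module.finrank_mul_finrank ℚ L10 (L20 d), finrank_L10, finrank_L20']

lemma hom_ext20 {S : Type*} [Field S] (φ ψ : L20 d →+* S)
    (h : φ.comp (algebraMap L10 (L20 d)) = ψ.comp (algebraMap L10 (L20 d)))
    (h2 : φ (rL d) = ψ (rL d)) : φ = ψ := by
  ext x
  rw [L20_eq d x, map_add, map_add, map_mul, map_mul, h2]
  have e : ∀ c, φ (algebraMap L10 (L20 d) c) = ψ (algebraMap L10 (L20 d) c) := fun c => RingHom.congr_fun h c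
  rw [e, e]

lemma nrReal_L20 : nrRealPlaces (L20 d) ≤ 8 := by
  classical
  rw [← card_real_embeddings]
  let f : { φ : L20 d →+* ℂ // ComplexEmbedding.IsReal φ } →
      { φ : L10 →+* ℂ // ComplexEmbedding.IsReal φ } := fun φ =>
    ⟨φ.1.comp (algebraMap L10 (L20 d)), by
      rw [ComplexEmbedding.isReal_iff]
      ext x
      exact RingHom.congr_fun (ComplexEmbedding.isReal_iff.1 φ.2) (algebraMap L10 (L20 d) x)⟩
  have h4 := nrReal_L10
  rw [← card_real_embeddings] at h4
  have := Finset.card_le_mul_card_image (f := f) (Finset.univ) 2 ?_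
  · rw [Finset.card_univ] at this
    refine this.trans ?_
    have := Finset.card_le_univ (Finset.image f Finset.univ)
    omega
  · intro ψ _
    let g : { φ : L20 d →+* ℂ // ComplexEmbedding.IsReal φ } → ℂ := fun φ => φ.1 (rL d)
    obtain ⟨y, hy⟩ := IsAlgClosed.exists_pow_nat_eq (ψ.1 d) (n := 2) (by norm_num)
    have hsub : ((Finset.univ.filter (fun φ => f φ = ψ)).image g) ⊆ {y, -y} := by
      intro z hz
      rw [Finset.mem_image] at hz
      obtain ⟨φ, hφ, rfl⟩ := hz
      rw [Finset.mem_filter] at hφ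
      have h1 : g φ ^ 2 = y ^ 2 := by
        rw [hy, ← hφ.2]
        change (φ.1 (rL d)) ^ 2 = φ.1 (algebraMap L10 (L20 d) d)
        rw [← map_pow, rL_sq]
      rcases sq_eq_sq_iff_eq_or_eq_neg.1 h1 with h | h <;> simp [h]
    rw [← Finset.card_image_of_injOn (f := g)]
    · exact (Finset.card_le_card hsub).trans Finset.card_le_two
    · intro φ hφ ψ' hψ h
      simp only [Finset.coe_filter, Finset.mem_univ, true_and, Set.mem_ofPred_eq] at hφ hψ
      apply Subtype.ext
      refine hom_ext20 d _ _ ?_ h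
      exact congrArg Subtype.val (hφ.trans hψ.symm)

lemma rank_L20 : Units.rank (L20 d) ≤ 13 := rank_le 10 4 (finrank_L20 d) (nrReal_L20 d)

lemma tors_L20 (φ : L10 →+* ℝ) (h : 0 ≤ φ d) (z : (𝓞 (L20 d))ˣ) (hz : z ∈ Units.torsion (L20 d)) :
    z ^ 2 = 1 := by
  let := φ.toAlgebra
  have hs : √(φ d) * √(φ d) = d • (1:ℝ) + (0:L10) • √(φ d) := by
    rw [zero_smul, add_zero, Real.mul_self_sqrt h, Algebra.smul_def, mul_one]; rfl
  let Φ : L20 d →+* ℝ := (QuadraticAlgebra.lift ⟨√(φ d), hs⟩ : QuadraticAlgebra L10 d 0 →ₐ[L10] ℝ).toRingHom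
  exact tors_real Φ z hz

/-- conjugation -/
def conjL : L20 d →+* L20 d :=
  (QuadraticAlgebra.lift ⟨-rL d, by
    have := rL_sq d
    rw [zero_smul, add_zero, neg_mul_neg, ← sq, this, Algebra.smul_def, mul_one]⟩ :
    QuadraticAlgebra L10 d 0 →ₐ[L10] L20 d).toRingHom

lemma conjL_alg (c : L10) : conjL d (algebraMap L10 (L20 d) c) = algebraMap L10 (L20 d) c := by
  have h : conjL d (algebraMap L10 (L20 d) c) = c • (1 : L20 d) + (0 : L10) • (- rL d) := rfl
  rw [h, zero_smul, add_zero, Algebra.smul_def, mul_one]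
lemma conjL_r : conjL d (rL d) = - rL d := by
  have h : conjL d (rL d) = (0 : L10) • (1 : L20 d) + (1 : L10) • (- rL d) := rfl
  rw [h, one_smul, zero_smul, zero_add]
end

section
variable (d : 𝓞 L10) [hd : Fact (∀ x : L10, x ^ 2 ≠ (d : L10) + 0 * x)]

abbrev LL : Type := L20 (d : L10)

def alO : 𝓞 L10 →+* 𝓞 (LL d) := RingOfIntegers.mapRingHom (algebraMap L10 (L20 (d : L10)))
lemma alO_coe (x : 𝓞 L10) : ((alO d x : 𝓞 (LL d)) : LL d) = algebraMap L10 (LL d) x := rfl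

def coO : 𝓞 (LL d) →+* 𝓞 (LL d) := RingOfIntegers.mapRingHom (conjL (d : L10))
lemma coO_coe (x : 𝓞 (LL d)) : ((coO d x : 𝓞 (LL d)) : LL d) = conjL (d : L10) x := rfl

lemma rL_int : IsIntegral ℤ (rL (d : L10)) := by
  apply IsIntegral.of_pow (n := 2) (by norm_num)
  rw [rL_sq]
  exact (RingOfIntegers.isIntegral_coe d).algebraMap

def rO : 𝓞 (LL d) := ⟨rL (d : L10), rL_int d⟩
lemma rO_coe : ((rO d : 𝓞 (LL d)) : LL d) = rL (d : L10) := rfl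
lemma rO_sq : rO d ^ 2 = alO d d := by
  apply RingOfIntegers.coe_injective
  rw [map_pow]
  exact rL_sq (d : L10)
lemma coO_alO (x : 𝓞 L10) : coO d (alO d x) = alO d x := by
  apply RingOfIntegers.coe_injective
  exact conjL_alg (d : L10) x
lemma coO_rO : coO d (rO d) = - rO d := by
  apply RingOfIntegers.coe_injective
  rw [map_neg]
  exact conjL_r (d : L10)

lemma exists_O {L : Type*} [Field L] (x : L) (h : IsIntegral ℤ x) :
    ∃ y : 𝓞 L, algebraMap (𝓞 L) L y = x := ⟨⟨x, h⟩, rfl⟩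

lemma conj_fix (y : 𝓞 (LL d)) : ∃ c : 𝓞 L10, alO d c = y + coO d y := by
  have e : algebraMap (𝓞 (LL d)) (LL d) (y + coO d y) =
      algebraMap L10 (LL d) (2 * reL (d : L10) (y : LL d)) := by
    rw [map_add]
    change algebraMap (𝓞 (LL d)) (LL d) y + conjL (d : L10) (algebraMap (𝓞 (LL d)) (LL d) y) = _
    have e2 := L20_eq (d : L10) (algebraMap (𝓞 (LL d)) (LL d) y)
    conv_lhs => rw [e2]
    rw [map_add, map_mul, conjL_alg, conjL_alg, conjL_r, map_mul, map_ofNat]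
    ring
  have h2 : IsIntegral ℤ (2 * reL (d : L10) (y : LL d)) := by
    have := RingOfIntegers.isIntegral_coe (y + coO d y)
    rw [e] at this
    exact (isIntegral_algebraMap_iff (algebraMap L10 (LL d)).injective).1 this
  obtain ⟨c, hc⟩ := exists_O _ h2
  refine ⟨c, ?_⟩
  apply RingOfIntegers.coe_injective
  rw [e, ← hc]; rfl

lemma alO_inj : Function.Injective (alO d) := by
  intro x y h
  apply RingOfIntegers.coe_injective
  apply (algebraMap L10 (LL d)).injective
  exact congrArg (algebraMap (𝓞 (LL d)) (LL d)) h

lemma sat20_aux (a b : 𝓞 L10) (h : (3 : 𝓞 (LL d)) ∣ alO d a + rO d * alO d b) :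
    (3 : 𝓞 L10) ∣ 2 * a ∧ (3 : 𝓞 L10) ∣ 2 * (d * b) := by
  obtain ⟨y, hy⟩ := h
  obtain ⟨c, hc⟩ := conj_fix d y
  obtain ⟨c', hc'⟩ := conj_fix d (rO d * y)
  have hy2 := congrArg (coO d) hy
  rw [map_add, map_mul, map_mul, coO_alO, coO_alO, coO_rO, map_ofNat] at hy2
  rw [map_mul, coO_rO] at hc'
  refine ⟨⟨c, alO_inj d ?_⟩, ⟨c', alO_inj d ?_⟩⟩
  · rw [map_mul, map_mul, hc, map_ofNat, map_ofNat]
    linear_combination hy + hy2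
  · rw [map_mul, map_mul, map_mul, hc', map_ofNat, map_ofNat, ← rO_sq]
    linear_combination rO d * hy - rO d * hy2

lemma three_two {x : 𝓞 L10} (h : (3 : 𝓞 L10) ∣ 2 * x) : (3 : 𝓞 L10) ∣ x := by
  obtain ⟨y, hy⟩ := h
  exact ⟨x - y, by linear_combination - hy⟩

def tO' : 𝓞 (LL d) := alO d tO
lemma relO' : tO' d ^ (9 + 1) = ev (tO' d) red10 := by
  have := congrArg (alO d) relO
  rwa [map_pow, ev_map] at this

lemma sat20 (dl di a b : List ℤ) (hdl : 8 * d = ev tO dl)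
    (hdi : eqM 3 (mulM red10 9 3 dl di) [1] = true) (ha : a.length ≤ 10) (hb : b.length ≤ 10)
    (h : (3 : 𝓞 (LL d)) ∣ evP (tO' d) (rO d) (a, b)) (i : ℕ) :
    (3 : ℤ) ∣ a.getD i 0 ∧ (3 : ℤ) ∣ b.getD i 0 := by
  unfold evP at h
  have e : ∀ l, ev (tO' d) l = alO d (ev tO l) := fun l => (ev_map tO (alO d) l).symm
  rw [e, e] at h
  obtain ⟨h1, h2⟩ := sat20_aux d _ _ h
  refine ⟨sat10 a ha (three_two h1) i, sat10 b hb ?_ i⟩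
  have h3 := three_two h2
  have h4 := ev_mulM tO relO 3 dl di
  have h5 := ev_eqM tO hdi
  simp only at h3
  rw [← hdl] at h4
  simp only [Int.cast_ofNat] at h4 h5
  obtain ⟨y, hy⟩ := h3
  obtain ⟨z, hz⟩ := h4
  obtain ⟨w, hw⟩ := h5
  simp at hw
  refine ⟨8 * ev tO di * y + (z - w) * ev tO b, ?_⟩
  linear_combination (- ev tO b) * hw + 8 * ev tO di * hy + ev tO b * hz

/-- norm one units -/
lemma mkUnit20 (a b y : 𝓞 L10) (hy : 8 * y = a) (h : a ^ 2 - d * b ^ 2 = 256) :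
    ∃ u : (𝓞 (LL d))ˣ, 16 * (u : 𝓞 (LL d)) = alO d a + rO d * alO d b := by
  set x : LL d := algebraMap (𝓞 (LL d)) (LL d) (alO d a + rO d * alO d b) / 16 with hx
  set x' : LL d := algebraMap (𝓞 (LL d)) (LL d) (alO d a - rO d * alO d b) / 16 with hx'
  have e1 : algebraMap (𝓞 (LL d)) (LL d) (alO d a) = 8 * algebraMap (𝓞 (LL d)) (LL d) (alO d y) := by
    rw [← hy, map_mul, map_ofNat, map_mul, map_ofNat]
  have hn : (alO d a : 𝓞 (LL d)) ^ 2 - rO d ^ 2 * (alO d b) ^ 2 = 256 := by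
    rw [rO_sq, ← map_pow, ← map_pow, ← map_mul, ← map_sub, h, map_ofNat]
  have hn2 := congrArg (algebraMap (𝓞 (LL d)) (LL d)) hn
  rw [map_sub, map_mul, map_pow, map_pow, map_pow, map_ofNat] at hn2
  have hxx : x * x' = 1 := by
    rw [hx, hx', map_add, map_sub, map_mul]
    linear_combination (1 / 256) * hn2
  have hsum : x + x' = algebraMap (𝓞 (LL d)) (LL d) (alO d y) := by
    rw [hx, hx', map_add, map_sub, map_mul, e1]
    ring
  have int : ∀ z : LL d, z ^ 2 - algebraMap (𝓞 (LL d)) (LL d) (alO d y) * z + 1 = 0 → IsIntegral ℤ z := by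
    intro z hz
    have : IsIntegral (𝓞 (LL d)) z := by
      refine ⟨X ^ 2 + C (-(alO d y)) * X + C 1, by monicity!, ?_⟩
      simp
      linear_combination hz
    exact isIntegral_trans z this
  have hxi : IsIntegral ℤ x := int x (by rw [← hsum]; linear_combination - hxx)
  have hxi' : IsIntegral ℤ x' := int x' (by rw [← hsum]; linear_combination - hxx)
  obtain ⟨u, hu⟩ := exists_O x hxi
  obtain ⟨v, hv⟩ := exists_O x' hxi'
  refine ⟨Units.mkOfMulEqOne u v (RingOfIntegers.coe_injective ?_), ?_⟩
  · rw [map_one, map_mul, hu, hv]; exact hxx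
  · apply RingOfIntegers.coe_injective
    rw [map_mul, map_ofNat]
    change 16 * algebraMap (𝓞 (LL d)) (LL d) u = _
    rw [hu, hx]; field_simp

end

end
end Skl


namespace Skl
noncomputable section

lemma ev_sum {R : Type*} [CommRing R] (x : R) (n : ℕ) (l : List ℤ) (h : l.length ≤ n) :
    ev x l = ∑ j ∈ Finset.range n, ((l.getD j 0 : ℤ) : R) * x ^ j := by
  rw [ev_X_ofFn]
  apply Finset.sum_subset (Finset.range_mono h)
  intro j _ hj
  simp only [Finset.mem_range, not_lt] at hj
  rw [List.getD_eq_default _ _ hj]; simp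

def dotL : List ℤ → List ℤ → ℤ
  | [], _ => 0
  | _ :: _, [] => 0
  | a :: l, b :: m => a * b + dotL l m

lemma dotL_sum (n : ℕ) (l m : List ℤ) (h : l.length ≤ n) :
    dotL l m = ∑ j ∈ Finset.range n, l.getD j 0 * m.getD j 0 := by
  induction l generalizing m n with
  | nil => simp [dotL]
  | cons a l ih =>
    cases n with
    | zero => simp at h
    | succ n =>
      cases m with
      | nil => simp [dotL]
      | cons b m =>
        rw [Finset.sum_range_succ', dotL, ih n m (by simpa using h)]
        simp; ring

section
variable {R : Type*} [CommRing R] (b : ℕ → R) (N : ℕ)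

def FF (l : List ℤ) : R := ∑ j ∈ Finset.range N, ((l.getD j 0 : ℤ) : R) * b j

def Sat : Prop := ∀ c : ℕ → ℤ, (3 : R) ∣ ∑ j ∈ Finset.range N, (c j : R) * b j → ∀ j < N, (3 : ℤ) ∣ c j

variable {b N}

lemma pairing (hs : Sat b N) {n : ℕ} (a : Fin n → ℤ) (W : Fin n → List ℤ) (c : ℤ) (v lam : List ℤ)
    (hl : lam.length ≤ N)
    (h : (3 : R) ∣ (c : R) * FF b N v - ∑ i, (a i : R) * FF b N (W i)) :
    (3 : ℤ) ∣ c * dotL lam v - ∑ i, a i * dotL lam (W i) := by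
  have h1 : (c : R) * FF b N v - ∑ i, (a i : R) * FF b N (W i) =
      ∑ j ∈ Finset.range N, ((c * v.getD j 0 - ∑ i, a i * (W i).getD j 0 : ℤ) : R) * b j := by
    simp only [FF, Finset.mul_sum]
    rw [Finset.sum_comm, ← Finset.sum_sub_distrib]
    apply Finset.sum_congr rfl
    intro j _
    push_cast
    rw [sub_mul, Finset.sum_mul, mul_assoc]
    congr 1
    apply Finset.sum_congr rfl
    intro i _
    ring
  rw [h1] at h
  have h2 := hs _ h
  have h3 : c * dotL lam v - ∑ i, a i * dotL lam (W i) =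
      ∑ j ∈ Finset.range N, lam.getD j 0 * (c * v.getD j 0 - ∑ i, a i * (W i).getD j 0) := by
    simp only [dotL_sum N _ _ hl, Finset.mul_sum]
    rw [Finset.sum_comm, ← Finset.sum_sub_distrib]
    apply Finset.sum_congr rfl
    intro j _
    rw [mul_sub, Finset.mul_sum]
    congr 1
    · ring
    · apply Finset.sum_congr rfl
      intro i _
      ring
  rw [h3]
  apply Finset.dvd_sum
  intro j hj
  exact Dvd.dvd.mul_left (h2 j (Finset.mem_range.1 hj)) _

end

def dualOK (N n : ℕ) (Lam W : List (List ℤ)) : Bool :=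
  (List.range n).all fun i => decide ((Lam.getD i []).length ≤ N) && (List.range n).all fun j =>
    (dotL (Lam.getD i []) (W.getD j [])) % 3 == (if i = j then 1 else 0)

def killOK (N n : ℕ) (W : List (List ℤ)) (lam v : List ℤ) : Bool :=
  decide (lam.length ≤ N) && (dotL lam v % 3 != 0) && (List.range n).all fun j =>
    (dotL lam (W.getD j [])) % 3 == 0

lemma mkSk {L : Type*} [Field L] [NumberField L] {n N : ℕ} {b : ℕ → 𝓞 L} (hs : Sat b N)
    (W Lam : List (List ℤ)) (hrank : Units.rank L ≤ n)
    (htors : ∀ z ∈ Units.torsion L, z ^ 2 = 1)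
    (hu : ∀ i < n, ∃ u : (𝓞 L)ˣ, (9 : 𝓞 L) ∣ (u : 𝓞 L) ^ 242 - (1 + 3 * FF b N (W.getD i [])))
    (hd : dualOK N n Lam W = true) :
    ∃ S : SkData L n, ∀ i, S.w i = FF b N (W.getD i []) := by
  choose e he using fun i : Fin n => hu i i.2
  refine ⟨⟨e, fun i => FF b N (W.getD i []), 242, by norm_num, hrank, ?_, ?_, ?_⟩, fun i => rfl⟩
  · intro i
    rw [Units.val_pow_eq_pow_val]
    exact he i
  · intro z hz
    rw [show 242 = 2 * 121 from rfl, pow_mul, htors z hz, one_pow]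
  · intro a ha i
    simp only [dualOK, List.all_eq_true, List.mem_range, Bool.and_eq_true, decide_eq_true_eq,
      beq_iff_eq] at hd
    have h1 := pairing hs a (fun i => W.getD i []) 0 [] (Lam.getD i []) (hd i i.2).1 (by
      rw [Int.cast_zero, zero_mul, zero_sub]
      exact (dvd_neg).2 ha)
    rw [zero_mul, zero_sub, dvd_neg] at h1
    have h2 : (3:ℤ) ∣ ∑ j, (a j * dotL (Lam.getD i []) (W.getD j []) - if i = j then a j else 0) := by
      apply Finset.dvd_sum
      intro j _
      have h3 := (hd i i.2).2 j j.2
      by_cases hij : i = j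
      · subst hij
        simp only [if_true] at h3 ⊢
        obtain ⟨q, hq⟩ : (3:ℤ) ∣ dotL (Lam.getD i []) (W.getD i []) - 1 := by omega
        exact ⟨a i * q, by linear_combination a i * hq⟩
      · rw [if_neg (fun h => hij (Fin.ext h))] at h3
        rw [if_neg hij, sub_zero]
        exact Dvd.dvd.mul_left (Int.dvd_of_emod_eq_zero h3) _
    rw [Finset.sum_sub_distrib, Finset.sum_ite_eq, if_pos (Finset.mem_univ _)] at h2
    have := dvd_sub h1 h2
    simpa using this

lemma kill {L : Type*} [Field L] [NumberField L] {n N : ℕ} {b : ℕ → 𝓞 L} (hs : Sat b N)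
    {W : List (List ℤ)} (S : SkData L n) (hS : ∀ i, S.w i = FF b N (W.getD i []))
    (lam vl : List ℤ) (hk : killOK N n W lam vl = true)
    (k : ℕ) (u : (𝓞 L)ˣ) (v : 𝓞 L) (s : ℤ) (h3 : ¬ (3 : ℤ) ∣ s)
    (hv : (3 : 𝓞 L) ∣ v - s * FF b N vl)
    (hu : (3 ^ (k + 2) : 𝓞 L) ∣ (u : 𝓞 L) - (1 + 3 ^ (k + 1) * v)) : False := by
  obtain ⟨a, c, hc, h⟩ := S.main k u v hu
  simp only [hS] at h
  simp only [killOK, List.all_eq_true, List.mem_range, Bool.and_eq_true, decide_eq_true_eq,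
      beq_iff_eq, bne_iff_ne] at hk
  obtain ⟨⟨h1, h2⟩, h4⟩ := hk
  have h5 := pairing hs a (fun i => W.getD i []) (c * s) vl lam h1 (by
    obtain ⟨y, hy⟩ := h
    obtain ⟨z, hz⟩ := hv
    refine ⟨y - c * z, ?_⟩
    push_cast
    linear_combination hy - c * hz)
  have h6 : (3:ℤ) ∣ ∑ i : Fin n, a i * dotL lam (W.getD i []) := by
    apply Finset.dvd_sum
    intro i _
    exact Dvd.dvd.mul_left (Int.dvd_of_emod_eq_zero (h4 i i.2)) _
  have h7 := dvd_add h5 h6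
  rw [sub_add_cancel] at h7
  have hp : Prime (3:ℤ) := Int.prime_three
  rcases hp.dvd_or_dvd h7 with h8 | h8
  · rcases hp.dvd_or_dvd h8 with h8 | h8
    · exact hc h8
    · exact h3 h8
  · exact h2 (Int.emod_eq_zero_of_dvd h8)

/-! the two bases -/
def b10 (j : ℕ) : 𝓞 L10 := tO ^ j

lemma FF10 (l : List ℤ) (h : l.length ≤ 10) : FF b10 10 l = ev tO l := (ev_sum tO 10 l h).symm

lemma sat_b10 : Sat b10 10 := by
  intro c h j hj
  have h1 := sat10 ((List.range 10).map c) (by simp) (by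
    rw [ev_sum tO 10 _ (by simp)]
    convert h using 2 with j hj
    have : j < 10 := Finset.mem_range.1 hj
    simp [b10, this]) j
  simpa [hj] using h1

def bP {R : Type*} [CommRing R] (t r : R) (j : ℕ) : R := if j < 10 then t ^ j else r * t ^ (j - 10)

lemma FFP {R : Type*} [CommRing R] (t r : R) (l : List ℤ) (h : l.length ≤ 20) :
    FF (bP t r) 20 l = evP t r (l.take 10, l.drop 10) := by
  have h1 := ev_sum t 10 (l.take 10) (by simp)
  have h2 := ev_sum t 10 (l.drop 10) (by simp; omega)
  rw [evP, h1, h2, FF, show (20 : ℕ) = 10 + 10 from rfl, Finset.sum_range_add, Finset.mul_sum]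
  congr 1
  · apply Finset.sum_congr rfl
    intro j hj
    have : j < 10 := Finset.mem_range.1 hj
    simp [bP, this, List.getElem?_take]
  · apply Finset.sum_congr rfl
    intro j hj
    simp [bP]; ring

section
variable (d : 𝓞 L10) [hd : Fact (∀ x : L10, x ^ 2 ≠ (d : L10) + 0 * x)]

def b20 (j : ℕ) : 𝓞 (LL d) := bP (tO' d) (rO d) j

lemma FF20 (l : List ℤ) (h : l.length ≤ 20) :
    FF (b20 d) 20 l = evP (tO' d) (rO d) (l.take 10, l.drop 10) := FFP (tO' d) (rO d) l h

lemma sat_b20 (dl di : List ℤ) (hdl : 8 * d = ev tO dl)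
    (hdi : eqM 3 (mulM red10 9 3 dl di) [1] = true) : Sat (b20 d) 20 := by
  intro c h j hj
  have h1 := sat20 d dl di ((List.range 10).map c) ((List.range 10).map fun j => c (10 + j)) hdl hdi
    (by simp) (by simp) (by
    have := FF20 d ((List.range 10).map c ++ (List.range 10).map fun j => c (10 + j)) (by simp)
    rw [List.take_left' (by simp), List.drop_left' (by simp)] at this
    rw [← this, FF]
    convert h using 2 with j hj
    have h20 : j < 20 := Finset.mem_range.1 hj
    by_cases h10 : j < 10
    · simp [h10, List.getElem?_append]
    · have : j - 10 < 10 := by omega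
      simp [h10, List.getElem?_append, this, show 10 + (j - 10) = j by omega])
  by_cases h10 : j < 10
  · simpa [h10] using (h1 j).1
  · have : j - 10 < 10 := by omega
    simpa [this, show 10 + (j - 10) = j by omega] using (h1 (j - 10)).2
end

end
end Skl


namespace Skl
noncomputable section

/-- linear combination of lists -/
def lin : List ℤ → List (List ℤ) → List ℤ
  | [], _ => []
  | _ :: _, [] => []
  | a :: l, P :: Ps => addL (smulL a P) (lin l Ps)

def powsM (red : List ℤ) (n : ℕ) (m : ℤ) (q : List ℤ) : ℕ → List ℤ → List (List ℤ)
  | 0, _ => []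
  | k + 1, cur => cur :: powsM red n m q k (mulM red n m cur q)

section
variable {R : Type*} [CommRing R]

lemma ev_powsM (x y : R) {red : List ℤ} {n : ℕ} (h : x ^ (n + 1) = ev x red) (m : ℤ) (q : List ℤ)
    (hq : (m : R) ∣ y - ev x q) (k : ℕ) (l : List ℤ) (hl : l.length ≤ k) (c : R) (cur : List ℤ)
    (hc : (m : R) ∣ c - ev x cur) :
    (m : R) ∣ c * ev y l - ev x (lin l (powsM red n m q k cur)) := by
  induction l generalizing k c cur with
  | nil => simp [lin]
  | cons a l ih =>
    cases k with
    | zero => simp at hl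
    | succ k =>
      have h1 := ih k (by simpa using hl) (c * y) (mulM red n m cur q) (by
        have h2 := dvd_sub_mul hc hq
        have h3 := ev_mulM x h m cur q
        have := dvd_sub h2 h3
        convert this using 1; ring)
      simp only [powsM, lin, ev_cons, ev_addL, ev_smulL]
      obtain ⟨s, hs⟩ := h1
      obtain ⟨t, ht⟩ := hc
      exact ⟨s + a * t, by linear_combination hs + a * ht⟩

lemma cube3 {x y : R} (h : (3 : R) ∣ x - y) : (3 : R) ∣ x ^ 3 - y ^ 3 :=
  h.trans (sub_dvd_pow_sub_pow x y 3)

lemma cube9 {x y : R} (h : (3 : R) ∣ x - y) : (9 : R) ∣ x ^ 3 - y ^ 3 := by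
  obtain ⟨c, hc⟩ := h
  have : x = y + 3 * c := by linear_combination hc
  subst this
  exact ⟨y ^ 2 * c + 3 * y * c ^ 2 + 3 * c ^ 3, by ring⟩

lemma int_cube (a : ℤ) : (3 : R) ∣ (a : R) ^ 3 - a := by
  have : (3 : ℤ) ∣ a ^ 3 - a := by
    have h : a % 3 = 0 ∨ a % 3 = 1 ∨ a % 3 = 2 := by omega
    apply Int.dvd_of_emod_eq_zero
    rcases h with h | h | h <;> simp [Int.sub_emod, pow_succ, Int.mul_emod, h]
  have := map_dvd (Int.castRingHom R) this
  simpa using this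

lemma frob1 (x : R) (l : List ℤ) : (3 : R) ∣ ev x l ^ 3 - ev (x ^ 3) l := by
  induction l with
  | nil => simp
  | cons a l ih =>
    obtain ⟨s, hs⟩ := ih
    obtain ⟨t, ht⟩ := int_cube (R := R) a
    refine ⟨t + x ^ 3 * s + a ^ 2 * (x * ev x l) + a * (x * ev x l) ^ 2, ?_⟩
    simp only [ev_cons]
    linear_combination ht + x ^ 3 * hs

lemma frob (x : R) (l : List ℤ) (k : ℕ) : (3 : R) ∣ ev x l ^ 3 ^ k - ev (x ^ 3 ^ k) l := by
  induction k with
  | zero => simp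
  | succ k ih =>
    have h1 := cube3 ih
    have h2 := frob1 (x ^ 3 ^ k) l
    have := dvd_add h1 h2
    rw [pow_succ, pow_mul, pow_mul]
    convert this using 1; ring

lemma frob_add (A B : R) (k : ℕ) : (3 : R) ∣ (A + B) ^ 3 ^ k - (A ^ 3 ^ k + B ^ 3 ^ k) := by
  induction k with
  | zero => simp
  | succ k ih =>
    obtain ⟨c, hc⟩ := cube3 ih
    rw [pow_succ, pow_mul, pow_mul, pow_mul]
    refine ⟨c + (A ^ 3 ^ k) ^ 2 * B ^ 3 ^ k + A ^ 3 ^ k * (B ^ 3 ^ k) ^ 2, ?_⟩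
    linear_combination hc
end

def bits81 : List Bool := [true, false, false, false, true, false, true]
def bits40 : List Bool := [false, false, false, true, false, true]

def P81 : List (List ℤ) := [[1], [2, 0, 0, 1, 1, 1, 1, 1, 0, 1], [1, 1, 2, 0, 0, 2, 1, 2, 1, 1], [0, 1, 0, 0, 0, 0, 0, 0, 0, 0],
  [2, 2, 0, 1, 2, 0, 2, 1, 0, 0], [2, 1, 1, 0, 1, 2, 0, 1, 1, 1], [0, 0, 1, 0, 0, 0, 0, 0, 0, 0],
  [0, 2, 2, 0, 1, 2, 0, 2, 1, 0], [2, 2, 1, 2, 1, 0, 0, 0, 0, 1], [0, 0, 0, 1, 0, 0, 0, 0, 0, 0]]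

lemma P81_eq : powsM red10 9 3 (powM red10 9 3 [0, 1] bits81) 10 [1] = P81 := by
  decide +kernel

section
variable {R : Type*} [CommRing R] (x r : R) (h : x ^ (9 + 1) = ev x red10)
include h

lemma frob81 (l : List ℤ) (hl : l.length ≤ 10) : (3 : R) ∣ ev x l ^ 81 - ev x (lin l P81) := by
  have h1 := frob x l 4
  have h0 := ev_powM x h 3 [0, 1] bits81
  have h2 := ev_powsM x (x ^ 81) h 3 (powM red10 9 3 [0, 1] bits81) (by
    rw [dvd_sub_comm]
    have e : ev x [0, 1] = x := by simp
    rw [e] at h0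
    exact h0) 10 l hl 1 [1] (by simp)
  rw [P81_eq] at h2
  have := dvd_add h1 (by exact_mod_cast h2)
  convert this using 1; norm_num

def logOK10 (p w : List ℤ) : Bool :=
  let y := modL 3 (lin p P81)
  decide (p.length ≤ 10) && decide (w.length ≤ 10) &&
  eqM 9 (mulM red10 9 9 y (mulM red10 9 9 y y)) (mulM red10 9 9 p (addL [1] (smulL 3 w)))

lemma log10 (u : Rˣ) (p w : List ℤ) (hu : (9 : R) ∣ u - ev x p) (hc : logOK10 p w = true) :
    (9 : R) ∣ (u : R) ^ 242 - (1 + 3 * ev x w) := by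
  simp only [logOK10, Bool.and_eq_true, decide_eq_true_eq] at hc
  obtain ⟨⟨hp, hw⟩, hc⟩ := hc
  set y := modL 3 (lin p P81) with hy
  have h1 := frob81 x h p hp
  have h2 : (3 : R) ∣ (u : R) ^ 81 - ev x y := by
    have a1 : (3 : R) ∣ (u : R) ^ 81 - ev x p ^ 81 :=
      (Dvd.dvd.trans ⟨3, by norm_num⟩ hu).trans (sub_dvd_pow_sub_pow _ _ 81)
    have a2 := ev_modL x 3 (lin p P81)
    have := dvd_sub (dvd_add a1 h1) (by exact_mod_cast a2)
    convert this using 1; ring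
  obtain ⟨c1, e1⟩ := cube9 h2
  obtain ⟨c2, e2⟩ := ev_mulM x h 9 y (mulM red10 9 9 y y)
  obtain ⟨c3, e3⟩ := ev_mulM x h 9 y y
  obtain ⟨c4, e4⟩ := ev_mulM x h 9 p (addL [1] (smulL 3 w))
  obtain ⟨c5, e5⟩ := ev_eqM x hc
  obtain ⟨c6, e6⟩ := hu
  simp only [ev_addL, ev_smulL, ev_cons, ev_nil] at e4
  push_cast at e1 e2 e3 e4 e5
  have key : (9 : R) ∣ (u : R) * ((u : R) ^ 242 - (1 + 3 * ev x w)) := by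
    refine ⟨c1 - c2 - ev x y * c3 + c4 + c5 - c6 * (1 + 3 * ev x w), ?_⟩
    linear_combination e1 - e2 - ev x y * e3 + e4 + e5 - e6 * (1 + 3 * ev x w)
  exact (Units.isUnit u).dvd_mul_left.1 key

def logOK20 (d d40 : List ℤ) (p w : List ℤ × List ℤ) : Bool :=
  let y := (modL 3 (lin p.1 P81), mulM red10 9 3 d40 (modL 3 (lin p.2 P81)))
  decide (p.1.length ≤ 10) && decide (p.2.length ≤ 10) &&
  (let a := mulP red10 9 9 d y (mulP red10 9 9 d y y)
   let b := mulP red10 9 9 d p (addL [1] (smulL 3 w.1), smulL 3 w.2)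
   eqM 9 a.1 b.1 && eqM 9 a.2 b.2)

lemma log20 (d d40 : List ℤ) (hd : (9 : R) ∣ r ^ 2 - ev x d) 
    (hd40 : eqM 3 (powM red10 9 3 d bits40) d40 = true)
    (u : Rˣ) (p w : List ℤ × List ℤ) (hu : (9 : R) ∣ u - evP x r p)
    (hc : logOK20 d d40 p w = true) :
    (9 : R) ∣ (u : R) ^ 242 - (1 + 3 * evP x r w) := by
  simp only [logOK20, Bool.and_eq_true, decide_eq_true_eq] at hc
  set y := (modL 3 (lin p.1 P81), mulM red10 9 3 d40 (modL 3 (lin p.2 P81))) with hy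
  obtain ⟨⟨hp, hp2⟩, hc1, hc2⟩ := hc
  have h39 : (3 : R) ∣ 9 := ⟨3, by norm_num⟩
  have hr : (3 : R) ∣ r ^ 80 - ev x d40 := by
    have b1 : (3 : R) ∣ (r ^ 2) ^ 40 - ev x d ^ 40 :=
      (h39.trans hd).trans (sub_dvd_pow_sub_pow _ _ 40)
    have b2 := ev_powM x h 3 d bits40
    have b3 := ev_eqM x hd40
    have e40 : bitsVal bits40 = 40 := rfl
    rw [e40] at b2
    obtain ⟨c1, e1⟩ := b1
    obtain ⟨c2, e2⟩ := b2
    obtain ⟨c3, e3⟩ := b3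
    push_cast at e2 e3
    exact ⟨c1 - c2 + c3, by linear_combination e1 - e2 + e3⟩
  have h2 : (3 : R) ∣ (u : R) ^ 81 - evP x r y := by
    have a1 : (3 : R) ∣ (u : R) ^ 81 - evP x r p ^ 81 :=
      (h39.trans hu).trans (sub_dvd_pow_sub_pow _ _ 81)
    have a2 := ev_modL x 3 (lin p.1 P81)
    have a3 := ev_modL x 3 (lin p.2 P81)
    have a4 := ev_mulM x h 3 d40 (modL 3 (lin p.2 P81))
    have a5 := frob_add (ev x p.1) (r * ev x p.2) 4
    have a6 := frob81 x h p.1 hp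
    have a7 := frob81 x h p.2 hp2
    obtain ⟨c1, e1⟩ := a1
    obtain ⟨c2, e2⟩ := a2
    obtain ⟨c3, e3⟩ := a3
    obtain ⟨c4, e4⟩ := a4
    obtain ⟨c5, e5⟩ := a5
    obtain ⟨c6, e6⟩ := a6
    obtain ⟨c7, e7⟩ := a7
    obtain ⟨c8, e8⟩ := hr
    have e9 : evP x r p = ev x p.1 + r * ev x p.2 := rfl
    have e10 : evP x r y = ev x (modL 3 (lin p.1 P81)) +
      r * ev x (mulM red10 9 3 d40 (modL 3 (lin p.2 P81))) := rfl
    rw [← e9, show 3 ^ 4 = 81 from rfl, mul_pow] at e5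
    push_cast at e2 e3 e4
    refine ⟨c1 + c5 + c6 + r ^ 81 * c7 + r * ev x (lin p.2 P81) * c8 - r * c4 - r * ev x d40 * c3 - c2, ?_⟩
    rw [e10]
    linear_combination e1 + e5 + e6 + r ^ 81 * e7 + r * ev x (lin p.2 P81) * e8 - r * e4 - r * ev x d40 * e3 - e2
  obtain ⟨c1, e1⟩ := cube9 h2
  have hd9 : ((9 : ℤ) : R) ∣ r ^ 2 - ev x d := by exact_mod_cast hd
  obtain ⟨c2, e2⟩ := ev_mulP x r h 9 d hd9 y (mulP red10 9 9 d y y)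
  obtain ⟨c3, e3⟩ := ev_mulP x r h 9 d hd9 y y
  obtain ⟨c4, e4⟩ := ev_mulP x r h 9 d hd9 p (addL [1] (smulL 3 w.1), smulL 3 w.2)
  obtain ⟨c5, e5⟩ := ev_eqM x hc1
  obtain ⟨c7, e7⟩ := ev_eqM x hc2
  obtain ⟨c6, e6⟩ := hu
  have e8 : evP x r (addL [1] (smulL 3 w.1), smulL 3 w.2) = 1 + 3 * evP x r w := by
    simp [evP]; ring
  rw [e8] at e4
  set A := mulP red10 9 9 d y (mulP red10 9 9 d y y)
  set B := mulP red10 9 9 d p (addL [1] (smulL 3 w.1), smulL 3 w.2)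
  have eA : evP x r A = ev x A.1 + r * ev x A.2 := rfl
  have eB : evP x r B = ev x B.1 + r * ev x B.2 := rfl
  push_cast at e1 e2 e3 e4 e5 e7
  have key : (9 : R) ∣ (u : R) * ((u : R) ^ 242 - (1 + 3 * evP x r w)) := by
    refine ⟨c1 - c2 - evP x r y * c3 + c4 + c5 + r * c7 - c6 * (1 + 3 * evP x r w), ?_⟩
    linear_combination e1 - e2 - evP x r y * e3 + e4 + e5 + r * e7 - e6 * (1 + 3 * evP x r w) + eA - eB
  exact (Units.isUnit u).dvd_mul_left.1 key

end
end
end Skl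


namespace Skl
noncomputable section

def SL : List ℤ := [0, 0, 64, -2, 16, 0, -4, 0, -1]
def UL : List (List ℤ) := [[], [8], SL, [32, 0, 0, 64, -2, 16, 0, -4, 0, -1],
  [0, 32, 256, 0, 64, 0, -16, 0, -4, 0]]
def VL : List (List ℤ) := [[16], SL, [32, 0, -8, 64, -2, 16, 0, -4, 0, -1],
  [-4, 32, 256, -8, 64, -2, -16, 0, -4, 0], [128, -4, -32, 512, -24, 128, -2, -32, 0, -8]]

structure ES (E : Type) [Field E] where
  j : 𝓞 L10 →+* E
  inj : Function.Injective j
  z : E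
  z' : E
  φ : 𝓞 K →+* E
  φ' : 𝓞 K →+* E
  hφ : φ piO = z
  hφ' : φ' piO = z'
  hs : 8 * (z + z') = ev (j tO) SL
  hp : z * z' = j tO ^ 2
  hw : z - z' ≠ 0
  h2 : (2 : E) ≠ 0

lemma mk_ES {E : Type} [Field E] [CharZero E] [IsAlgClosed E] (j : 𝓞 L10 →+* E)
    (inj : Function.Injective j) : Nonempty (ES E) := by
  set t := j tO with ht
  have rel : t ^ (9 + 1) = ev t red10 := by
    have := congrArg j relO
    rwa [map_pow, ev_map] at this
  have h8 : (8 : E) ≠ 0 := by norm_num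
  obtain ⟨w, hw⟩ := IsAlgClosed.exists_pow_nat_eq ((ev t SL / 8) ^ 2 - 4 * t ^ 2) (n := 2) (by norm_num)
  set σ := ev t SL / 8 with hσ
  have e1 : 8 * σ = ev t SL := by rw [hσ]; field_simp
  have i1 : σ ^ 4 - 3 * σ ^ 2 * t ^ 2 + t ^ 4 - 8 * σ ^ 2 + 8 * t ^ 2 + 16 = 0 := by
    have hc : eqM 0 (mulM red10 9 0 (mulM red10 9 0 SL SL)
      (subL (mulM red10 9 0 SL SL) [512, 0, 192])) [-65536, 0, -32768, 0, -4096] = true := by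
      decide +kernel
    have := ev_eq0 t hc
    simp only [ev_mulM0 t rel, ev_subL] at this
    rw [← e1] at this
    simp only [ev_cons, ev_nil] at this
    have h3 : (4096 : E) ≠ 0 := by norm_num
    apply mul_left_cancel₀ h3
    push_cast at this
    linear_combination this
  have i2 : t ^ 2 * (σ ^ 3 - 2 * σ * t ^ 2 - 8 * σ) = -2 := by
    have hc : eqM 0 (mulM red10 9 0 (mulM red10 9 0 [0, 0, 1] SL)
      (subL (mulM red10 9 0 SL SL) [512, 0, 128])) [-1024] = true := by
      decide +kernel
    have := ev_eq0 t hc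
    simp only [ev_mulM0 t rel, ev_subL] at this
    rw [← e1] at this
    simp only [ev_cons, ev_nil] at this
    have h3 : (512 : E) ≠ 0 := by norm_num
    apply mul_left_cancel₀ h3
    push_cast at this
    linear_combination this
  have i3 : w ≠ 0 := by
    intro h0
    rw [h0] at hw
    have hc : eqM 0 (mulM red10 9 0 (subL (mulM red10 9 0 SL SL) [0, 0, 256])
      [129822, -25600, 131072, -271644, 32640, -49777, -4800, 24576, -1000, 5120]) [31954432] = true := by decide +kernel
    have := ev_eq0 t hc
    simp only [ev_mulM0 t rel, ev_subL] at this
    rw [← e1] at this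
    have e : (8 * σ) * (8 * σ) - ev t [0, 0, 256] = 0 := by
      simp only [ev_cons, ev_nil]; push_cast
      linear_combination - 64 * hw
    rw [e, zero_mul] at this
    simp at this
  have key : ∀ z z' : E, z + z' = σ → z * z' = t ^ 2 → ev z hL = 0 := by
    intro z z' h1 h2
    have h3 : z ^ 2 = σ * z - t ^ 2 := by rw [← h1, ← h2]; ring
    simp only [hL, ev_cons, ev_nil]; push_cast
    have h4 : z ^ 3 = (σ ^ 2 - t ^ 2) * z - σ * t ^ 2 := by
      linear_combination (z + σ) * h3
    have h5 : z ^ 5 = (σ ^ 4 - 3 * σ ^ 2 * t ^ 2 + t ^ 4) * z - t ^ 2 * (σ ^ 3 - 2 * σ * t ^ 2) := by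
      linear_combination (z ^ 2) * h4 + ((σ ^ 2 - t ^ 2) * z + (σ ^ 2 - t ^ 2) * σ - σ * t ^ 2) * h3
    linear_combination h5 - 8 * h4 + z * i1 - i2
  have h2 : (2 : E) ≠ 0 := by norm_num
  have hz1 : (σ + w) / 2 + (σ - w) / 2 = σ := by field_simp; ring
  have hz2 : (σ + w) / 2 * ((σ - w) / 2) = t ^ 2 := by
    field_simp; linear_combination - hw
  obtain ⟨φ, hφ⟩ := exists_homK ((σ + w) / 2) (key _ _ hz1 hz2)
  obtain ⟨φ', hφ'⟩ := exists_homK ((σ - w) / 2) (key _ ((σ + w) / 2) (by rw [add_comm]; exact hz1)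
    (by rw [mul_comm]; exact hz2))
  refine ⟨⟨j, inj, _, _, φ, φ', hφ, hφ', ?_, hz2, ?_, h2⟩⟩
  · rw [hz1]; exact e1
  · have : (σ + w) / 2 - (σ - w) / 2 = w := by field_simp; ring
    rw [this]; exact i3

lemma exists_ES : Nonempty (ES (AlgebraicClosure L10)) :=
  mk_ES ((algebraMap L10 (AlgebraicClosure L10)).comp (algebraMap (𝓞 L10) L10))
    ((algebraMap L10 (AlgebraicClosure L10)).injective.comp RingOfIntegers.coe_injective)

lemma ev_lin {R : Type*} [CommRing R] (x : R) (c : List ℤ) (T : List (List ℤ)) (n : ℕ)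
    (h : c.length ≤ n) :
    ev x (lin c T) = ∑ k ∈ Finset.range n, ((c.getD k 0 : ℤ) : R) * ev x (T.getD k []) := by
  induction c generalizing T n with
  | nil => simp [lin]
  | cons a c ih =>
    cases n with
    | zero => simp at h
    | succ n =>
      cases T with
      | nil => simp [lin]
      | cons P T =>
        rw [Finset.sum_range_succ', lin, ev_addL, ev_smulL, ih T n (by simpa using h)]
        simp; ring

def sh : ℕ → List ℤ → List ℤ
  | 0, l => l
  | n + 1, l => shiftL red10 9 (sh n l)

lemma ev_sh {R : Type*} [CommRing R] (x : R) (h : x ^ (9 + 1) = ev x red10) (n : ℕ) (l : List ℤ) :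
    ev x (sh n l) = x ^ n * ev x l := by
  induction n with
  | zero => simp [sh]
  | succ n ih => rw [sh, ev_shiftL x h, ih]; ring

def Dk (k j : ℕ) : List ℤ :=
  if j ≤ k then sh (2 * j) (UL.getD (k - j) []) else smulL (-1) (sh (2 * k) (UL.getD (j - k) []))
def Pk (k j : ℕ) : List ℤ :=
  if j ≤ k then sh (2 * j) (VL.getD (k - j) []) else sh (2 * k) (VL.getD (j - k) [])

def colD (j : ℕ) : List (List ℤ) := (List.range 5).map fun k => Dk k j
def colP (j : ℕ) : List (List ℤ) := (List.range 5).map fun k => Pk k j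

def GLi : List ℤ := [0, 0, 0, 2, 0, 0, 4, 0, 1]

namespace ES
variable {E : Type} [Field E] (S : ES E)

def t : E := S.j tO
def w : E := S.z - S.z'

lemma rel : S.t ^ (9 + 1) = ev S.t red10 := by
  have := congrArg S.j relO
  rwa [map_pow, ev_map] at this


lemma e8 {E : Type} [Field E] (S : ES E) : (8 : E) ≠ 0 := by
  have := pow_ne_zero 3 S.h2
  intro h
  exact this (by linear_combination h)

lemma hU (n : ℕ) (hn : n < 5) : 8 * (S.z ^ n - S.z' ^ n) = S.w * ev S.t (UL.getD n []) := by
  have rc : ∀ n, S.z ^ (n + 2) - S.z' ^ (n + 2) = (S.z + S.z') * (S.z ^ (n + 1) - S.z' ^ (n + 1))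
      - S.t ^ 2 * (S.z ^ n - S.z' ^ n) := by
    intro n
    have := S.hp
    change _ = S.t ^ 2 at this
    rw [← this]; ring
  have st : ∀ n (A B C : List ℤ), eqM 0 (mulM red10 9 0 SL B) (addL (smulL 8 C) (smulL 8 (sh 2 A))) = true →
      8 * (S.z ^ n - S.z' ^ n) = S.w * ev S.t A →
      8 * (S.z ^ (n + 1) - S.z' ^ (n + 1)) = S.w * ev S.t B →
      8 * (S.z ^ (n + 2) - S.z' ^ (n + 2)) = S.w * ev S.t C := by
    intro n A B C hc hA hB
    have h1 := ev_eq0 S.t hc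
    simp only [ev_mulM0 S.t S.rel, ev_addL, ev_smulL, ev_sh S.t S.rel] at h1
    push_cast at h1
    have h2 := S.hs
    change _ = ev S.t SL at h2
    apply mul_left_cancel₀ S.e8
    linear_combination 64 * rc n - 8 * S.t ^ 2 * hA + ev S.t SL * hB + S.w * h1 + 8 * (S.z ^ (n + 1) - S.z' ^ (n + 1)) * h2
  have h0 : 8 * (S.z ^ 0 - S.z' ^ 0) = S.w * ev S.t [] := by simp
  have h1 : 8 * (S.z ^ 1 - S.z' ^ 1) = S.w * ev S.t [8] := by
    simp [w]; ring
  have h2 := st 0 _ _ SL (by decide +kernel) h0 h1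
  have h3 := st 1 _ _ [32, 0, 0, 64, -2, 16, 0, -4, 0, -1] (by decide +kernel) h1 h2
  have h4 := st 2 _ _ [0, 32, 256, 0, 64, 0, -16, 0, -4, 0] (by decide +kernel) h2 h3
  interval_cases n
  · exact h0
  · exact h1
  · exact h2
  · exact h3
  · exact h4

lemma hV (n : ℕ) (hn : n < 5) : 8 * (S.z ^ n + S.z' ^ n) = ev S.t (VL.getD n []) := by
  have rc : ∀ n, S.z ^ (n + 2) + S.z' ^ (n + 2) = (S.z + S.z') * (S.z ^ (n + 1) + S.z' ^ (n + 1))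
      - S.t ^ 2 * (S.z ^ n + S.z' ^ n) := by
    intro n
    have := S.hp
    change _ = S.t ^ 2 at this
    rw [← this]; ring
  have st : ∀ n (A B C : List ℤ), eqM 0 (mulM red10 9 0 SL B) (addL (smulL 8 C) (smulL 8 (sh 2 A))) = true →
      8 * (S.z ^ n + S.z' ^ n) = ev S.t A →
      8 * (S.z ^ (n + 1) + S.z' ^ (n + 1)) = ev S.t B →
      8 * (S.z ^ (n + 2) + S.z' ^ (n + 2)) = ev S.t C := by
    intro n A B C hc hA hB
    have h1 := ev_eq0 S.t hc
    simp only [ev_mulM0 S.t S.rel, ev_addL, ev_smulL, ev_sh S.t S.rel] at h1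
    push_cast at h1
    have h2 := S.hs
    change _ = ev S.t SL at h2
    apply mul_left_cancel₀ S.e8
    linear_combination 64 * rc n - 8 * S.t ^ 2 * hA + ev S.t SL * hB + h1 + 8 * (S.z ^ (n + 1) + S.z' ^ (n + 1)) * h2
  have h0 : 8 * (S.z ^ 0 + S.z' ^ 0) = ev S.t [16] := by simp; norm_num
  have h1 : 8 * (S.z ^ 1 + S.z' ^ 1) = ev S.t SL := by
    have h2 := S.hs
    change _ = ev S.t SL at h2
    rw [← h2]; ring
  have h2 := st 0 _ _ [32, 0, -8, 64, -2, 16, 0, -4, 0, -1] (by decide +kernel) h0 h1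
  have h3 := st 1 _ _ [-4, 32, 256, -8, 64, -2, -16, 0, -4, 0] (by decide +kernel) h1 h2
  have h4 := st 2 _ _ [128, -4, -32, 512, -24, 128, -2, -32, 0, -8] (by decide +kernel) h2 h3
  interval_cases n
  · exact h0
  · exact h1
  · exact h2
  · exact h3
  · exact h4

lemma hD (k j : ℕ) (hk : k < 5) (hj : j < 5) :
    8 * (S.z ^ k * S.z' ^ j - S.z' ^ k * S.z ^ j) = S.w * ev S.t (Dk k j) := by
  have hp := S.hp
  change _ = S.t ^ 2 at hp
  unfold Dk
  split_ifs with h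
  · obtain ⟨m, rfl⟩ := Nat.exists_eq_add_of_le h
    rw [ev_sh S.t S.rel, pow_mul, ← hp, Nat.add_sub_cancel_left]
    linear_combination (S.z * S.z') ^ j * S.hU m (by omega)
  · obtain ⟨m, rfl⟩ := Nat.exists_eq_add_of_le (Nat.le_of_not_le h)
    rw [ev_smulL, ev_sh S.t S.rel, pow_mul, ← hp, Nat.add_sub_cancel_left]
    push_cast
    linear_combination -(S.z * S.z') ^ k * S.hU m (by omega)

lemma hP (k j : ℕ) (hk : k < 5) (hj : j < 5) :
    8 * (S.z ^ k * S.z' ^ j + S.z' ^ k * S.z ^ j) = ev S.t (Pk k j) := by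
  have hp := S.hp
  change _ = S.t ^ 2 at hp
  unfold Pk
  split_ifs with h
  · obtain ⟨m, rfl⟩ := Nat.exists_eq_add_of_le h
    rw [ev_sh S.t S.rel, pow_mul, ← hp, Nat.add_sub_cancel_left]
    linear_combination (S.z * S.z') ^ j * S.hV m (by omega)
  · obtain ⟨m, rfl⟩ := Nat.exists_eq_add_of_le (Nat.le_of_not_le h)
    rw [ev_sh S.t S.rel, pow_mul, ← hp, Nat.add_sub_cancel_left]
    linear_combination (S.z * S.z') ^ k * S.hV m (by omega)

lemma hDl (l : List ℤ) (hl : l.length ≤ 5) (j : ℕ) (hj : j < 5) :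
    8 * (ev S.z l * S.z' ^ j - ev S.z' l * S.z ^ j) = S.w * ev S.t (lin l (colD j)) := by
  rw [ev_sum S.z 5 l hl, ev_sum S.z' 5 l hl, ev_lin S.t l _ 5 hl, Finset.sum_mul, Finset.sum_mul,
    ← Finset.sum_sub_distrib, Finset.mul_sum, Finset.mul_sum]
  apply Finset.sum_congr rfl
  intro k hk
  have hk5 : k < 5 := Finset.mem_range.1 hk
  have : (colD j).getD k [] = Dk k j := by simp [colD, hk5]
  rw [this]
  linear_combination ((l.getD k 0 : ℤ) : E) * S.hD k j hk5 hj

lemma hPl (l : List ℤ) (hl : l.length ≤ 5) (j : ℕ) (hj : j < 5) :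
    8 * (ev S.z l * S.z' ^ j + ev S.z' l * S.z ^ j) = ev S.t (lin l (colP j)) := by
  rw [ev_sum S.z 5 l hl, ev_sum S.z' 5 l hl, ev_lin S.t l _ 5 hl, Finset.sum_mul, Finset.sum_mul,
    ← Finset.sum_add_distrib, Finset.mul_sum]
  apply Finset.sum_congr rfl
  intro k hk
  have hk5 : k < 5 := Finset.mem_range.1 hk
  have : (colP j).getD k [] = Pk k j := by simp [colP, hk5]
  rw [this]
  linear_combination ((l.getD k 0 : ℤ) : E) * S.hP k j hk5 hj

def G : E := ev S.z [1, -8, 0, 2] * S.z' ^ 2 - ev S.z' [1, -8, 0, 2] * S.z ^ 2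

lemma hG : 8 * S.G = S.w * ev S.t GLi := by
  have h1 := S.hDl [1, -8, 0, 2] (by simp) 2 (by norm_num)
  have h2 : eqM 0 (lin [1, -8, 0, 2] (colD 2)) GLi = true := by decide +kernel
  rw [ev_eq0 S.t h2] at h1
  exact h1

lemma hGL : ev S.t GLi ≠ 0 := by
  intro h
  have hc : eqM 0 (mulM red10 9 0 GLi [-128, 514, -64, 256, -4, 0, 1, -16, 0, -2]) [64] = true := by
    decide +kernel
  have := ev_eq0 S.t hc
  rw [ev_mulM0 S.t S.rel, h, zero_mul] at this
  have h2 : (64 : E) = 0 := by simpa using this.symm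
  have h3 : (8 : E) * 8 = 0 := by linear_combination h2
  exact (mul_ne_zero S.e8 S.e8) h3

lemma hw' : S.w ≠ 0 := S.hw

end ES
end
end Skl


namespace Skl
noncomputable section

lemma ev_powsM0 {R : Type*} [CommRing R] (x : R) {red : List ℤ} {n : ℕ} (h : x ^ (n + 1) = ev x red)
    (q : List ℤ) (k : ℕ) (cur : List ℤ) (i : ℕ) (hi : i < k) :
    ev x ((powsM red n 0 q k cur).getD i []) = ev x cur * ev x q ^ i := by
  induction k generalizing cur i with
  | zero => omega
  | succ k ih =>
    cases i with
    | zero => simp [powsM]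
    | succ i =>
      rw [powsM, List.getD_cons_succ, ih _ i (by omega), ev_mulM0 x h]
      ring

lemma int_lin (T : List (List ℤ)) (hT : ∀ k < 5, checkInt (T.getD k []) = true) (c : List ℤ)
    (hc : c.length ≤ 5) : ∃ y : 𝓞 L10, 8 * y = ev tO (lin c T) := by
  choose y hy using fun k : Fin 5 => exists_int (hT k k.2)
  rw [ev_lin tO c T 5 hc, Finset.sum_range]
  refine ⟨∑ k : Fin 5, ((c.getD k 0 : ℤ) : 𝓞 L10) * y k, ?_⟩
  rw [Finset.mul_sum]
  apply Finset.sum_congr rfl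
  intro k _
  rw [← hy k]; ring

def chkABC (kap eta1 : List ℤ) (T R : List (List ℤ)) (dl : List ℤ) : Bool :=
  let E := powsM redK 4 0 [0, 1] 5 (mulM redK 4 0 kap eta1)
  decide (kap.length ≤ 5) && decide (eta1.length ≤ 5) &&
  (List.range 5).all (fun k => decide ((E.getD k []).length ≤ 5) &&
    eqM 0 (mulM red10 9 0 GLi (T.getD k [])) (smulL (-16) (lin (E.getD k []) (colD 2))) &&
    eqM 0 (mulM red10 9 0 GLi (R.getD k [])) (smulL 16 (sh 2 (lin eta1 (colD k)))) &&
    checkInt (T.getD k [])) &&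
  eqM 0 (lin kap ((List.range 5).map fun j => lin kap (colP j))) (smulL 2 dl)

namespace ES
variable {E : Type} [Field E] (S : ES E)

lemma phi (l : List ℤ) : S.φ (ev piO l) = ev S.z l := by rw [ev_map, S.hφ]
lemma phi' (l : List ℤ) : S.φ' (ev piO l) = ev S.z' l := by rw [ev_map, S.hφ']
lemma jj (l : List ℤ) : S.j (ev tO l) = ev S.t l := by rw [ev_map]; rfl

lemma relz : S.z ^ (4 + 1) = ev S.z redK := by
  have := congrArg S.φ piO_relK
  rwa [map_pow, S.hφ, S.phi] at this
lemma relz' : S.z' ^ (4 + 1) = ev S.z' redK := by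
  have := congrArg S.φ' piO_relK
  rwa [map_pow, S.hφ', S.phi'] at this

lemma BLz (X : ℤ) : ev S.z (BL X) = X * S.z ^ 2 + ev S.z [1, -8, 0, 2] := by
  simp [BL]; ring
lemma BLz' (X : ℤ) : ev S.z' (BL X) = X * S.z' ^ 2 + ev S.z' [1, -8, 0, 2] := by
  simp [BL]; ring

lemma norm_ABC {kap eta1 : List ℤ} {T R : List (List ℤ)} {dl : List ℤ}
    (hchk : chkABC kap eta1 T R dl = true) (X X1 : ℤ) (c : List ℤ) (hc : c.length ≤ 5)
    (h : ev piO kap * ev piO c ^ 2 = ev piO (BL X))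
    (h1 : ev piO kap * ev piO eta1 ^ 2 = ev piO (BL X1)) :
    8 * ev S.t (lin c T) ^ 2 - ev S.t dl * ev S.t (lin c R) ^ 2 = 8 * 256 := by
  simp only [chkABC, Bool.and_eq_true, decide_eq_true_eq, List.all_eq_true, List.mem_range] at hchk
  obtain ⟨⟨⟨hk, he⟩, hall⟩, hd⟩ := hchk
  set EE := powsM redK 4 0 [0, 1] 5 (mulM redK 4 0 kap eta1) with hEE
  have f1 := congrArg S.φ h
  have f2 := congrArg S.φ' h
  have f3 := congrArg S.φ h1
  have f4 := congrArg S.φ' h1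
  rw [map_mul, map_pow] at f1 f2 f3 f4
  rw [S.phi, S.phi, S.phi, S.BLz] at f1 f3
  rw [S.phi', S.phi', S.phi', S.BLz'] at f2 f4
  -- T
  have gT : ev S.t GLi * ev S.t (lin c T) * S.w = -128 * (ev S.z kap * ev S.z eta1 * ev S.z c * S.z' ^ 2 -
      ev S.z' kap * ev S.z' eta1 * ev S.z' c * S.z ^ 2) := by
    rw [ev_lin S.t c T 5 hc, ev_sum S.z 5 c hc, ev_sum S.z' 5 c hc, Finset.mul_sum, Finset.mul_sum,
      Finset.mul_sum, Finset.sum_mul, Finset.sum_mul, Finset.sum_mul, ← Finset.sum_sub_distrib,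
      Finset.mul_sum]
    apply Finset.sum_congr rfl
    intro k hk
    have hk5 : k < 5 := Finset.mem_range.1 hk
    obtain ⟨⟨⟨q1, q2⟩, q3⟩, q4⟩ := hall k hk5
    have r1 := ev_eq0 S.t q2
    have r2 := S.hDl _ q1 2 (by norm_num)
    rw [hEE, ev_powsM0 S.z S.relz _ _ _ _ hk5, ev_powsM0 S.z' S.relz' _ _ _ _ hk5, ← hEE,
      ev_mulM0 S.z S.relz, ev_mulM0 S.z' S.relz'] at r2
    rw [ev_mulM0 S.t S.rel, ev_smulL] at r1
    simp only [ev_cons, ev_nil] at r2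
    push_cast at r1 r2
    linear_combination ((c.getD k 0 : ℤ) : E) * S.w * r1 + 16 * ((c.getD k 0 : ℤ) : E) * r2
  have gR : ev S.t GLi * ev S.t (lin c R) * S.w = -128 * S.t ^ 2 * (ev S.z c * ev S.z' eta1 -
      ev S.z' c * ev S.z eta1) := by
    rw [ev_lin S.t c R 5 hc, ev_sum S.z 5 c hc, ev_sum S.z' 5 c hc, Finset.mul_sum,
      Finset.sum_mul, Finset.sum_mul, Finset.sum_mul, ← Finset.sum_sub_distrib,
      Finset.mul_sum]
    apply Finset.sum_congr rfl
    intro k hk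
    have hk5 : k < 5 := Finset.mem_range.1 hk
    obtain ⟨⟨⟨q1, q2⟩, q3⟩, q4⟩ := hall k hk5
    have r1 := ev_eq0 S.t q3
    have r2 := S.hDl eta1 he k hk5
    rw [ev_mulM0 S.t S.rel, ev_smulL, ev_sh S.t S.rel] at r1
    push_cast at r1
    linear_combination ((c.getD k 0 : ℤ) : E) * S.w * r1 - 16 * S.t ^ 2 * ((c.getD k 0 : ℤ) : E) * r2
  have gd : ev S.t dl = 8 * (ev S.z kap * ev S.z' kap) := by
    have r1 := ev_eq0 S.t hd
    rw [ev_smulL, ev_lin S.t kap _ 5 hk] at r1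
    have r2 : ∑ k ∈ Finset.range 5, ((kap.getD k 0 : ℤ) : E) * ev S.t (List.getD ((List.range 5).map fun j => lin kap (colP j)) k [])
      = ∑ k ∈ Finset.range 5, (8 * ev S.z kap * (((kap.getD k 0 : ℤ) : E) * S.z' ^ k) +
        8 * ev S.z' kap * (((kap.getD k 0 : ℤ) : E) * S.z ^ k)) := by
      apply Finset.sum_congr rfl
      intro k hk'
      have hk5 : k < 5 := Finset.mem_range.1 hk'
      have e : List.getD ((List.range 5).map fun j => lin kap (colP j)) k [] = lin kap (colP k) := by
        simp [hk5]
      rw [e]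
      linear_combination - ((kap.getD k 0 : ℤ) : E) * S.hPl kap hk k hk5
    rw [r2, Finset.sum_add_distrib, ← Finset.mul_sum, ← Finset.mul_sum, ← ev_sum S.z 5 kap hk,
      ← ev_sum S.z' 5 kap hk] at r1
    apply mul_left_cancel₀ S.h2
    push_cast at r1
    linear_combination - r1
  have hG := S.hG
  have hp : S.z * S.z' = S.t ^ 2 := S.hp
  have n1 : ev S.t GLi ^ 2 * S.w ^ 2 ≠ 0 := mul_ne_zero (pow_ne_zero _ S.hGL) (pow_ne_zero _ S.hw')
  apply mul_left_cancel₀ n1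
  have hG2 : S.G = ev S.z [1, -8, 0, 2] * S.z' ^ 2 - ev S.z' [1, -8, 0, 2] * S.z ^ 2 := rfl
  set b := ev S.z [1, -8, 0, 2]
  set b' := ev S.z' [1, -8, 0, 2]
  set g := ev S.t GLi
  set T1 := ev S.t (lin c T)
  set R1 := ev S.t (lin c R)
  set n := ev S.z c
  set n' := ev S.z' c
  set m := ev S.z eta1
  set m' := ev S.z' eta1
  set k := ev S.z kap
  set k' := ev S.z' kap
  have w2 : (g * S.w) ^ 2 = 64 * S.G ^ 2 := by rw [mul_comm g, ← hG]; ring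
  have a1 : (g * T1 * S.w) ^ 2 = 128 ^ 2 * (k * m * n * S.z' ^ 2 - k' * m' * n' * S.z ^ 2) ^ 2 := by
    rw [gT]; ring
  have a2 : (g * R1 * S.w) ^ 2 = 128 ^ 2 * (S.z * S.z') ^ 2 * (n * m' - n' * m) ^ 2 := by
    rw [gR, hp]; ring
  have a3 : (k * m * n * S.z' ^ 2 - k' * m' * n' * S.z ^ 2) ^ 2 - k * k' * (S.z * S.z') ^ 2 * (n * m' - n' * m) ^ 2
      = S.G ^ 2 := by
    have : (k * m * n * S.z' ^ 2 - k' * m' * n' * S.z ^ 2) ^ 2 - k * k' * (S.z * S.z') ^ 2 * (n * m' - n' * m) ^ 2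
      = (k * n ^ 2 * S.z' ^ 2 - k' * n' ^ 2 * S.z ^ 2) * (k * m ^ 2 * S.z' ^ 2 - k' * m' ^ 2 * S.z ^ 2) := by ring
    rw [this, f1, f2, f3, f4, hG2]
    ring
  rw [gd]
  linear_combination 8 * a1 - 8 * k * k' * a2 + 8 * 128 ^ 2 * a3 - 8 * 256 * w2

end ES

lemma unit_ABC (d : 𝓞 L10) [hd : Fact (∀ x : L10, x ^ 2 ≠ (d : L10) + 0 * x)]
    {kap eta1 : List ℤ} {T R : List (List ℤ)} {dl : List ℤ} (hdl : 8 * d = ev tO dl)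
    (hchk : chkABC kap eta1 T R dl = true) (X X1 : ℤ) (c : List ℤ) (hc : c.length ≤ 5)
    (h : ev piO kap * ev piO c ^ 2 = ev piO (BL X))
    (h1 : ev piO kap * ev piO eta1 ^ 2 = ev piO (BL X1)) :
    ∃ u : (𝓞 (LL d))ˣ, 16 * (u : 𝓞 (LL d)) = evP (tO' d) (rO d) (lin c T, lin c R) := by
  obtain ⟨S⟩ := exists_ES
  have key := S.norm_ABC hchk X X1 c hc h h1
  have key2 : 8 * ev tO (lin c T) ^ 2 - ev tO dl * ev tO (lin c R) ^ 2 = 8 * 256 := by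
    apply S.inj
    rw [map_sub, map_mul, map_mul, map_mul, map_pow, map_pow, S.jj, S.jj, S.jj, map_ofNat, map_ofNat]
    exact key
  rw [← hdl] at key2
  simp only [chkABC, Bool.and_eq_true, decide_eq_true_eq, List.all_eq_true, List.mem_range] at hchk
  obtain ⟨y, hy⟩ := int_lin T (fun k hk => (hchk.1.2 k hk).2) c hc
  obtain ⟨u, hu⟩ := mkUnit20 d (ev tO (lin c T)) (ev tO (lin c R)) y hy (by
    have h8 : (8 : 𝓞 L10) ≠ 0 := by norm_num
    apply mul_left_cancel₀ h8
    linear_combination key2)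
  refine ⟨u, ?_⟩
  rw [hu, ev_map, ev_map]
  rfl

def chk0 (T R : List (List ℤ)) : Bool :=
  (List.range 5).all (fun k => eqM 0 (sh 1 (T.getD k [])) (Pk k 1) &&
    eqM 0 (mulM red10 9 0 GLi (R.getD k [])) (smulL 8 (sh 1 (Dk k 1))) &&
    checkInt (T.getD k []) && checkInt (R.getD k []))

lemma ES.norm_0 {E : Type} [Field E] (S : ES E) {T R : List (List ℤ)} (hchk : chk0 T R = true) (X : ℤ) (c : List ℤ)
    (hc : c.length ≤ 5) (h : ev piO c ^ 2 = ev piO (BL X)) :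
    ev S.t (lin c T) * ev S.t (lin c R) = 64 := by
  simp only [chk0, Bool.and_eq_true, List.all_eq_true, List.mem_range] at hchk
  have f1 := congrArg S.φ h
  have f2 := congrArg S.φ' h
  rw [map_pow] at f1 f2
  rw [S.phi, S.phi, S.BLz] at f1
  rw [S.phi', S.phi', S.BLz'] at f2
  have gT : S.t * ev S.t (lin c T) = 8 * (ev S.z c * S.z' + ev S.z' c * S.z) := by
    rw [ev_lin S.t c T 5 hc, ev_sum S.z 5 c hc, ev_sum S.z' 5 c hc, Finset.mul_sum,
      Finset.sum_mul, Finset.sum_mul, ← Finset.sum_add_distrib, Finset.mul_sum]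
    apply Finset.sum_congr rfl
    intro k hk
    have hk5 : k < 5 := Finset.mem_range.1 hk
    obtain ⟨⟨⟨q1, q2⟩, q3⟩, q4⟩ := hchk k hk5
    have r1 := ev_eq0 S.t q1
    have r2 := S.hP k 1 hk5 (by norm_num)
    rw [ev_sh S.t S.rel, ← r2] at r1
    linear_combination ((c.getD k 0 : ℤ) : E) * r1
  have gR : ev S.t GLi * ev S.t (lin c R) * S.w = S.t * (64 * (ev S.z c * S.z' - ev S.z' c * S.z)) := by
    rw [ev_lin S.t c R 5 hc, ev_sum S.z 5 c hc, ev_sum S.z' 5 c hc, Finset.mul_sum,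
      Finset.sum_mul, Finset.sum_mul, Finset.sum_mul, ← Finset.sum_sub_distrib, Finset.mul_sum,
      Finset.mul_sum]
    apply Finset.sum_congr rfl
    intro k hk
    have hk5 : k < 5 := Finset.mem_range.1 hk
    obtain ⟨⟨⟨q1, q2⟩, q3⟩, q4⟩ := hchk k hk5
    have r1 := ev_eq0 S.t q2
    have r2 := S.hD k 1 hk5 (by norm_num)
    rw [ev_mulM0 S.t S.rel, ev_smulL, ev_sh S.t S.rel] at r1
    push_cast at r1
    linear_combination ((c.getD k 0 : ℤ) : E) * S.w * r1 - 8 * S.t * ((c.getD k 0 : ℤ) : E) * r2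
  have hG := S.hG
  have hG2 : S.G = ev S.z [1, -8, 0, 2] * S.z' ^ 2 - ev S.z' [1, -8, 0, 2] * S.z ^ 2 := rfl
  have ht : S.t ≠ 0 := by
    intro h0
    have := S.rel
    rw [h0] at this
    have h4 : (4 : E) = 0 := by simpa [red10] using this
    have h5 : (2 : E) * 2 = 0 := by linear_combination h4
    exact mul_ne_zero S.h2 S.h2 h5
  have n1 : ev S.t GLi * S.w * S.t ≠ 0 := mul_ne_zero (mul_ne_zero S.hGL S.hw') ht
  apply mul_left_cancel₀ n1
  have a1 : (S.t * ev S.t (lin c T)) * (ev S.t GLi * ev S.t (lin c R) * S.w) =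
      S.t * (512 * S.G) := by
    rw [gT, gR, hG2]
    linear_combination S.t * 512 * S.z' ^ 2 * f1 - S.t * 512 * S.z ^ 2 * f2
  linear_combination a1 + 64 * S.t * hG

lemma unit_0 {T R : List (List ℤ)} (hchk : chk0 T R = true) (X : ℤ) (c : List ℤ)
    (hc : c.length ≤ 5) (h : ev piO c ^ 2 = ev piO (BL X)) :
    ∃ u : (𝓞 L10)ˣ, 8 * (u : 𝓞 L10) = ev tO (lin c T) := by
  obtain ⟨S⟩ := exists_ES
  have key := S.norm_0 hchk X c hc h
  have key2 : ev tO (lin c T) * ev tO (lin c R) = 64 := by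
    apply S.inj
    rw [map_mul, S.jj, S.jj, map_ofNat]
    exact key
  simp only [chk0, Bool.and_eq_true, List.all_eq_true, List.mem_range] at hchk
  obtain ⟨a, ha⟩ := int_lin T (fun k hk => (hchk k hk).1.2) c hc
  obtain ⟨b, hb⟩ := int_lin R (fun k hk => (hchk k hk).2) c hc
  have h2 : a * b = 1 := by
    have : (64 : 𝓞 L10) ≠ 0 := by norm_num
    apply mul_left_cancel₀ this
    rw [← ha, ← hb] at key2
    linear_combination key2
  exact ⟨Units.mkOfMulEqOne a b h2, ha⟩

end
end Skl


namespace Skl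
noncomputable section

section
variable {R : Type*} [CommRing R]

lemma ev_congr (a b : R) (l : List ℤ) : a - b ∣ ev a l - ev b l := by
  induction l with
  | nil => simp
  | cons c l ih =>
    obtain ⟨s, hs⟩ := ih
    refine ⟨ev a l + b * s, ?_⟩
    simp only [ev_cons]
    linear_combination b * hs

lemma hens (η e w a : R) (k : ℕ) (h : (η - e) * (1 + 3 * a) = 3 ^ k * w) :
    (3 : R) ^ (k + 1) ∣ η - e - 3 ^ k * w := by
  have h1 : (1 + 3 * a) ∣ 1 - (-(3 * a)) ^ (k + 1) := by
    have := sub_dvd_pow_sub_pow (1 : R) (-(3 * a)) (k + 1)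
    rwa [one_pow, sub_neg_eq_add] at this
  have h2 : ∃ g, 1 - (-(3 * a)) ^ (k + 1) = (1 + 3 * a) * (1 + 3 * g) := by
    clear h h1
    induction k with
    | zero => exact ⟨0, by ring⟩
    | succ k ih =>
      obtain ⟨g, hg⟩ := ih
      refine ⟨-a - 3 * a * g, ?_⟩
      rw [pow_succ]
      linear_combination (-3 * a) * hg
  obtain ⟨g, hg⟩ := h2
  refine ⟨w * g + (η - e) * (-a) ^ (k + 1), ?_⟩
  have e1 : (-(3 * a)) ^ (k + 1) = 3 ^ (k + 1) * (-a) ^ (k + 1) := by rw [← mul_pow]; ring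
  rw [e1] at hg
  linear_combination (1 + 3 * g) * h + (η - e) * hg

lemma hens2 (kap η e nu d : R) (k : ℕ) (h1 : (3 : R) ∣ η - e) (hnu : (3 : R) ∣ kap * e * nu - 1)
    (h : kap * η ^ 2 - kap * e ^ 2 = 3 ^ k * d) :
    (3 : R) ^ (k + 1) ∣ η - e - 3 ^ k * (2 * nu * d) := by
  obtain ⟨s, hs⟩ := h1
  obtain ⟨t, ht⟩ := hnu
  refine hens η e (2 * nu * d) (1 + 4 * t + 2 * kap * nu * s) k ?_
  linear_combination (-2 * kap * nu * (η - e)) * hs + 2 * nu * h - 4 * (η - e) * ht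

lemma sign_aux (kap η e nu : R) (hsq : ∀ q : R, (3 : R) ∣ q ^ 2 - 1 → (3 : R) ∣ q - 1 ∨ (3 : R) ∣ q + 1)
    (hnu : (3 : R) ∣ kap * e * nu - 1) (h : (3 : R) ∣ kap * η ^ 2 - kap * e ^ 2) :
    (3 : R) ∣ η - e ∨ (3 : R) ∣ (-η) - e := by
  obtain ⟨t, ht⟩ := hnu
  obtain ⟨s, hs⟩ := h
  have h1 : (3 : R) ∣ (kap * η * nu) ^ 2 - 1 :=
    ⟨kap * nu ^ 2 * s + (kap * e * nu + 1) * t, by linear_combination kap * nu ^ 2 * hs + (kap * e * nu + 1) * ht⟩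
  rcases hsq _ h1 with ⟨q, hq⟩ | ⟨q, hq⟩
  · left
    exact ⟨e * q - η * t, by linear_combination e * hq - η * ht⟩
  · right
    exact ⟨η * t - e * q, by linear_combination η * ht - e * hq⟩

end

def bits243 : List Bool := [true, true, false, false, true, true, true, true]
def bits121 : List Bool := [true, false, false, true, true, true, true]

lemma powchk {R : Type*} [CommRing R] (x : R) {red : List ℤ} {n : ℕ}
    (h : x ^ (n + 1) = ev x red) (m : ℤ) (p q : List ℤ) (l : List Bool)
    (hc : eqM m (powM red n m p l) q = true) : (m : R) ∣ ev x p ^ (bitsVal l) - ev x q :=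
  dvd_sub_tr (dvd_sub_comm.1 (ev_powM x h m p l)) (ev_eqM x hc)

lemma pi243 : (3 : 𝓞 K) ∣ piO ^ 243 - piO := by
  have h0 := powchk piO piO_relK 3 [0, 1] [0, 1] bits243 (by decide +kernel)
  have e : ev piO [0, 1] = piO := by simp
  have e2 : bitsVal bits243 = 243 := by decide
  rw [e, e2] at h0
  exact_mod_cast h0

lemma K243 (y : 𝓞 K) : (3 : 𝓞 K) ∣ y ^ 243 - y := by
  obtain ⟨l, rfl⟩ := exists_list y
  exact dvd_sub_tr (frob piO l 5) (pi243.trans (ev_congr _ _ l))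

lemma not3 : ¬ (3 : 𝓞 K) ∣ 1 := by
  intro h
  have e : (1 : 𝓞 K) = evK ![1, 0, 0, 0, 0] := by simp [evK]
  rw [e] at h
  have := evK_dvd (n := 3) (by exact_mod_cast h) 0
  norm_num at this

lemma K_two {y : 𝓞 K} (h : (3 : 𝓞 K) ∣ 2 * y) : (3 : 𝓞 K) ∣ y := by
  obtain ⟨z, hz⟩ := h
  exact ⟨y - z, by linear_combination - hz⟩

lemma BL_sub (X x : ℤ) : ev piO (BL X) - ev piO (BL x) = ((X - x : ℤ) : 𝓞 K) * piO ^ 2 := by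
  simp [BL]; ring

lemma K_nonsq (kap : List ℤ) (x : ℤ)
    (hc : eqM 3 (powM redK 4 3 (mulM redK 4 3 kap (BL x)) bits121) [-1] = true)
    (X : ℤ) (hX : 3 ∣ X - x) (η : 𝓞 K) (h : ev piO kap * η ^ 2 = ev piO (BL X)) : False := by
  have h0 := powchk piO piO_relK 3 _ _ _ hc
  have e2 : bitsVal bits121 = 121 := by decide
  rw [e2] at h0
  have h1 := ev_mulM piO piO_relK 3 kap (BL x)
  have h2 : ((3 : ℤ) : 𝓞 K) ∣ ev piO (BL X) - ev piO (BL x) := by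
    rw [BL_sub]
    exact Dvd.dvd.mul_right (by exact_mod_cast map_dvd (Int.castRingHom (𝓞 K)) hX) _
  push_cast at h0 h1 h2
  set y := ev piO kap * η with hy
  have h3 : (3 : 𝓞 K) ∣ y ^ 2 - ev piO (mulM redK 4 3 kap (BL x)) := by
    have e : y ^ 2 = ev piO kap * ev piO (BL X) := by rw [← h, hy]; ring
    rw [e]
    refine dvd_sub_tr ?_ (dvd_sub_comm.1 h1)
    rw [← mul_sub]
    exact h2.mul_left _
  have h4 : (3 : 𝓞 K) ∣ y ^ 242 - (-1) := by
    have a1 := h3.trans (sub_dvd_pow_sub_pow _ _ 121)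
    rw [← pow_mul] at a1
    have := dvd_sub_tr a1 h0
    simpa using this
  have h5 := K243 y
  obtain ⟨a, ha⟩ := h4
  obtain ⟨b, hb⟩ := h5
  have h6 : (3 : 𝓞 K) ∣ y := K_two ⟨y * a - b, by
    rw [pow_succ] at hb
    linear_combination y * ha - hb⟩
  have h7 : (3 : 𝓞 K) ∣ y ^ 242 := h6.trans (dvd_pow_self _ (by norm_num))
  apply not3
  have := dvd_sub ⟨a, ha⟩ h7
  simpa using this

def frobK : List (List ℤ) := [[1], [0, 0, 0, 1], [0, 2, 2, 0, 2], [0, 0, 1, 1, 2], [1, 0, 0, 2, 2]]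

lemma K_sq1 (q : 𝓞 K) (h : (3 : 𝓞 K) ∣ q ^ 2 - 1) : (3 : 𝓞 K) ∣ q - 1 ∨ (3 : 𝓞 K) ∣ q + 1 := by
  obtain ⟨c, hc⟩ := exists_evK q
  have h1 : (3 : 𝓞 K) ∣ q ^ 3 - q := by
    have := h.mul_left q
    have e : q * (q ^ 2 - 1) = q ^ 3 - q := by ring
    rwa [e] at this
  have h2 := frob1 piO [c 0, c 1, c 2, c 3, c 4]
  have h3 := ev_powsM piO (piO ^ 3) piO_relK 3 [0, 0, 0, 1] (by simp; ring_nf; simp) 5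
    [c 0, c 1, c 2, c 3, c 4] (by simp) 1 [1] (by simp)
  have e : powsM redK 4 3 [0, 0, 0, 1] 5 [1] = frobK := by decide +kernel
  rw [e, one_mul] at h3
  have h4 : (3 : 𝓞 K) ∣ ev piO (lin [c 0, c 1, c 2, c 3, c 4] frobK) - evK c := by
    rw [hc] at h1
    push_cast at h3
    have := dvd_sub_tr (dvd_sub_comm.1 (dvd_sub_tr h2 h3)) h1
    exact this
  have h5 : ev piO (lin [c 0, c 1, c 2, c 3, c 4] frobK) - evK c = evK ![c 4, 2 * c 2 - c 1, c 2 + c 3,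
      c 1 + 2 * c 4, 2 * c 2 + 2 * c 3 + c 4] := by
    simp [evK, lin, frobK, smulL, addL]
    ring
  rw [h5] at h4
  have h6 := evK_dvd (n := 3) (by exact_mod_cast h4)
  have g0 := h6 0
  have g1 := h6 1
  have g2 := h6 2
  have g3 := h6 3
  simp at g0 g1 g2 g3
  obtain ⟨a1, b1⟩ : (3 : ℤ) ∣ c 1 := by omega
  obtain ⟨a2, b2⟩ : (3 : ℤ) ∣ c 2 := by omega
  obtain ⟨a3, b3⟩ : (3 : ℤ) ∣ c 3 := by omega
  obtain ⟨a4, b4⟩ : (3 : ℤ) ∣ c 4 := g0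
  have h7 : q - c 0 = 3 * ev piO [0, a1, a2, a3, a4] := by
    rw [hc]; simp [evK, b1, b2, b3, b4]; ring
  have hm : c 0 % 3 = 0 ∨ c 0 % 3 = 1 ∨ c 0 % 3 = 2 := by omega
  rcases hm with hm | hm | hm
  · exfalso
    obtain ⟨a0, b0⟩ := Int.dvd_of_emod_eq_zero hm
    have h8 : (3 : 𝓞 K) ∣ q := ⟨ev piO [0, a1, a2, a3, a4] + a0, by
      rw [b0] at h7; push_cast at h7; linear_combination h7⟩
    apply not3
    have := dvd_sub (h8.mul_right q) h
    have e : q * q - (q ^ 2 - 1) = 1 := by ring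
    rwa [e] at this
  · left
    obtain ⟨a0, b0⟩ : ∃ a, c 0 = 1 + 3 * a := ⟨c 0 / 3, by omega⟩
    exact ⟨ev piO [0, a1, a2, a3, a4] + a0, by
      rw [b0] at h7; push_cast at h7; linear_combination h7⟩
  · right
    obtain ⟨a0, b0⟩ : ∃ a, c 0 = -1 + 3 * a := ⟨c 0 / 3 + 1, by omega⟩
    exact ⟨ev piO [0, a1, a2, a3, a4] + a0, by
      rw [b0] at h7; push_cast at h7; linear_combination h7⟩

def etaOK (kap e nu : List ℤ) (x : ℤ) : Bool :=
  decide (e.length ≤ 5) && eqM 9 (mulM redK 4 9 kap (mulM redK 4 9 e e)) (BL x) &&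
  eqM 3 (mulM redK 4 3 (mulM redK 4 3 kap e) nu) [1]

lemma list_of (η : 𝓞 K) : ∃ c : List ℤ, c.length = 5 ∧ η = ev piO c ∧ ∀ n : ℤ, ∀ e : List ℤ, e.length ≤ 5 →
    (n : 𝓞 K) ∣ η - ev piO e → ∀ k, n ∣ c.getD k 0 - e.getD k 0 := by
  obtain ⟨c, hc⟩ := exists_evK η
  refine ⟨[c 0, c 1, c 2, c 3, c 4], rfl, hc, ?_⟩
  intro n e he h k
  have h1 : η - ev piO e = evK fun i => c i - e.getD i 0 := by
    rw [hc, ev_sum piO 5 e he]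
    simp [evK, Finset.sum_range_succ]; ring
  rw [h1] at h
  have h2 := evK_dvd h
  by_cases hk : k < 5
  · have := h2 ⟨k, hk⟩
    interval_cases k <;> exact this
  · rw [List.getD_eq_default _ _ (by simpa using hk), List.getD_eq_default _ _ (by omega)]
    simp

lemma K_nu {kap e nu : List ℤ} (h : eqM 3 (mulM redK 4 3 (mulM redK 4 3 kap e) nu) [1] = true) :
    (3 : 𝓞 K) ∣ ev piO kap * ev piO e * ev piO nu - 1 := by
  have h1 := ev_mulM piO piO_relK 3 kap e
  have h2 := ev_mulM piO piO_relK 3 (mulM redK 4 3 kap e) nu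
  have h3 := ev_eqM piO h
  have h4 := dvd_sub_tr (dvd_sub_comm.1 (dvd_sub_tr h2 (dvd_sub_mul h1 ((dvd_zero _).trans (by rw [sub_self] : _ ∣ _))))) h3
  simpa using h4

lemma K_sign {kap e nu : List ℤ} {x X : ℤ}
    (h9 : (3 : 𝓞 K) ∣ ev piO kap * ev piO e ^ 2 - ev piO (BL x))
    (hnu : eqM 3 (mulM redK 4 3 (mulM redK 4 3 kap e) nu) [1] = true)
    (hX : 3 ∣ X - x) (η : 𝓞 K) (h : ev piO kap * η ^ 2 = ev piO (BL X)) :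
    ∃ η' : 𝓞 K, ev piO kap * η' ^ 2 = ev piO (BL X) ∧ (3 : 𝓞 K) ∣ η' - ev piO e := by
  have h2 : (3 : 𝓞 K) ∣ ev piO (BL X) - ev piO (BL x) := by
    rw [BL_sub]
    exact Dvd.dvd.mul_right (by exact_mod_cast map_dvd (Int.castRingHom (𝓞 K)) hX) _
  have h3 := dvd_sub_tr h2 (dvd_sub_comm.1 h9)
  rw [← h] at h3
  rcases sign_aux _ η _ _ K_sq1 (K_nu hnu) h3 with h4 | h4
  · exact ⟨η, h, h4⟩
  · exact ⟨-η, by rw [neg_sq]; exact h, h4⟩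

lemma K_res {kap e nu : List ℤ} {x X : ℤ} (hc : etaOK kap e nu x = true) (hX : 9 ∣ X - x) (η : 𝓞 K)
    (h : ev piO kap * η ^ 2 = ev piO (BL X)) :
    ∃ c : List ℤ, c.length = 5 ∧ ev piO kap * ev piO c ^ 2 = ev piO (BL X) ∧
      ∀ k, 9 ∣ c.getD k 0 - e.getD k 0 := by
  simp only [etaOK, Bool.and_eq_true, decide_eq_true_eq] at hc
  obtain ⟨⟨he, h9⟩, hnu⟩ := hc
  have h9' : (9 : 𝓞 K) ∣ ev piO kap * ev piO e ^ 2 - ev piO (BL x) := by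
    have h1 := ev_mulM piO piO_relK 9 e e
    have h2 := ev_mulM piO piO_relK 9 kap (mulM redK 4 9 e e)
    have h3 := ev_eqM piO h9
    have h4 := dvd_sub_tr (dvd_sub_comm.1 (dvd_sub_tr h2 ((h1.mul_left (ev piO kap)).trans (by rw [mul_sub])))) h3
    rw [sq]; exact_mod_cast h4
  have d39 : (3 : 𝓞 K) ∣ 9 := ⟨3, by norm_num⟩
  obtain ⟨η', g1, g2⟩ := K_sign (d39.trans h9') hnu (Dvd.dvd.trans (by norm_num) hX) η h
  have h2 : (9 : 𝓞 K) ∣ ev piO (BL X) - ev piO (BL x) := by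
    rw [BL_sub]
    exact Dvd.dvd.mul_right (by exact_mod_cast map_dvd (Int.castRingHom (𝓞 K)) hX) _
  have h3 := dvd_sub_tr h2 (dvd_sub_comm.1 h9')
  rw [← g1] at h3
  obtain ⟨d, hd⟩ := h3
  have h4 := hens2 (ev piO kap) η' (ev piO e) (ev piO nu) d 2 g2 (K_nu hnu) (by rw [hd]; norm_num)
  obtain ⟨c, c1, c2, c3⟩ := list_of η'
  refine ⟨c, c1, by rw [← c2]; exact g1, fun k => c3 9 e he ?_ k⟩
  obtain ⟨a, ha⟩ := h4
  refine ⟨3 * a + (2 * ev piO nu * d), ?_⟩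
  push_cast
  linear_combination ha

lemma length_addL (a b : List ℤ) : (addL a b).length = max a.length b.length := by
  induction a generalizing b with
  | nil => simp [addL]
  | cons x a ih =>
    cases b with
    | nil => simp [addL]
    | cons y b => simp [addL, ih]

lemma length_smulL (c : ℤ) (a : List ℤ) : (smulL c a).length = a.length := by simp [smulL]

lemma getD_addL (a b : List ℤ) (j : ℕ) : (addL a b).getD j 0 = a.getD j 0 + b.getD j 0 := by
  induction a generalizing b j with
  | nil => simp [addL]
  | cons x a ih =>
    cases b with
    | nil => simp [addL]
    | cons y b =>
      cases j with
      | zero => simp [addL]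
      | succ j => simpa [addL] using ih b j

lemma getD_smulL (c : ℤ) (a : List ℤ) (j : ℕ) : (smulL c a).getD j 0 = c * a.getD j 0 := by
  induction a generalizing j with
  | nil => simp [smulL]
  | cons x a ih =>
    cases j with
    | zero => simp [smulL]
    | succ j => simpa [smulL] using ih j

lemma K_res1 {kap e nu m : List ℤ} {x X : ℤ} (he : e.length ≤ 5) (hm : m.length ≤ 5)
    (h1 : ev piO kap * ev piO e ^ 2 = ev piO (BL x))
    (hnu : eqM 3 (mulM redK 4 3 (mulM redK 4 3 kap e) nu) [1] = true)
    (hmc : eqM 3 (mulM redK 4 3 nu [0, 0, 2]) m = true)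
    (k : ℕ) (hk : 1 ≤ k) (s : ℤ) (hX : X = x + 3 ^ k * s) (η : 𝓞 K)
    (h : ev piO kap * η ^ 2 = ev piO (BL X)) :
    ∃ c : List ℤ, c.length = 5 ∧ ev piO kap * ev piO c ^ 2 = ev piO (BL X) ∧
      ∀ j, 3 ^ (k + 1) ∣ c.getD j 0 - e.getD j 0 - 3 ^ k * s * m.getD j 0 := by
  obtain ⟨η', g1, g2⟩ := K_sign (x := x) (X := X) (by rw [h1, sub_self]; exact dvd_zero _) hnu
    (by rw [hX, add_sub_cancel_left]; exact (dvd_pow_self _ (by omega)).mul_right _) η h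
  have h4 := hens2 (ev piO kap) η' (ev piO e) (ev piO nu) (s * piO ^ 2) k g2 (K_nu hnu) (by
    rw [g1, h1, BL_sub, hX]; push_cast; ring)
  have h5 := ev_mulM piO piO_relK 3 nu [0, 0, 2]
  have h6 := dvd_sub_tr (dvd_sub_comm.1 h5) (ev_eqM piO hmc)
  have e2 : ev piO [0, 0, 2] = 2 * piO ^ 2 := by simp; ring
  rw [e2] at h6
  obtain ⟨a, ha⟩ := h4
  obtain ⟨b, hb⟩ := h6
  obtain ⟨c, c1, c2, c3⟩ := list_of η'
  refine ⟨c, c1, by rw [← c2]; exact g1, fun j => ?_⟩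
  have := c3 (3 ^ (k + 1)) (addL e (smulL (3 ^ k * s) m)) (by
    simp [length_addL, length_smulL]; omega) ⟨a + s * b, by
      rw [ev_addL, ev_smulL]
      push_cast at hb ⊢
      linear_combination ha + 3 ^ k * s * hb⟩ j
  have e3 : (addL e (smulL (3 ^ k * s) m)).getD j 0 = e.getD j 0 + 3 ^ k * s * m.getD j 0 := by
    rw [getD_addL, getD_smulL]
  rw [e3] at this
  rwa [sub_sub]

end
end Skl


namespace Skl
noncomputable section

lemma nonsq10 (d : 𝓞 L10) (dl : List ℤ) (hdl : 8 * d = ev tO dl) (p : ℕ) [Fact p.Prime]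
    (hp : ((1997152 : ℤ) : ZMod p) ≠ 0) (a : ZMod p) (ha : ev a g10L = 0)
    (hns : ∀ y : ZMod p, y * y ≠ 2 * ev a dl) : ∀ x : L10, x ^ 2 ≠ (d : L10) + 0 * x := by
  intro x hx
  rw [zero_mul, add_zero] at hx
  have hi : IsIntegral ℤ x := by
    apply IsIntegral.of_pow (n := 2) (by norm_num)
    rw [hx]; exact RingOfIntegers.isIntegral_coe d
  obtain ⟨y, hy⟩ := exists_O x hi
  obtain ⟨q, -, hq⟩ := N_poly y
  change 1997152 * algebraMap (𝓞 L10) L10 y = _ at hq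
  change x ^ 2 = algebraMap (𝓞 L10) L10 d at hx
  rw [hy] at hq
  have hdl' : 8 * algebraMap (𝓞 L10) L10 d = ev tL dl := by
    have := congrArg (algebraMap (𝓞 L10) L10) hdl
    rw [map_mul, ev_map, map_ofNat] at this
    exact this
  have hz : aeval tL (C 8 * q ^ 2 - C (1997152 ^ 2) * ev X dl) = 0 := by
    rw [map_sub, map_mul, map_mul, map_pow, ← hq, aeval_ev, ← hdl', aeval_C, aeval_C, ← hx]
    simp only [algebraMap_int_eq, Int.coe_castRingHom]
    push_cast
    ring
  have hd := minpoly.isIntegrallyClosed_dvd tL_int hz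
  rw [minpolyZ_tL] at hd
  obtain ⟨r, hr⟩ := hd
  have h2 := congrArg (aeval a) hr
  have hg : aeval a gZ = 0 := by rw [gZ, aeval_ev, ha]
  rw [map_mul, hg, zero_mul, map_sub, map_mul, map_mul, map_pow, aeval_ev, aeval_C, aeval_C] at h2
  simp only [algebraMap_int_eq, Int.coe_castRingHom] at h2
  push_cast at h2 hp
  refine hns (4 * aeval a q / 1997152) ?_
  field_simp
  linear_combination 2 * h2

section
variable {R : Type*} [CommRing R] (x : R)

lemma lin_congr (n : ℤ) (c e : List ℤ) (T : List (List ℤ)) (hc : c.length ≤ 5) (he : e.length ≤ 5)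
    (h : ∀ k, n ∣ c.getD k 0 - e.getD k 0) : (n : R) ∣ ev x (lin c T) - ev x (lin e T) := by
  rw [ev_lin x c T 5 hc, ev_lin x e T 5 he, ← Finset.sum_sub_distrib]
  apply Finset.dvd_sum
  intro k _
  have := map_dvd (Int.castRingHom R) (h k)
  rw [← sub_mul]
  refine Dvd.dvd.mul_right ?_ _
  simpa using this

lemma lin_lin (e m : List ℤ) (s : ℤ) (T : List (List ℤ)) (he : e.length ≤ 5) (hm : m.length ≤ 5) :
    ev x (lin (addL e (smulL s m)) T) = ev x (lin e T) + s * ev x (lin m T) := by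
  rw [ev_lin x e T 5 he, ev_lin x m T 5 hm, ev_lin x _ T 5 (by simp [length_addL, length_smulL]; omega),
    Finset.mul_sum, ← Finset.sum_add_distrib]
  apply Finset.sum_congr rfl
  intro k _
  rw [getD_addL, getD_smulL]; push_cast; ring

lemma dvd9_of16 (r : R) (u : R) (p q P Q : List ℤ) (h : 16 * u = evP x r (p, q))
    (hp : (9 : R) ∣ ev x p - ev x P) (hq : (9 : R) ∣ ev x q - ev x Q) :
    (9 : R) ∣ u - evP x r (modL 9 (smulL 4 P), modL 9 (smulL 4 Q)) := by
  have h1 := ev_modL x 9 (smulL 4 P)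
  have h2 := ev_modL x 9 (smulL 4 Q)
  rw [ev_smulL] at h1 h2
  push_cast at h1 h2
  obtain ⟨a1, b1⟩ := h1
  obtain ⟨a2, b2⟩ := h2
  obtain ⟨a3, b3⟩ := hp
  obtain ⟨a4, b4⟩ := hq
  simp only [evP] at h ⊢
  refine ⟨4 * a3 + 4 * r * a4 - a1 - r * a2 - 7 * u, ?_⟩
  linear_combination 4 * b3 + 4 * r * b4 - b1 - r * b2 + 4 * h

lemma cop16 (k : ℕ) (y : R) (h : (3 : R) ^ k ∣ 16 * y) : (3 : R) ^ k ∣ y := by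
  have h1 : IsCoprime ((3 : ℤ) ^ k) 16 := IsCoprime.pow_left (by norm_num)
  obtain ⟨a, b, hab⟩ := h1
  have h2 := congrArg (Int.castRingHom R) hab
  simp at h2
  obtain ⟨z, hz⟩ := h
  exact ⟨a * y + b * z, by linear_combination (-y) * h2 + b * hz⟩

lemma fin_aux (u F z : R) (s : ℤ) (k : ℕ) (h : 16 * u = -16 + 3 ^ k * s * F + 3 ^ (k + 1) * z) :
    (3 : R) ^ (k + 1) ∣ (-u) - (1 + 3 ^ k * ((-s : ℤ) * F)) := by
  apply cop16
  refine ⟨5 * s * F - z, ?_⟩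
  push_cast
  linear_combination - h

end

def resOK (kap : List ℤ) (T R : List (List ℤ)) (d9 d40 : List ℤ) (W : List (List ℤ))
    (x : ℤ) (e nu w lam : List ℤ) : Bool :=
  etaOK kap e nu x && decide (w.length ≤ 20) && killOK 20 13 W lam w &&
  logOK20 d9 d40 (modL 9 (smulL 4 (lin e T)), modL 9 (smulL 4 (lin e R))) (w.take 10, w.drop 10)

def finOK (kap : List ℤ) (T R : List (List ℤ)) (W : List (List ℤ)) (e nu m y lam : List ℤ) : Bool :=
  decide (e.length ≤ 5) && decide (m.length ≤ 5) && decide (y.length ≤ 20) &&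
  eqM 3 (mulM redK 4 3 (mulM redK 4 3 kap e) nu) [1] &&
  eqM 3 (mulM redK 4 3 nu [0, 0, 2]) m && eqM 0 (lin e T) [-16] && eqM 0 (lin e R) [] &&
  eqM 3 (lin m T) (y.take 10) && eqM 3 (lin m R) (y.drop 10) && killOK 20 13 W lam y

section
variable (d : 𝓞 L10) [hd : Fact (∀ x : L10, x ^ 2 ≠ (d : L10) + 0 * x)]

lemma rO_d9 {dl d9 : List ℤ} (hdl : 8 * d = ev tO dl) (h : eqM 9 (smulL 8 dl) d9 = true) :
    (9 : 𝓞 (LL d)) ∣ rO d ^ 2 - ev (tO' d) d9 := by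
  have h1 := ev_eqM (tO' d) h
  have h2 := congrArg (alO d) hdl
  rw [map_mul, map_ofNat, ev_map] at h2
  change _ = ev (tO' d) dl at h2
  rw [ev_smulL, ← h2] at h1
  rw [rO_sq]
  obtain ⟨a, ha⟩ := h1
  refine ⟨a - 7 * alO d d, ?_⟩
  push_cast at ha
  linear_combination ha

lemma res_kill {kap eta1 : List ℤ} {T R : List (List ℤ)} {dl d9 d40 : List ℤ} (hdl : 8 * d = ev tO dl)
    (hchk : chkABC kap eta1 T R dl = true) (hd9 : eqM 9 (smulL 8 dl) d9 = true)
    (hd40 : eqM 3 (powM red10 9 3 d9 bits40) d40 = true)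
    {W : List (List ℤ)} (hs : Sat (b20 d) 20) (S : SkData (LL d) 13)
    (hS : ∀ i, S.w i = FF (b20 d) 20 (W.getD i []))
    (x : ℤ) (e nu w lam : List ℤ) (hr : resOK kap T R d9 d40 W x e nu w lam = true)
    (X X1 : ℤ) (h1 : ev piO kap * ev piO eta1 ^ 2 = ev piO (BL X1))
    (hX : 9 ∣ X - x) (η : 𝓞 K) (h : ev piO kap * η ^ 2 = ev piO (BL X)) : False := by
  simp only [resOK, Bool.and_eq_true, decide_eq_true_eq] at hr
  obtain ⟨⟨⟨r1, r2⟩, r3⟩, r4⟩ := hr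
  have he : e.length ≤ 5 := by
    simp only [etaOK, Bool.and_eq_true, decide_eq_true_eq] at r1
    exact r1.1.1
  obtain ⟨c, c1, c2, c3⟩ := K_res r1 hX η h
  obtain ⟨u, hu⟩ := unit_ABC d hdl hchk X X1 c c1.le c2 h1
  have l1 := lin_congr (tO' d) 9 c e T c1.le he c3
  have l2 := lin_congr (tO' d) 9 c e R c1.le he c3
  push_cast at l1 l2
  have h9 := dvd9_of16 (tO' d) (rO d) _ _ _ _ _ hu l1 l2
  have hl := log20 (tO' d) (rO d) (relO' d) d9 d40 (rO_d9 d hdl hd9) hd40 u _ _ h9 r4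
  rw [← FF20 d w r2] at hl
  refine kill hs S hS lam w r3 0 (u ^ 242) (FF (b20 d) 20 w) 1 (by norm_num) (by simp) ?_
  rw [Units.val_pow_eq_pow_val]
  have e1 : (3 : 𝓞 (LL d)) ^ (0 + 2) = 9 := by norm_num
  rw [e1, zero_add, pow_one]
  exact hl

lemma fin_kill {kap eta1 : List ℤ} {T R : List (List ℤ)} {dl : List ℤ} (hdl : 8 * d = ev tO dl)
    (hchk : chkABC kap eta1 T R dl = true)
    {W : List (List ℤ)} (hs : Sat (b20 d) 20) (S : SkData (LL d) 13)
    (hS : ∀ i, S.w i = FF (b20 d) 20 (W.getD i []))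
    (nu m y lam : List ℤ) (hr : finOK kap T R W eta1 nu m y lam = true)
    (X X1 : ℤ) (h1 : ev piO kap * ev piO eta1 ^ 2 = ev piO (BL X1))
    (hX : 3 ∣ X - X1) (hne : X ≠ X1) (η : 𝓞 K) (h : ev piO kap * η ^ 2 = ev piO (BL X)) : False := by
  simp only [finOK, Bool.and_eq_true, decide_eq_true_eq] at hr
  obtain ⟨⟨⟨⟨⟨⟨⟨⟨⟨q1, q2⟩, q3⟩, q4⟩, q5⟩, q6⟩, q7⟩, q8⟩, q9⟩, q10⟩ := hr
  have hfin : FiniteMultiplicity (3 : ℤ) (X - X1) :=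
    Int.finiteMultiplicity_iff.2 ⟨by norm_num, sub_ne_zero.2 hne⟩
  obtain ⟨s, hs1, hs2⟩ := hfin.exists_eq_pow_mul_and_not_dvd
  set k := multiplicity (3 : ℤ) (X - X1)
  have hk : 1 ≤ k := by
    by_contra hk
    have : k = 0 := by omega
    rw [this, pow_zero, one_mul] at hs1
    exact hs2 (hs1 ▸ hX)
  obtain ⟨k', hk'⟩ : ∃ k', k = k' + 1 := ⟨k - 1, by omega⟩
  obtain ⟨c, c1, c2, c3⟩ := K_res1 q1 q2 h1 q4 q5 k hk s (by linear_combination hs1) η h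
  obtain ⟨u, hu⟩ := unit_ABC d hdl hchk X X1 c c1.le c2 h1
  have hl : (addL eta1 (smulL (3 ^ k * s) m)).length ≤ 5 := by
    simp [length_addL, length_smulL]; omega
  have hcc : ∀ j, 3 ^ (k + 1) ∣ c.getD j 0 - (addL eta1 (smulL (3 ^ k * s) m)).getD j 0 := by
    intro j
    rw [getD_addL, getD_smulL, ← sub_sub]; exact c3 j
  obtain ⟨a1, b1⟩ := lin_congr (tO' d) _ c _ T c1.le hl hcc
  obtain ⟨a2, b2⟩ := lin_congr (tO' d) _ c _ R c1.le hl hcc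
  rw [lin_lin (tO' d) _ _ _ _ q1 q2, ev_eq0 _ q6] at b1
  rw [lin_lin (tO' d) _ _ _ _ q1 q2, ev_eq0 _ q7] at b2
  obtain ⟨a3, b3⟩ := ev_eqM (tO' d) q8
  obtain ⟨a4, b4⟩ := ev_eqM (tO' d) q9
  have hF := FF20 d y q3
  set F := FF (b20 d) 20 y with hFd
  simp only [evP] at hF hu
  simp only [ev_cons, ev_nil] at b1 b2
  push_cast at b1 b2 b3 b4
  have hfin := fin_aux (u : 𝓞 (LL d)) F (a1 + rO d * a2 + s * (a3 + rO d * a4)) s k (by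
    rw [hu, hF]
    linear_combination b1 + rO d * b2 + 3 ^ k * s * b3 + 3 ^ k * s * rO d * b4)
  refine kill hs S hS lam y q10 k' (-u) ((-s : ℤ) * F) (-s) (by rwa [dvd_neg]) (by simp [hFd]) ?_
  rw [hk'] at hfin
  rw [Units.val_neg]
  exact hfin

end
end
end Skl


namespace Skl
noncomputable section

def u10OK (A B w : List ℤ) : Bool :=
  checkInt A && checkInt B && eqM 0 (mulM red10 9 0 A B) [64] && decide (w.length ≤ 10) &&
  logOK10 (modL 9 (smulL 8 A)) w

lemma dvd9_of8 {R : Type*} [CommRing R] (x u : R) (p P : List ℤ) (h : 8 * u = ev x p)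
    (hp : (9 : R) ∣ ev x p - ev x P) : (9 : R) ∣ u - ev x (modL 9 (smulL 8 P)) := by
  have h1 := ev_modL x 9 (smulL 8 P)
  rw [ev_smulL] at h1
  push_cast at h1
  obtain ⟨a1, b1⟩ := h1
  obtain ⟨a3, b3⟩ := hp
  refine ⟨8 * a3 - a1 - 7 * u, ?_⟩
  linear_combination 8 * b3 - b1 + 8 * h

lemma u10 (A B w : List ℤ) (h : u10OK A B w = true) : ∃ u : (𝓞 L10)ˣ,
    (9 : 𝓞 L10) ∣ (u : 𝓞 L10) ^ 242 - (1 + 3 * FF b10 10 w) := by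
  simp only [u10OK, Bool.and_eq_true, decide_eq_true_eq] at h
  obtain ⟨⟨⟨⟨q1, q2⟩, q3⟩, q4⟩, q5⟩ := h
  obtain ⟨u, hu⟩ := mkUnit10 A B q1 q2 q3
  refine ⟨u, ?_⟩
  rw [FF10 w q4]
  exact log10 tO relO u _ w (dvd9_of8 tO _ A A hu (by simp)) q5

def epsOK (dl d9 d40 A B w : List ℤ) : Bool :=
  checkInt A && eqM 0 (subL (smulL 8 (mulM red10 9 0 A A)) (mulM red10 9 0 dl (mulM red10 9 0 B B))) [2048] &&
  decide (w.length ≤ 20) &&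
  logOK20 d9 d40 (modL 9 (smulL 4 A), modL 9 (smulL 4 B)) (w.take 10, w.drop 10)

section
variable (d : 𝓞 L10) [hd : Fact (∀ x : L10, x ^ 2 ≠ (d : L10) + 0 * x)]

lemma eps20 {dl d9 d40 : List ℤ} (hdl : 8 * d = ev tO dl) (hd9 : eqM 9 (smulL 8 dl) d9 = true)
    (hd40 : eqM 3 (powM red10 9 3 d9 bits40) d40 = true) (A B w : List ℤ)
    (h : epsOK dl d9 d40 A B w = true) : ∃ u : (𝓞 (LL d))ˣ,
    (9 : 𝓞 (LL d)) ∣ (u : 𝓞 (LL d)) ^ 242 - (1 + 3 * FF (b20 d) 20 w) := by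
  simp only [epsOK, Bool.and_eq_true, decide_eq_true_eq] at h
  obtain ⟨⟨⟨q1, q2⟩, q3⟩, q4⟩ := h
  obtain ⟨y, hy⟩ := exists_int q1
  have h2 := ev_eq0 tO q2
  rw [ev_subL, ev_smulL, ev_mulM0 tO relO, ev_mulM0 tO relO, ev_mulM0 tO relO, ← hdl] at h2
  have e1 : ev tO [2048] = 8 * 256 := by simp; norm_num
  rw [e1] at h2
  push_cast at h2
  obtain ⟨u, hu⟩ := mkUnit20 d (ev tO A) (ev tO B) y hy (by
    have h8 : (8 : 𝓞 L10) ≠ 0 := by norm_num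
    apply mul_left_cancel₀ h8
    linear_combination h2)
  rw [ev_map, ev_map] at hu
  change 16 * (u : 𝓞 (LL d)) = evP (tO' d) (rO d) (A, B) at hu
  refine ⟨u, ?_⟩
  rw [FF20 d w q3]
  exact log20 (tO' d) (rO d) (relO' d) d9 d40 (rO_d9 d hdl hd9) hd40 u _ _
    (dvd9_of16 _ _ _ _ _ A B hu (by simp) (by simp)) q4

lemma u10_20 (A B w : List ℤ) (h : u10OK A B w = true) : ∃ u : (𝓞 (LL d))ˣ,
    (9 : 𝓞 (LL d)) ∣ (u : 𝓞 (LL d)) ^ 242 - (1 + 3 * FF (b20 d) 20 w) := by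
  obtain ⟨u, hu⟩ := u10 A B w h
  simp only [u10OK, Bool.and_eq_true, decide_eq_true_eq] at h
  refine ⟨Units.map (alO d).toMonoidHom u, ?_⟩
  have := map_dvd (alO d) hu
  rw [FF10 w h.1.2, map_sub, map_add, map_mul, map_pow, map_one, map_ofNat, map_ofNat, ev_map] at this
  rw [FF20 d w (by omega), List.take_of_length_le h.1.2, List.drop_eq_nil_of_le h.1.2]
  simp only [evP, ev_nil, mul_zero, add_zero]
  exact this

def posOK (dl : List ℤ) : Bool := decide (0 ≤ (evI (5294/10000) (5295/10000) dl).1)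

lemma pos_real {dl : List ℤ} (hdl : 8 * d = ev tO dl) (h : posOK dl = true) :
    ∃ φ : L10 →+* ℝ, 0 ≤ φ (d : L10) := by
  obtain ⟨φ, h1, h2⟩ := exists_real_hom
  refine ⟨φ, ?_⟩
  have h3 := (ev_evI (5294/10000) (5295/10000) (φ tL) (by norm_num) h1 h2 dl).1
  simp only [posOK, decide_eq_true_eq] at h
  have h4 : (0 : ℝ) ≤ ev (φ tL) dl := le_trans (by exact_mod_cast h) h3
  have h5 := congrArg (fun z => φ (algebraMap (𝓞 L10) L10 z)) hdl
  simp only [map_mul, ev_map, map_ofNat] at h5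
  change 8 * φ (d : L10) = ev (φ tL) dl at h5
  linarith

structure ED where
  A : List ℤ
  B : List ℤ
  w : List ℤ

def setOK (dl d9 d40 di : List ℤ) (E U : List ED) (Lam : List (List ℤ)) : Bool :=
  decide (E.length = 7) && decide (U.length = 6) && posOK dl && eqM 3 (mulM red10 9 3 dl di) [1] &&
  eqM 9 (smulL 8 dl) d9 && eqM 3 (powM red10 9 3 d9 bits40) d40 &&
  (E.all fun e => epsOK dl d9 d40 e.A e.B e.w) && dualOK 20 13 Lam ((E ++ U).map ED.w)

lemma exists_S {dl d9 d40 di : List ℤ} {E U : List ED} {Lam : List (List ℤ)} (hdl : 8 * d = ev tO dl)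
    (hU : (U.all fun e => u10OK e.A e.B e.w) = true)
    (h : setOK dl d9 d40 di E U Lam = true) :
    Sat (b20 d) 20 ∧ ∃ S : SkData (LL d) 13, ∀ i, S.w i = FF (b20 d) 20 (((E ++ U).map ED.w).getD i []) := by
  simp only [setOK, Bool.and_eq_true, decide_eq_true_eq] at h
  obtain ⟨⟨⟨⟨⟨⟨⟨q1, q2⟩, q3⟩, q4⟩, q5⟩, q6⟩, q7⟩, q8⟩ := h
  have hs := sat_b20 d dl di hdl q4
  refine ⟨hs, ?_⟩
  obtain ⟨φ, hφ⟩ := pos_real d hdl q3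
  refine mkSk hs _ Lam (rank_L20 (d : L10)) (tors_L20 (d : L10) φ hφ) ?_ q8
  intro i hi
  have hl : i < ((E ++ U).map ED.w).length := by simp [q1, q2, hi]
  rw [List.getD_eq_getElem _ _ hl]
  have hm := List.getElem_mem hl
  rw [List.mem_map] at hm
  obtain ⟨e, he, hw⟩ := hm
  rw [← hw]
  rw [List.all_eq_true] at q7 hU
  rcases List.mem_append.1 he with h1 | h1
  · exact eps20 d hdl q5 q6 _ _ _ (q7 e h1)
  · exact u10_20 d _ _ _ (hU e h1)

end

def res0OK (T : List (List ℤ)) (W : List (List ℤ)) (x : ℤ) (e nu w lam : List ℤ) : Bool :=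
  etaOK [1] e nu x && decide (w.length ≤ 10) && killOK 10 6 W lam w &&
  logOK10 (modL 9 (smulL 8 (lin e T))) w

lemma exists_S0 {U : List ED} {Lam : List (List ℤ)} (hl : U.length = 6)
    (hU : (U.all fun e => u10OK e.A e.B e.w) = true) (h : dualOK 10 6 Lam (U.map ED.w) = true) :
    ∃ S : SkData L10 6, ∀ i, S.w i = FF b10 10 ((U.map ED.w).getD i []) := by
  refine mkSk sat_b10 _ Lam rank_L10 tors_L10 ?_ h
  intro i hi
  have hl : i < (U.map ED.w).length := by simp [hl, hi]
  rw [List.getD_eq_getElem _ _ hl]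
  have hm := List.getElem_mem hl
  rw [List.mem_map] at hm
  obtain ⟨e, he, hw⟩ := hm
  rw [← hw]
  rw [List.all_eq_true] at hU
  exact u10 _ _ _ (hU e he)

lemma res_kill0 {T R : List (List ℤ)} (hchk : chk0 T R = true) {W : List (List ℤ)} (S : SkData L10 6)
    (hS : ∀ i, S.w i = FF b10 10 (W.getD i []))
    (x : ℤ) (e nu w lam : List ℤ) (hr : res0OK T W x e nu w lam = true)
    (X : ℤ) (hX : 9 ∣ X - x) (η : 𝓞 K) (h : ev piO [1] * η ^ 2 = ev piO (BL X)) : False := by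
  simp only [res0OK, Bool.and_eq_true, decide_eq_true_eq] at hr
  obtain ⟨⟨⟨r1, r2⟩, r3⟩, r4⟩ := hr
  have he : e.length ≤ 5 := by
    simp only [etaOK, Bool.and_eq_true, decide_eq_true_eq] at r1
    exact r1.1.1
  obtain ⟨c, c1, c2, c3⟩ := K_res r1 hX η h
  have c2' : ev piO c ^ 2 = ev piO (BL X) := by
    rw [← c2]; simp
  obtain ⟨u, hu⟩ := unit_0 hchk X c c1.le c2'
  have l1 := lin_congr tO 9 c e T c1.le he c3
  push_cast at l1
  have h9 := dvd9_of8 tO _ _ _ hu l1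
  have hl := log10 tO relO u _ _ h9 r4
  rw [← FF10 w r2] at hl
  refine kill sat_b10 S hS lam w r3 0 (u ^ 242) (FF b10 10 w) 1 (by norm_num) (by simp) ?_
  rw [Units.val_pow_eq_pow_val]
  have e1 : (3 : 𝓞 L10) ^ (0 + 2) = 9 := by norm_num
  rw [e1, zero_add, pow_one]
  exact hl

end
end Skl


namespace Skl
noncomputable section

structure RD where
  x : ℤ
  e : List ℤ
  nu : List ℤ
  w : List ℤ
  lam : List ℤ

structure FD where
  X1 : ℤ
  eta1 : List ℤ
  T : List (List ℤ)
  R : List (List ℤ)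
  nu : List ℤ
  m : List ℤ
  y : List ℤ
  lam : List ℤ

def fdOK (kap dl : List ℤ) (W : List (List ℤ)) (F : FD) : Bool :=
  chkABC kap F.eta1 F.T F.R dl && finOK kap F.T F.R W F.eta1 F.nu F.m F.y F.lam &&
  eqM 0 (mulM redK 4 0 kap (mulM redK 4 0 F.eta1 F.eta1)) (BL F.X1)

def modOK (Rs : List RD) (Fs : List FD) : Bool :=
  (List.range 9).all fun x => Rs.any (fun r => (x - r.x) % 9 == 0) || Fs.any (fun F => (x - F.X1) % 3 == 0)

lemma class_gen {kap dl d9 d40 di : List ℤ} {E U : List ED} {Lam : List (List ℤ)}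
    (hi : checkInt dl = true) (p : ℕ) [Fact p.Prime]
    (hp : ((1997152 : ℤ) : ZMod p) ≠ 0) (a : ZMod p) (ha : ev a g10L = 0)
    (hns : ∀ y : ZMod p, y * y ≠ 2 * ev a dl)
    (hU : (U.all fun e => u10OK e.A e.B e.w) = true)
    (hset : setOK dl d9 d40 di E U Lam = true)
    (F0 : FD) (Fs : List FD) (Rs : List RD)
    (hF : ((F0 :: Fs).all fun F => fdOK kap dl ((E ++ U).map ED.w) F) = true)
    (hR : (Rs.all fun r => resOK kap F0.T F0.R d9 d40 ((E ++ U).map ED.w) r.x r.e r.nu r.w r.lam) = true)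
    (hm : modOK Rs (F0 :: Fs) = true)
    (X : ℤ) (η : 𝓞 K) (h : ev piO kap * η ^ 2 = ev piO (BL X)) : ∃ F ∈ F0 :: Fs, X = F.X1 := by
  obtain ⟨d, hdl⟩ := exists_int hi
  have : Fact (∀ x : L10, x ^ 2 ≠ (d : L10) + 0 * x) := ⟨nonsq10 d dl hdl p hp a ha hns⟩
  obtain ⟨hs, S, hS⟩ := exists_S d hdl hU hset
  simp only [setOK, Bool.and_eq_true, decide_eq_true_eq] at hset
  obtain ⟨⟨⟨⟨⟨⟨⟨-, -⟩, -⟩, -⟩, q5⟩, q6⟩, -⟩, -⟩ := hset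
  have hF' : ∀ F ∈ F0 :: Fs, chkABC kap F.eta1 F.T F.R dl = true ∧
      finOK kap F.T F.R ((E ++ U).map ED.w) F.eta1 F.nu F.m F.y F.lam = true ∧
      ev piO kap * ev piO F.eta1 ^ 2 = ev piO (BL F.X1) := by
    intro F hm
    have := (List.all_eq_true.1 hF) F hm
    simp only [fdOK, Bool.and_eq_true] at this
    refine ⟨this.1.1, this.1.2, ?_⟩
    have h0 := ev_eq0 piO this.2
    rw [ev_mulM0 piO piO_relK, ev_mulM0 piO piO_relK] at h0
    rw [← h0]; ring
  obtain ⟨x, hx9, hxX⟩ : ∃ x : ℕ, x < 9 ∧ (9 : ℤ) ∣ X - x :=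
    ⟨(X % 9).toNat, by omega, by omega⟩
  have hmx := (List.all_eq_true.1 hm) x (by simpa using hx9)
  rw [Bool.or_eq_true, List.any_eq_true, List.any_eq_true] at hmx
  rcases hmx with ⟨r, hr, hrx⟩ | ⟨F, hFm, hFx⟩
  · exfalso
    simp only [beq_iff_eq] at hrx
    obtain ⟨c1, -, c3⟩ := hF' F0 (by simp)
    exact res_kill d hdl c1 q5 q6 hs S hS r.x r.e r.nu r.w r.lam ((List.all_eq_true.1 hR) r hr) X F0.X1 c3
      (by omega) η h
  · refine ⟨F, hFm, ?_⟩
    simp only [beq_iff_eq] at hFx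
    obtain ⟨c1, c2, c3⟩ := hF' F hFm
    by_contra hne
    exact fin_kill d hdl c1 hs S hS F.nu F.m F.y F.lam c2 X F.X1 c3 (by omega) hne η h

instance fact7 : Fact (Nat.Prime 7) := ⟨by norm_num⟩

instance fact11 : Fact (Nat.Prime 11) := ⟨by norm_num⟩

def UD : List ED :=
  [⟨[-8, 64, -34, 272, -16, 60, 0, -17, 0, -4], [-8, 4, 30, -16, 16, -8, 2, -1, 0, 0], [1, 2, 2, 1, 0, 1, 1, 2, 1, 1]⟩,
   ⟨[0, 0, -2, 16, 0, 0, 0, -1, 0, 0], [0, 64, -2, 16, 0, -4, 0, -1, 0, 0], [1, 0, 0, 1, 2, 2, 1, 1, 2, 0]⟩,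
   ⟨[-24, 0, 24, -192, 14, -48, 0, 12, 0, 3], [8, -20, 40, -64, 2, -16, -2, 4, 0, 1], [2, 2, 0, 0, 0, 0, 2, 1, 2, 1]⟩,
   ⟨[-8, -4, -34, -16, -16, -8, -2, -1, 0, 0], [-8, 64, 30, -240, 16, -68, 0, 15, 0, 4], [2, 0, 2, 1, 0, 1, 0, 2, 2, 0]⟩,
   ⟨[-3856, -7280, -13754, -33676, -1956, -7548, 1156, 2183, 270, 510], [-24, 32, 54, -58, 18, -20, -4, 3, -1, 1], [1, 0, 0, 1, 1, 0, 0, 1, 1, 1]⟩,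
   ⟨[8, -112, -156, 228, -48, 72, 8, -14, 2, -4], [-105672, 227776, -490972, 846940, -134840, 184976, 23968, -51662, 5686, -12256], [2, 0, 2, 2, 2, 2, 1, 1, 1, 2]⟩]

lemma UD_ok : (UD.all fun e => u10OK e.A e.B e.w) = true := by decide +kernel

def kapA : List ℤ := [5, 0, -1, 0, 0]
def dlA : List ℤ := [40, 0, 40, -320, 18, -80, 0, 20, 0, 5]
def diA : List ℤ := [2, 0, 0, 1, 1, 1, 1, 2, 0, 2]
def d9A : List ℤ := [5, 0, 5, 5, 0, 8, 0, 7, 0, 4]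
def d40A : List ℤ := [0, 1, 0, 0, 1, 0, 1, 0, 0, 2]
def EA : List ED :=
  [⟨[36, -64, 0, -136, 4, -30, 0, 8, 0, 2], [4, 12, -36, 136, -20, 26, -2, -10, 0, -2], [0, 0, 0, 0, 0, 0, 0, 0, 0, 0, 0, 2, 0, 1, 1, 2, 2, 2, 2, 1]⟩,
   ⟨[24, -16, 128, 268, 24, 68, -8, -16, -2, -4], [48, 88, 144, 300, 40, 72, -4, -16, -2, -4], [0, 0, 0, 0, 0, 0, 0, 0, 0, 0, 2, 1, 0, 1, 0, 0, 2, 0, 2, 1]⟩,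
   ⟨[60, 64, -304, 400, -92, 94, 16, -24, 4, -6], [-44, -44, 20, -408, 28, -94, 2, 26, 0, 6], [0, 0, 0, 0, 0, 0, 0, 0, 0, 0, 2, 2, 1, 0, 0, 0, 1, 2, 2, 2]⟩,
   ⟨[772, -1680, 3736, -6240, 1028, -1358, -184, 380, -44, 90], [228, -540, 1116, -2064, 300, -454, -54, 126, -12, 30], [0, 0, 0, 0, 0, 0, 0, 0, 0, 0, 2, 1, 1, 0, 2, 0, 1, 0, 2, 0]⟩,
   ⟨[-488, 944, -2404, 3848, -648, 852, 120, -234, 28, -56], [200, -256, 848, -692, 188, -148, -48, 40, -10, 10], [0, 0, 0, 0, 0, 0, 0, 0, 0, 0, 1, 0, 0, 0, 1, 2, 1, 0, 2, 2]⟩,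
   ⟨[-800, -4584, -2100, -19700, 148, -4376, 300, 1254, 70, 294], [-3312, -5312, -12072, -25000, -1856, -5616, 976, 1628, 228, 380], [0, 0, 0, 0, 0, 0, 0, 0, 0, 0, 1, 2, 2, 2, 0, 0, 0, 0, 2, 2]⟩,
   ⟨[84, 224, 488, 908, 648, -94, 248, -204, 26, -32], [260, 428, 856, 2068, -300, 682, -282, -28, -42, -18], [0, 0, 0, 0, 0, 0, 0, 0, 0, 0, 1, 0, 0, 1, 2, 2, 2, 0, 1, 1]⟩]
def LamA : List (List ℤ) :=
   [[0, 0, 0, 0, 0, 0, 0, 0, 0, 0, 2, 1, 0, 1, 2, 1, 0, 0, 0, 0],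
    [0, 0, 0, 0, 0, 0, 0, 0, 0, 0, 0, 2, 2, 2, 1, 1, 0, 0, 0, 0],
    [0, 0, 0, 0, 0, 0, 0, 0, 0, 0, 2, 0, 0, 2, 1, 0, 0, 0, 0, 0],
    [0, 0, 0, 0, 0, 0, 0, 0, 0, 0, 1, 2, 1, 1, 0, 0, 2, 0, 0, 0],
    [0, 0, 0, 0, 0, 0, 0, 0, 0, 0, 0, 0, 2, 1, 0, 0, 1, 0, 0, 0],
    [0, 0, 0, 0, 0, 0, 0, 0, 0, 0, 0, 2, 0, 0, 1, 0, 2, 0, 0, 0],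
    [0, 0, 0, 0, 0, 0, 0, 0, 0, 0, 1, 2, 1, 1, 1, 1, 2, 0, 0, 0],
    [0, 1, 2, 2, 1, 0, 2, 0, 0, 0, 0, 0, 0, 0, 0, 0, 0, 0, 0, 0],
    [1, 2, 0, 1, 1, 0, 0, 0, 0, 0, 0, 0, 0, 0, 0, 0, 0, 0, 0, 0],
    [0, 1, 1, 1, 2, 0, 1, 0, 0, 0, 0, 0, 0, 0, 0, 0, 0, 0, 0, 0],
    [1, 1, 1, 0, 2, 0, 1, 0, 0, 0, 0, 0, 0, 0, 0, 0, 0, 0, 0, 0],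
    [0, 0, 2, 2, 2, 0, 0, 0, 0, 0, 0, 0, 0, 0, 0, 0, 0, 0, 0, 0],
    [2, 1, 2, 1, 0, 0, 0, 0, 0, 0, 0, 0, 0, 0, 0, 0, 0, 0, 0, 0]]
def FA2 : FD :=
  ⟨2, [-1, 7, 3, -2, -1],
   [[24, -112, 768, -3084, 288, -764, -24, 192, -6, 48],
    [0, -16, 192, -516, 64, -128, -8, 32, -2, 8],
    [40, -64, 0, 0, 0, 4, 0, 0, 0, 0],
    [-8, 32, 320, -520, 96, -132, -16, 32, -4, 8],
    [128, -256, -64, 512, -32, 144, 0, -32, 0, -8]],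
   [[-192, -392, -864, -580, -176, -96, 60, 40, 14, 8],
    [-24, -48, -128, 4, -32, 4, 8, 0, 2, 0],
    [-8, 32, -16, 0, 0, -4, 0, 0, 0, 0],
    [0, 0, -40, 304, -24, 64, 0, -20, 0, -4],
    [0, 152, 0, 0, 0, -16, -4, 0, 0, 0]],
   [1, 0, 2, 2, 0], [2, 2, 2, 2, 1], [0, 0, 0, 0, 0, 0, 0, 0, 0, 0, 2, 2, 1, 2, 1, 1, 0, 1, 2, 2], [0, 0, 0, 0, 0, 0, 0, 0, 0, 0, 2, 1, 2, 0, 2, 2, 0, 0, 2, 0]⟩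
def FA30 : FD :=
  ⟨30, [-3, 25, 11, -8, -3],
   [[-40, 368, -2944, 12332, -1120, 3060, 88, -768, 22, -192],
    [80, -112, -320, 1540, -128, 392, 8, -96, 2, -24],
    [24, 0, 640, -1040, 192, -260, -32, 64, -8, 16],
    [264, -608, 192, 504, 32, 164, -16, -32, -4, -8],
    [96, 320, 2112, -4656, 672, -1184, -96, 288, -24, 72]],
   [[-704, -88, -2656, -5532, -400, -1376, 212, 360, 50, 88],
    [-88, -16, -256, -1012, -32, -252, 24, 64, 6, 16],
    [8, -160, -32, -128, 0, 4, 0, 8, 0, 0],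
    [0, 0, 152, -1264, 56, -320, 0, 76, 0, 20],
    [0, -632, 0, 0, -16, 144, -12, 0, 0, -8]],
   [2, 0, 0, 1, 1], [1, 2, 2, 1, 1], [0, 0, 0, 0, 0, 0, 0, 0, 0, 0, 0, 2, 1, 2, 2, 1, 2, 1, 2, 0], [0, 0, 0, 0, 0, 0, 0, 0, 0, 0, 1, 1, 0, 0, 0, 1, 0, 1, 0, 0]⟩
def RA : List RD :=
  [⟨1, [0, 6, 4, 2, 7], [1, 0, 2, 1, 1], [0, 0, 0, 0, 0, 0, 0, 0, 0, 0, 1, 0, 0, 0, 0, 1, 1, 2, 0, 0], [0, 0, 0, 0, 0, 0, 0, 0, 0, 0, 1, 1, 0, 0, 0, 1, 0, 1, 0, 0]⟩,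
   ⟨4, [3, 3, 4, 5, 4], [1, 0, 2, 1, 1], [0, 0, 0, 0, 0, 0, 0, 0, 0, 0, 2, 2, 1, 0, 0, 1, 0, 0, 0, 1], [0, 0, 0, 0, 0, 0, 0, 0, 0, 0, 2, 2, 0, 0, 0, 2, 0, 2, 0, 0]⟩,
   ⟨7, [6, 0, 4, 8, 1], [1, 0, 2, 1, 1], [0, 0, 0, 0, 0, 0, 0, 0, 0, 0, 0, 1, 2, 0, 0, 1, 2, 1, 0, 2], [0, 0, 0, 0, 0, 0, 0, 0, 0, 0, 2, 1, 2, 0, 2, 2, 0, 0, 2, 0]⟩]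

lemma setA_ok : setOK dlA d9A d40A diA EA UD LamA = true := by decide +kernel
lemma FA_ok : ((FA2 :: [FA30]).all fun F => fdOK kapA dlA ((EA ++ UD).map ED.w) F) = true := by
  decide +kernel
lemma RA_ok : (RA.all fun r =>
    resOK kapA FA2.T FA2.R d9A d40A ((EA ++ UD).map ED.w) r.x r.e r.nu r.w r.lam) = true := by
  decide +kernel

lemma classA (X : ℤ) (η : 𝓞 K) (h : ev piO kapA * η ^ 2 = ev piO (BL X)) : X = 2 ∨ X = 30 := by
  have := class_gen (kap := kapA) (dl := dlA) (by decide +kernel) 7 (by decide +kernel) 2 (by decide +kernel)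
    (by decide +kernel) UD_ok setA_ok FA2 [FA30] RA FA_ok RA_ok (by decide +kernel) X η h
  simpa [FA2, FA30] using this

def kapB : List ℤ := [85, -2, -41, 0, 5]
def dlB : List ℤ := [848, -1700, 3472, -5904, 938, -1276, -170, 360, -40, 85]
def diB : List ℤ := [0, 0, 0, 0, 0, 0, 0, 0, 0, 2]
def d9B : List ℤ := [7, 8, 2, 0, 7, 7, 8, 0, 4, 5]
def d40B : List ℤ := [0, 0, 0, 1, 0, 0, 0, 0, 0, 0]
def EB : List ED :=
  [⟨[16, 0, 128, -68, 34, -16, -8, 4, -2, 1], [4, 4, 0, 48, 6, 10, 2, -4, 0, -1], [0, 0, 0, 0, 0, 0, 0, 0, 0, 0, 0, 2, 2, 2, 0, 1, 0, 1, 1, 2]⟩,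
   ⟨[16, 8, -64, 130, -20, 32, 4, -8, 1, -2], [-4, 4, 20, -2, 24, -10, 2, -2, -1, 0], [0, 0, 0, 0, 0, 0, 0, 0, 0, 0, 0, 0, 0, 1, 2, 0, 2, 2, 0, 2]⟩,
   ⟨[-16, 24, -72, 70, -52, 0, -12, -12, -1, -2], [4, 0, -4, 34, -52, -14, -24, -14, -3, -2], [0, 0, 0, 0, 0, 0, 0, 0, 0, 0, 1, 1, 0, 1, 1, 2, 0, 1, 2, 2]⟩,
   ⟨[-4, -28, 0, -70, -6, -18, 2, 4, 1, 1], [4, 0, 4, 38, -22, 2, -8, 2, -1, 1], [0, 0, 0, 0, 0, 0, 0, 0, 0, 0, 2, 2, 0, 1, 0, 1, 1, 0, 1, 1]⟩,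
   ⟨[-64, 144, -452, 682, -116, 152, 24, -42, 5, -10], [-4, -4, 40, -54, 60, -42, 6, 0, -3, 2], [0, 0, 0, 0, 0, 0, 0, 0, 0, 0, 2, 2, 1, 0, 1, 0, 2, 2, 1, 1]⟩,
   ⟨[488, -208, 2080, -380, 464, -68, -128, 16, -30, 4], [-88, -112, -332, -516, -56, -116, 24, 34, 6, 8], [0, 0, 0, 0, 0, 0, 0, 0, 0, 0, 0, 1, 1, 1, 1, 2, 0, 2, 0, 0]⟩,
   ⟨[-476, -568, -2356, -2670, -454, -598, 172, 178, 41, 41], [124, 288, 576, 1354, 86, 310, -48, -88, -11, -21], [0, 0, 0, 0, 0, 0, 0, 0, 0, 0, 0, 0, 1, 2, 1, 2, 1, 1, 1, 2]⟩]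
def LamB : List (List ℤ) :=
   [[0, 0, 0, 0, 0, 0, 0, 0, 0, 0, 0, 1, 0, 1, 1, 0, 0, 0, 0, 0],
    [0, 0, 0, 0, 0, 0, 0, 0, 0, 0, 2, 0, 2, 0, 2, 0, 0, 1, 0, 2],
    [0, 0, 0, 0, 0, 0, 0, 0, 0, 0, 2, 2, 1, 2, 2, 0, 0, 1, 0, 2],
    [0, 0, 0, 0, 0, 0, 0, 0, 0, 0, 0, 2, 1, 1, 2, 0, 0, 0, 0, 2],
    [0, 0, 0, 0, 0, 0, 0, 0, 0, 0, 1, 0, 0, 1, 0, 0, 0, 1, 0, 0],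
    [0, 0, 0, 0, 0, 0, 0, 0, 0, 0, 2, 2, 0, 1, 1, 0, 0, 0, 0, 0],
    [0, 0, 0, 0, 0, 0, 0, 0, 0, 0, 0, 2, 1, 2, 0, 0, 0, 2, 0, 0],
    [0, 1, 2, 2, 1, 0, 2, 0, 0, 0, 0, 0, 0, 0, 0, 0, 0, 0, 0, 0],
    [1, 2, 0, 1, 1, 0, 0, 0, 0, 0, 0, 0, 0, 0, 0, 0, 0, 0, 0, 0],
    [0, 1, 1, 1, 2, 0, 1, 0, 0, 0, 0, 0, 0, 0, 0, 0, 0, 0, 0, 0],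
    [1, 1, 1, 0, 2, 0, 1, 0, 0, 0, 0, 0, 0, 0, 0, 0, 0, 0, 0, 0],
    [0, 0, 2, 2, 2, 0, 0, 0, 0, 0, 0, 0, 0, 0, 0, 0, 0, 0, 0, 0],
    [2, 1, 2, 1, 0, 0, 0, 0, 0, 0, 0, 0, 0, 0, 0, 0, 0, 0, 0, 0]]
def FB1 : FD :=
  ⟨1, [1, -8, 1, 2, 0],
   [[-32, 256, -2048, 8224, -768, 2040, 64, -512, 16, -128],
    [0, 16, -256, 1028, -96, 256, 8, -64, 2, -16],
    [0, 0, 0, 0, 0, 0, 0, 0, 0, 0],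
    [8, -64, 0, 0, 0, 4, 0, 0, 0, 0],
    [0, 0, 64, -512, 32, -128, 0, 32, 0, 8]],
   [[-64, 384, 992, 64, 256, -32, -64, -8, -16, 0],
    [-8, 48, 128, -4, 32, -4, -8, 0, -2, 0],
    [0, 0, 16, 0, 0, 0, 0, 0, 0, 0],
    [0, 0, 8, -48, 0, 0, 0, 4, 0, 0],
    [0, -24, 0, 0, 0, 0, 4, 0, 0, 0]],
   [1, 0, 0, 0, 0], [0, 0, 2, 0, 0], [0, 0, 0, 0, 0, 0, 0, 0, 0, 0, 0, 0, 2, 0, 0, 0, 0, 0, 0, 0], [0, 0, 0, 0, 0, 0, 0, 0, 0, 0, 2, 0, 2, 0, 0, 2, 0, 0, 0, 0]⟩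
def RB : List RD :=
  [⟨0, [0, 8, 5, 0, 1], [0, 2, 0, 0, 0], [0, 0, 0, 0, 0, 0, 0, 0, 0, 0, 2, 1, 2, 1, 2, 0, 0, 0, 1, 2], [0, 0, 0, 0, 0, 0, 0, 0, 0, 0, 1, 0, 1, 0, 0, 1, 0, 0, 0, 0]⟩,
   ⟨3, [0, 8, 5, 3, 1], [0, 2, 0, 0, 0], [0, 0, 0, 0, 0, 0, 0, 0, 0, 0, 2, 1, 2, 1, 1, 0, 0, 0, 1, 2], [0, 0, 0, 0, 0, 0, 0, 0, 0, 0, 1, 0, 1, 0, 0, 1, 0, 0, 0, 0]⟩,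
   ⟨6, [0, 8, 5, 6, 1], [0, 2, 0, 0, 0], [0, 0, 0, 0, 0, 0, 0, 0, 0, 0, 2, 1, 2, 1, 0, 0, 0, 0, 1, 2], [0, 0, 0, 0, 0, 0, 0, 0, 0, 0, 1, 0, 1, 0, 0, 1, 0, 0, 0, 0]⟩,
   ⟨2, [5, 6, 1, 7, 1], [0, 0, 1, 2, 2], [0, 0, 0, 0, 0, 0, 0, 0, 0, 0, 0, 2, 2, 0, 1, 2, 2, 1, 0, 0], [0, 0, 0, 0, 0, 0, 0, 0, 0, 0, 1, 0, 1, 0, 0, 1, 0, 0, 0, 0]⟩,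
   ⟨5, [2, 0, 7, 4, 4], [0, 0, 1, 2, 2], [0, 0, 0, 0, 0, 0, 0, 0, 0, 0, 0, 0, 2, 0, 2, 0, 1, 1, 2, 1], [0, 0, 0, 0, 0, 0, 0, 0, 0, 0, 2, 0, 2, 0, 0, 2, 0, 0, 0, 0]⟩,
   ⟨8, [8, 3, 4, 1, 7], [0, 0, 1, 2, 2], [0, 0, 0, 0, 0, 0, 0, 0, 0, 0, 0, 1, 2, 0, 0, 1, 0, 1, 1, 2], [0, 0, 0, 0, 0, 0, 0, 0, 0, 0, 0, 1, 0, 2, 0, 0, 2, 0, 0, 0]⟩]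

lemma setB_ok : setOK dlB d9B d40B diB EB UD LamB = true := by decide +kernel
lemma FB_ok : ((FB1 :: []).all fun F => fdOK kapB dlB ((EB ++ UD).map ED.w) F) = true := by
  decide +kernel
lemma RB_ok : (RB.all fun r =>
    resOK kapB FB1.T FB1.R d9B d40B ((EB ++ UD).map ED.w) r.x r.e r.nu r.w r.lam) = true := by
  decide +kernel

lemma classB (X : ℤ) (η : 𝓞 K) (h : ev piO kapB * η ^ 2 = ev piO (BL X)) : X = 1 := by
  have := class_gen (kap := kapB) (dl := dlB) (by decide +kernel) 7 (by decide +kernel) 2 (by decide +kernel)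
    (by decide +kernel) UD_ok setB_ok FB1 [] RB FB_ok RB_ok (by decide +kernel) X η h
  simpa [FB1] using this

def kapC : List ℤ := [17, 0, -8, 0, 1]
def dlC : List ℤ := [136, -68, 544, -32, 120, 0, -34, 0, -8, 0]
def diC : List ℤ := [0, 1, 0, 2, 2, 2, 2, 0, 0, 0]
def d9C : List ℤ := [8, 5, 5, 5, 6, 0, 7, 0, 8, 0]
def d40C : List ℤ := [2, 1, 2, 0, 2, 1, 1, 1, 1, 0]
def EC : List ED :=
  [⟨[-16, -16, -144, -132, -96, -64, -24, -8, -2, 0], [0, 0, 8, 68, 32, 32, 16, 4, 2, 0], [0, 0, 0, 0, 0, 0, 0, 0, 0, 0, 1, 2, 2, 0, 1, 1, 1, 2, 2, 0]⟩,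
   ⟨[-24, -16, 128, -276, 40, -68, -8, 16, -2, 4], [24, 8, -64, -12, -32, -4, 4, 0, 2, 0], [0, 0, 0, 0, 0, 0, 0, 0, 0, 0, 0, 0, 1, 1, 1, 2, 1, 1, 1, 0]⟩,
   ⟨[-748, 2240, -3784, 8520, -1104, 1866, 168, -524, 40, -124], [-132, 352, -584, 1492, -180, 334, 24, -92, 6, -22], [0, 0, 0, 0, 0, 0, 0, 0, 0, 0, 1, 2, 0, 0, 2, 1, 1, 1, 1, 1]⟩,
   ⟨[84, -32, 32, -136, 4, -30, 0, 8, 0, 2], [28, 32, -40, -152, -12, -26, 0, 12, 0, 2], [0, 0, 0, 0, 0, 0, 0, 0, 0, 0, 2, 1, 0, 1, 0, 0, 2, 2, 1, 1]⟩,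
   ⟨[0, 144, -264, 1092, -96, 248, 8, -68, 2, -16], [-32, 48, 88, 60, 32, 0, -8, -4, -2, 0], [0, 0, 0, 0, 0, 0, 0, 0, 0, 0, 1, 1, 1, 2, 2, 2, 1, 1, 2, 0]⟩,
   ⟨[-12, 24, -48, 16, -72, -6, 4, 0, 4, 0], [-12, 8, 16, -36, 84, 42, -4, 0, -6, -2], [0, 0, 0, 0, 0, 0, 0, 0, 0, 0, 0, 0, 1, 1, 0, 1, 0, 0, 2, 1]⟩,
   ⟨[296, -744, 1484, -2756, 408, -612, -76, 166, -18, 40], [-56, 120, -268, 360, -52, 84, 20, -22, 4, -6], [0, 0, 0, 0, 0, 0, 0, 0, 0, 0, 2, 2, 1, 1, 2, 1, 0, 0, 0, 2]⟩]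
def LamC : List (List ℤ) :=
   [[0, 0, 0, 0, 0, 0, 0, 0, 0, 0, 2, 0, 2, 0, 1, 1, 0, 1, 0, 0],
    [0, 0, 0, 0, 0, 0, 0, 0, 0, 0, 1, 2, 0, 2, 0, 1, 0, 0, 0, 0],
    [0, 0, 0, 0, 0, 0, 0, 0, 0, 0, 0, 1, 0, 0, 2, 0, 0, 1, 0, 0],
    [0, 0, 0, 0, 0, 0, 0, 0, 0, 0, 0, 0, 2, 0, 0, 1, 0, 2, 0, 0],
    [0, 0, 0, 0, 0, 0, 0, 0, 0, 0, 1, 0, 1, 1, 2, 1, 0, 0, 0, 0],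
    [0, 0, 0, 0, 0, 0, 0, 0, 0, 0, 1, 0, 1, 2, 0, 1, 0, 1, 0, 0],
    [0, 0, 0, 0, 0, 0, 0, 0, 0, 0, 2, 1, 1, 1, 2, 1, 0, 0, 0, 0],
    [0, 1, 2, 2, 1, 0, 2, 0, 0, 0, 0, 0, 0, 0, 0, 0, 0, 0, 0, 0],
    [1, 2, 0, 1, 1, 0, 0, 0, 0, 0, 0, 0, 0, 0, 0, 0, 0, 0, 0, 0],
    [0, 1, 1, 1, 2, 0, 1, 0, 0, 0, 0, 0, 0, 0, 0, 0, 0, 0, 0, 0],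
    [1, 1, 1, 0, 2, 0, 1, 0, 0, 0, 0, 0, 0, 0, 0, 0, 0, 0, 0, 0],
    [0, 0, 2, 2, 2, 0, 0, 0, 0, 0, 0, 0, 0, 0, 0, 0, 0, 0, 0, 0],
    [2, 1, 2, 1, 0, 0, 0, 0, 0, 0, 0, 0, 0, 0, 0, 0, 0, 0, 0, 0]]
def FC3 : FD :=
  ⟨3, [1, -9, 5, 2, -1],
   [[32, -240, 1792, -7196, 672, -1784, -56, 448, -14, 112],
    [8, -80, 256, -1028, 96, -252, -8, 64, -2, 16],
    [8, -64, 64, -512, 32, -124, 0, 32, 0, 8],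
    [-8, -192, 64, -512, 32, -116, 0, 32, 0, 8],
    [0, -224, -64, -1528, 32, -368, 16, 96, 4, 24]],
   [[-320, 376, 1120, -452, 336, -160, -68, 24, -18, 8],
    [-40, 48, 128, -4, 32, -4, -8, 0, -2, 0],
    [-8, 32, 16, 0, 0, -4, 0, 0, 0, 0],
    [0, 0, -24, 208, -24, 64, 0, -12, 0, -4],
    [0, 104, 0, 0, 0, -16, 4, 0, 0, 0]],
   [1, 2, 2, 0, 1], [0, 1, 0, 1, 2], [0, 0, 0, 0, 0, 0, 0, 0, 0, 0, 2, 1, 2, 0, 2, 1, 0, 0, 1, 2], [0, 0, 0, 0, 0, 0, 0, 0, 0, 0, 1, 0, 1, 0, 2, 2, 2, 0, 0, 0]⟩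
def RC : List RD :=
  [⟨1, [1, 2, 0, 0, 5], [1, 2, 2, 1, 2], [0, 0, 0, 0, 0, 0, 0, 0, 0, 0, 1, 2, 2, 2, 0, 1, 0, 2, 2, 1], [0, 0, 0, 0, 0, 0, 0, 0, 0, 0, 2, 0, 2, 0, 1, 1, 1, 0, 0, 0]⟩,
   ⟨4, [4, 2, 3, 6, 5], [1, 2, 2, 1, 2], [0, 0, 0, 0, 0, 0, 0, 0, 0, 0, 0, 1, 1, 2, 1, 2, 2, 0, 0, 0], [0, 0, 0, 0, 0, 0, 0, 0, 0, 0, 2, 0, 2, 0, 1, 1, 1, 0, 0, 0]⟩,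
   ⟨7, [7, 2, 6, 3, 5], [1, 2, 2, 1, 2], [0, 0, 0, 0, 0, 0, 0, 0, 0, 0, 2, 0, 0, 2, 2, 0, 1, 1, 1, 2], [0, 0, 0, 0, 0, 0, 0, 0, 0, 0, 2, 0, 2, 0, 1, 1, 1, 0, 0, 0]⟩,
   ⟨2, [0, 2, 5, 4, 1], [0, 2, 0, 0, 0], [0, 0, 0, 0, 0, 0, 0, 0, 0, 0, 1, 0, 0, 2, 2, 2, 2, 1, 2, 2], [0, 0, 0, 0, 0, 0, 0, 0, 0, 0, 1, 0, 1, 0, 2, 2, 2, 0, 0, 0]⟩,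
   ⟨5, [0, 2, 5, 7, 1], [0, 2, 0, 0, 0], [0, 0, 0, 0, 0, 0, 0, 0, 0, 0, 1, 0, 0, 2, 1, 2, 2, 1, 2, 2], [0, 0, 0, 0, 0, 0, 0, 0, 0, 0, 2, 0, 2, 0, 1, 1, 1, 0, 0, 0]⟩,
   ⟨8, [0, 2, 5, 1, 1], [0, 2, 0, 0, 0], [0, 0, 0, 0, 0, 0, 0, 0, 0, 0, 1, 0, 0, 2, 0, 2, 2, 1, 2, 2], [0, 0, 0, 0, 0, 0, 0, 0, 0, 0, 0, 0, 1, 2, 2, 2, 0, 1, 2, 0]⟩]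

lemma setC_ok : setOK dlC d9C d40C diC EC UD LamC = true := by decide +kernel
lemma FC_ok : ((FC3 :: []).all fun F => fdOK kapC dlC ((EC ++ UD).map ED.w) F) = true := by
  decide +kernel
lemma RC_ok : (RC.all fun r =>
    resOK kapC FC3.T FC3.R d9C d40C ((EC ++ UD).map ED.w) r.x r.e r.nu r.w r.lam) = true := by
  decide +kernel

lemma classC (X : ℤ) (η : 𝓞 K) (h : ev piO kapC * η ^ 2 = ev piO (BL X)) : X = 3 := by
  have := class_gen (kap := kapC) (dl := dlC) (by decide +kernel) 11 (by decide +kernel) 6 (by decide +kernel)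
    (by decide +kernel) UD_ok setC_ok FC3 [] RC FC_ok RC_ok (by decide +kernel) X η h
  simpa [FC3] using this

def T0 : List (List ℤ) :=
   [[0, 64, -2, 16, 0, -4, 0, -1, 0, 0],
    [0, 16, 0, 0, 0, 0, 0, 0, 0, 0],
    [0, 0, 0, 64, -2, 16, 0, -4, 0, -1],
    [4, 32, 0, 0, 0, 2, 0, 0, 0, 0],
    [0, -4, 32, 256, -8, 64, -2, -16, 0, -4]]
def R0 : List (List ℤ) :=
   [[-8, 128, -514, 48, -128, -4, 32, -1, 8, 0],
    [0, 0, 0, 0, 0, 0, 0, 0, 0, 0],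
    [32, 0, 8, -64, 2, -16, 0, 4, 0, 1],
    [0, -32, 256, -16, 64, 0, -16, 0, -4, 0],
    [128, 0, 0, 0, -8, 0, 0, 0, 0, 0]]
def Lam0 : List (List ℤ) :=
   [[0, 1, 2, 2, 1, 0, 2, 0, 0, 0],
    [1, 2, 0, 1, 1, 0, 0, 0, 0, 0],
    [0, 1, 1, 1, 2, 0, 1, 0, 0, 0],
    [1, 1, 1, 0, 2, 0, 1, 0, 0, 0],
    [0, 0, 2, 2, 2, 0, 0, 0, 0, 0],
    [2, 1, 2, 1, 0, 0, 0, 0, 0, 0]]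
def Rs0 : List RD :=
  [⟨0, [7, 8, 3, 8, 4], [2, 1, 0, 0, 2], [0, 2, 0, 2, 2, 2, 1, 1, 2, 2], [1, 1, 1, 0, 1, 0, 2, 1, 0, 0]⟩,
   ⟨3, [7, 5, 3, 5, 1], [2, 1, 0, 0, 2], [0, 0, 0, 0, 1, 1, 0, 0, 0, 0], [1, 2, 1, 0, 2, 2, 0, 0, 0, 0]⟩,
   ⟨6, [7, 2, 3, 2, 7], [2, 1, 0, 0, 2], [0, 1, 0, 1, 0, 0, 2, 2, 1, 1], [2, 1, 2, 0, 1, 1, 0, 0, 0, 0]⟩,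
   ⟨1, [7, 3, 7, 7, 4], [1, 0, 2, 1, 2], [0, 0, 2, 2, 1, 1, 1, 2, 2, 1], [1, 1, 1, 0, 1, 0, 2, 1, 0, 0]⟩,
   ⟨4, [1, 3, 1, 1, 4], [1, 0, 2, 1, 2], [0, 1, 2, 2, 2, 1, 2, 2, 2, 0], [1, 2, 1, 0, 2, 2, 0, 0, 0, 0]⟩,
   ⟨7, [4, 3, 4, 4, 4], [1, 0, 2, 1, 2], [0, 2, 2, 2, 0, 1, 0, 2, 2, 2], [2, 1, 2, 0, 1, 1, 0, 0, 0, 0]⟩,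
   ⟨2, [5, 0, 5, 1, 2], [1, 0, 0, 2, 2], [0, 0, 1, 1, 1, 1, 0, 0, 0, 0], [2, 1, 2, 0, 1, 1, 0, 0, 0, 0]⟩,
   ⟨5, [2, 3, 8, 7, 8], [1, 0, 0, 2, 2], [0, 1, 0, 2, 2, 0, 1, 2, 1, 0], [1, 1, 1, 0, 1, 0, 2, 1, 0, 0]⟩,
   ⟨8, [8, 6, 2, 4, 5], [1, 0, 0, 2, 2], [0, 2, 2, 0, 0, 2, 2, 1, 2, 0], [1, 2, 1, 0, 2, 2, 0, 0, 0, 0]⟩]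

lemma Rs0_ok : (Rs0.all fun r => res0OK T0 (UD.map ED.w) r.x r.e r.nu r.w r.lam) = true := by
  decide +kernel

lemma class0 (X : ℤ) (η : 𝓞 K) (h : ev piO [1] * η ^ 2 = ev piO (BL X)) : False := by
  obtain ⟨S, hS⟩ := exists_S0 (U := UD) (Lam := Lam0) (by decide +kernel) UD_ok (by decide +kernel)
  have hm : modOK Rs0 [] = true := by decide +kernel
  obtain ⟨x, hx9, hxX⟩ : ∃ x : ℕ, x < 9 ∧ (9 : ℤ) ∣ X - x :=
    ⟨(X % 9).toNat, by omega, by omega⟩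
  have hmx := (List.all_eq_true.1 hm) x (by simpa using hx9)
  rw [Bool.or_eq_true, List.any_eq_true, List.any_eq_true] at hmx
  rcases hmx with ⟨r, hr, hrx⟩ | ⟨F, hFm, hFx⟩
  · simp only [beq_iff_eq] at hrx
    exact res_kill0 (T := T0) (R := R0) (by decide +kernel) S hS r.x r.e r.nu r.w r.lam
      ((List.all_eq_true.1 Rs0_ok) r hr) X (by omega) η h
  · simp at hFm

end
end Skl


namespace Skl

lemma main_pos (X Y : ℤ) (hX : 1 ≤ X) (h : 4 * X ^ 5 - 4 * X + 1 = (2 * Y - 1) ^ 2) :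
    X = 1 ∨ X = 2 ∨ X = 3 ∨ X = 30 := by
  obtain ⟨j, hj, k, hk, η, hη⟩ := K_descent X Y hX h
  have eA : ev piO kapA = ev piO [5, 0, -1] := ev_eq0 piO (by decide +kernel)
  have eB : ev piO kapB = ev piO [5, 0, -1] * ev piO [17, 0, -8, 0, 1] := by
    rw [← ev_mulM0 piO piO_relK]
    exact ev_eq0 piO (by decide +kernel)
  interval_cases j <;> interval_cases k
  · exfalso
    refine class0 X η ?_
    rw [hη]; simp [uval]
  · have := classC X η (by rw [hη, kapC]; simp only [uval]; ring)
    omega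
  · have := classA X η (by rw [hη, eA]; simp only [uval]; ring)
    omega
  · have := classB X η (by rw [hη, eB]; simp only [uval]; ring)
    omega

end Skl

/-- The only integral solutions to the equation `Y² - Y = X⁵ - X` are
`(-1,0), (-1,1), (0,0), (0,1), (1,0), (1,1), (2,-5), (2,6), (3,-15), (3,16),
(30,-4929), (30,4930)`. -/
theorem integral_points_Y2_sub_Y_eq_X5_sub_X (X Y : ℤ) :
    Y ^ 2 - Y = X ^ 5 - X ↔
      (X, Y) ∈ ({(-1, 0), (-1, 1), (0, 0), (0, 1), (1, 0), (1, 1), (2, -5), (2, 6),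
        (3, -15), (3, 16), (30, -4929), (30, 4930)} : Set (ℤ × ℤ)) := by
  simp only [Set.mem_insert_iff, Set.mem_singleton_iff, Prod.mk.injEq]
  constructor
  · intro h
    have key : ∀ a b : ℤ, (Y - a) * (Y - b) = 0 → Y = a ∨ Y = b := by
      intro a b hab
      rcases mul_eq_zero.1 hab with h1 | h1
      · left; linarith
      · right; linarith
    have hcases : X ≤ -2 ∨ X = -1 ∨ X = 0 ∨ 1 ≤ X := by omega
    rcases hcases with h1 | h1 | h1 | h1
    · exfalso
      have h2 : 4 * (X ^ 5 - X) + 1 = (2 * Y - 1) ^ 2 := by rw [← h]; ring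
      have h3 : 0 ≤ (2 * Y - 1) ^ 2 := sq_nonneg _
      have h4 : (4 : ℤ) ≤ X ^ 2 := by nlinarith
      have h5 : (16 : ℤ) ≤ X ^ 4 := by nlinarith
      have h6 : X ^ 5 - X = X * (X ^ 4 - 1) := by ring
      have h7 : X * (X ^ 4 - 1) ≤ -2 * (X ^ 4 - 1) := mul_le_mul_of_nonneg_right h1 (by linarith)
      linarith
    · subst h1
      rcases key 0 1 (by linear_combination h) with rfl | rfl <;> simp
    · subst h1
      rcases key 0 1 (by linear_combination h) with rfl | rfl <;> simp
    · rcases Skl.main_pos X Y h1 (by linear_combination -4 * h) with h2 | h2 | h2 | h2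
      · subst h2
        rcases key 0 1 (by linear_combination h) with rfl | rfl <;> simp
      · subst h2
        rcases key (-5) 6 (by linear_combination h) with rfl | rfl <;> simp
      · subst h2
        rcases key (-15) 16 (by linear_combination h) with rfl | rfl <;> simp
      · subst h2
        rcases key (-4929) 4930 (by linear_combination h) with rfl | rfl <;> simp
  · rintro (⟨rfl, rfl⟩ | ⟨rfl, rfl⟩ | ⟨rfl, rfl⟩ | ⟨rfl, rfl⟩ | ⟨rfl, rfl⟩ | ⟨rfl, rfl⟩ | ⟨rfl, rfl⟩ |
      ⟨rfl, rfl⟩ | ⟨rfl, rfl⟩ | ⟨rfl, rfl⟩ | ⟨rfl, rfl⟩ | ⟨rfl, rfl⟩) <;> norm_num
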